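/- Let d ≥ 5 and n ≥ 4. HAT is transient: for every n-element configuration U ⊂ Z^d, P_U-almost surely the set of times {t ≥ 0 : Û_t = Û} is finite. -/

import Mathlib

open MeasureTheory

namespace HATFormal

/-- Points of the lattice `ℤ^d`. -/
abbrev Pt (d : ℕ) := Fin d → ℤ

/-- The `2d` unit steps of the simple random walk on `ℤ^d`. -/
def Dir (d : ℕ) : Set (Pt d) :=
  {s | ∃ i : Fin d, s = Pi.single i 1 ∨ s = Pi.single i (-1)}

/-- The position, after `t` steps, of the walk started at `x` with steps `s`. -/
def wpos (d : ℕ) (x : Pt d) {T : ℕ} (s : Fin T → Pt d) (t : ℕ) : Pt d :=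
  x + ∑ i ∈ Finset.univ.filter (fun i : Fin T => (i : ℕ) < t), s i

/-- The probability of an event `P` of the first `T` steps of simple random walk on `ℤ^d`. -/
noncomputable def prob (d T : ℕ) (P : (Fin T → Pt d) → Prop) : ℝ :=
  (Nat.card {s : Fin T → Pt d // (∀ i, s i ∈ Dir d) ∧ P s} : ℝ) / ((2 * d : ℕ) : ℝ) ^ T

open Classical in
/-- `esc d A x = P_x(τ_A = ∞)` if `x ∈ A`, and `0` otherwise. -/
noncomputable def esc (d : ℕ) (A : Set (Pt d)) (x : Pt d) : ℝ :=
  if x ∈ A then ⨅ T : ℕ, prob d T (fun s => ∀ t, 1 ≤ t → t ≤ T → wpos d x s t ∉ A) else 0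

/-- The capacity of `A`. -/
noncomputable def capa (d : ℕ) (A : Set (Pt d)) : ℝ := ∑' x : A, esc d A (x : Pt d)

/-- The harmonic measure `H_A(x) = esc_A(x) / cap_A`. -/
noncomputable def harm (d : ℕ) (A : Set (Pt d)) (x : Pt d) : ℝ := esc d A x / capa d A

/-- `P_x(τ_W < ∞)`. -/
noncomputable def retProb (d : ℕ) (W : Set (Pt d)) (x : Pt d) : ℝ :=
  ∑' t : ℕ, prob d t (fun s => 1 ≤ t ∧ wpos d x s t ∈ W ∧
    ∀ u, 1 ≤ u → u < t → wpos d x s u ∉ W)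

/-- `P_x(τ_W < ∞ and S_{τ_W − 1} = y)`. -/
noncomputable def hitFrom (d : ℕ) (W : Set (Pt d)) (x y : Pt d) : ℝ :=
  ∑' t : ℕ, prob d t (fun s => 1 ≤ t ∧ wpos d x s t ∈ W ∧ wpos d x s (t - 1) = y ∧
    ∀ u, 1 ≤ u → u < t → wpos d x s u ∉ W)

/-- `P_x(τ_W < ∞ and S_{τ_W} ∈ T)`. -/
noncomputable def firstHitIn (d : ℕ) (W T : Set (Pt d)) (x : Pt d) : ℝ :=
  ∑' t : ℕ, prob d t (fun s => 1 ≤ t ∧ wpos d x s t ∈ W ∧ wpos d x s t ∈ T ∧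
    ∀ u, 1 ≤ u → u < t → wpos d x s u ∉ W)

/-- `P_x(S_{τ_W − 1} = y ∣ τ_W < ∞)`. -/
noncomputable def transP (d : ℕ) (W : Set (Pt d)) (x y : Pt d) : ℝ :=
  hitFrom d W x y / retProb d W x

/-- The Green's function of simple random walk on `ℤ^d`. -/
noncomputable def green (d : ℕ) (x : Pt d) : ℝ :=
  ∑' t : ℕ, prob d t (fun s => wpos d x s t = 0)

/-- Configurations: finite subsets of `ℤ^d`. -/
abbrev Conf (d : ℕ) := Finset (Pt d)

/-- `p_U(x, y)`, the probability that HAT activates at `x` and transports to `y`. -/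
noncomputable def pHAT (d : ℕ) (U : Conf d) (x y : Pt d) : ℝ :=
  harm d (↑U) x * transP d ((↑U : Set (Pt d)) \ {x}) x y

open Classical in
/-- The transition probabilities of HAT. -/
noncomputable def hatProb (d : ℕ) (U V : Conf d) : ℝ :=
  if V = U then ∑' z : Pt d, pHAT d U z z
  else ∑' x : Pt d, ∑' y : Pt d,
    if x ∈ U ∧ x ≠ y ∧ V = insert y (U.erase x) then pHAT d U x y else 0

instance (d : ℕ) : MeasurableSpace (Conf d) := ⊤

/-- `μ` is the law of HAT started from `U`. -/
def IsHATLaw (d : ℕ) (U : Conf d) (μ : Measure (ℕ → Conf d)) : Prop :=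
  IsProbabilityMeasure μ ∧
  ∀ (t : ℕ) (u : ℕ → Conf d),
    μ {ω | ∀ s ≤ t, ω s = u s} =
      (if u 0 = U then 1 else 0) *
        ∏ s ∈ Finset.range t, ENNReal.ofReal (hatProb d (u s) (u (s + 1)))

/-- A signed permutation plus translation of `ℤ^d`. -/
def SymImage (d : ℕ) (σ : Equiv.Perm (Fin d)) (ε : Fin d → ℤ) (v : Pt d) (x : Pt d) : Pt d :=
  fun i => v i + ε i * x (σ i)

/-- `SymEq d U V` holds when `V = gU` for a symmetry `g` of `ℤ^d`. -/
def SymEq (d : ℕ) (U V : Conf d) : Prop :=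
  ∃ (σ : Equiv.Perm (Fin d)) (ε : Fin d → ℤ) (v : Pt d),
    (∀ i, ε i = 1 ∨ ε i = -1) ∧ V = U.image (SymImage d σ ε v)

/-- Euclidean distance on `ℤ^d`. -/
noncomputable def dist0 (d : ℕ) (x y : Pt d) : ℝ :=
  Real.sqrt (∑ i, ((x i : ℝ) - (y i : ℝ)) ^ 2)

/-- Euclidean distance between finite subsets of `ℤ^d`. -/
noncomputable def setDist (d : ℕ) (A B : Finset (Pt d)) : ℝ :=
  sInf {r : ℝ | ∃ x ∈ A, ∃ y ∈ B, r = dist0 d x y}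

/-- Euclidean diameter of a finite subset of `ℤ^d`. -/
noncomputable def diam0 (d : ℕ) (A : Finset (Pt d)) : ℝ :=
  sSup {r : ℝ | ∃ x ∈ A, ∃ y ∈ A, r = dist0 d x y}

/-- Lattice (nearest-neighbor) adjacency in `ℤ^d`. -/
def latAdj (d : ℕ) (x y : Pt d) : Prop := (∑ i, (x i - y i).natAbs) = 1

/-- Exterior lattice boundary of a set. -/
def bdry (d : ℕ) (A : Set (Pt d)) : Set (Pt d) := {z | z ∉ A ∧ ∃ w ∈ A, latAdj d z w}

/-- Non-isolated configurations: some exposed element has a lattice neighbor in the set. -/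
def NonIso (d : ℕ) (U : Conf d) : Prop :=
  ∃ x ∈ U, 0 < esc d (↑U) x ∧ ∃ y ∈ U, latAdj d x y

/-- `C` is a clustering (ordered partition into nonempty clusters) of `U`. -/
def IsClusteringOf (d : ℕ) {k : ℕ} (C : Fin k → Finset (Pt d)) (U : Finset (Pt d)) : Prop :=
  (∀ i, (C i).Nonempty) ∧ (∀ i j, i ≠ j → Disjoint (C i) (C j)) ∧
    Finset.univ.biUnion C = U

/-- `C^{≠ i}`, the union of the clusters other than `i`. -/
def others (d : ℕ) {k : ℕ} (C : Fin k → Finset (Pt d)) (i : Fin k) : Finset (Pt d) :=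
  Finset.univ.biUnion fun j => if j = i then ∅ else C j

/-- The separation of a clustering. -/
noncomputable def sep (d : ℕ) {k : ℕ} (C : Fin k → Finset (Pt d)) : ℝ :=
  ⨅ i, setDist d (C i) (others d C i)

/-- `(a, b)` separated dimer-or-trimer (DOT) clusterings. -/
def IsDOT (d : ℕ) {k : ℕ} (C : Fin k → Finset (Pt d)) (a b : ℝ) : Prop :=
  (∀ i, (C i).card = 2 ∨ (C i).card = 3) ∧ a ≤ sep d C ∧
    ∀ i, diam0 d (C i) ≤ b * Real.log (setDist d (C i) (others d C i))

/-- Clusterings with an unspecified number of clusters. -/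
abbrev ClusteringS (d : ℕ) := Σ k : ℕ, Fin k → Finset (Pt d)

/-- `π(C)`, the union of the clusters of `C`. -/
def confOf (d : ℕ) (C : ClusteringS d) : Conf d := Finset.univ.biUnion C.2

/-- `C ∈ 𝒞(U, a, b)`. -/
def InC (d : ℕ) (U : Conf d) (a b : ℝ) (C : ClusteringS d) : Prop :=
  IsClusteringOf d C.2 U ∧ IsDOT d C.2 a b

/-- `U ∈ 𝒰_{d,n}(a, b)`. -/
def InU (d n : ℕ) (a b : ℝ) (U : Conf d) : Prop :=
  U.card = n ∧ ∃ C : ClusteringS d, InC d U a b C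

/-- `C` is a clustering of an `n`-element configuration. -/
def IsClusteringConf (d n : ℕ) (C : ClusteringS d) : Prop :=
  (∀ i, (C.2 i).Nonempty) ∧ (∀ i j, i ≠ j → Disjoint (C.2 i) (C.2 j)) ∧
    (confOf d C).card = n

open Classical in
/-- One step of the natural clustering. -/
noncomputable def clustStep (d : ℕ) (Ut Ut1 : Conf d) (C : ClusteringS d) : ClusteringS d :=
  if Ut1 = Ut then C
  else if h : ∃ p : Pt d × Pt d × Fin C.1,
      Ut \ Ut1 = {p.1} ∧ Ut1 \ Ut = {p.2.1} ∧ p.1 ∈ C.2 p.2.2 then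
    ⟨C.1, Function.update C.2 h.choose.2.2
      (insert h.choose.2.1 ((C.2 h.choose.2.2).erase h.choose.1))⟩
  else ⟨1, fun _ => Ut1⟩

/-- The natural clustering of the trajectory `ω` with initial clustering `C0`. -/
noncomputable def natClust (d : ℕ) (ω : ℕ → Conf d) (C0 : ClusteringS d) : ℕ → ClusteringS d
  | 0 => C0
  | t + 1 => clustStep d (ω t) (ω (t + 1)) (natClust d ω C0 t)

/-- `a_s = s^{1/2 − n^{−100}} + 100 n`. -/
noncomputable def aSep (n s : ℕ) : ℝ :=
  (s : ℝ) ^ ((1 : ℝ) / 2 - (n : ℝ) ^ (-(100 : ℝ))) + 100 * n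

/-- `C^{i, x, y}`: remove `x` from cluster `i` of `C` and add `y` to that cluster. -/
def updC (d : ℕ) (C : ClusteringS d) (i : Fin C.1) (x y : Pt d) : ClusteringS d :=
  ⟨C.1, Function.update C.2 i (insert y ((C.2 i).erase x))⟩

open Classical in
/-- The transition probabilities of the lifting of HAT to clusterings. -/
noncomputable def liftProb (d : ℕ) (E0 E1 : ClusteringS d) : ℝ :=
  ∑' x : Pt d, ∑' y : Pt d,
    if ∃ i : Fin E0.1, x ∈ E0.2 i ∧ E1 = updC d E0 i x y
    then pHAT d (confOf d E0) x y else 0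

/-- The capacity of a clustering: the sum of the capacities of its clusters. -/
noncomputable def capS (d : ℕ) (C : ClusteringS d) : ℝ := ∑ i, capa d (↑(C.2 i))

/-- `H_C(i, x) = esc_{C^i}(x) / cap_C`. -/
noncomputable def harmS (d : ℕ) (C : ClusteringS d) (i : Fin C.1) (x : Pt d) : ℝ :=
  esc d (↑(C.2 i)) x / capS d C

/-- `q_C(i, x, y)`. -/
noncomputable def qIHAT (d : ℕ) (C : ClusteringS d) (i : Fin C.1) (x y : Pt d) : ℝ :=
  harmS d C i x * transP d ((↑(C.2 i) : Set (Pt d)) \ {x}) x y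

open Classical in
/-- The transition probabilities of intracluster HAT (IHAT). -/
noncomputable def ihatProb (d : ℕ) (D E : ClusteringS d) : ℝ :=
  ∑' x : Pt d, ∑' y : Pt d, ∑ i : Fin D.1,
    if x ∈ D.2 i ∧ E = updC d D i x y then qIHAT d D i x y else 0

instance (d : ℕ) : MeasurableSpace (ClusteringS d) := ⊤

open Classical in
/-- `μ` is the law of the lifted HAT chain started from `E0`. -/
def IsLiftLaw (d : ℕ) (E0 : ClusteringS d) (μ : Measure (ℕ → ClusteringS d)) : Prop :=
  IsProbabilityMeasure μ ∧
  ∀ (t : ℕ) (u : ℕ → ClusteringS d),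
    μ {ω | ∀ s ≤ t, ω s = u s} =
      (if u 0 = E0 then 1 else 0) *
        ∏ s ∈ Finset.range t, ENNReal.ofReal (liftProb d (u s) (u (s + 1)))

open Classical in
/-- `μ` is the law of intracluster HAT started from `D0`. -/
def IsIHATLaw (d : ℕ) (D0 : ClusteringS d) (μ : Measure (ℕ → ClusteringS d)) : Prop :=
  IsProbabilityMeasure μ ∧
  ∀ (t : ℕ) (u : ℕ → ClusteringS d),
    μ {ω | ∀ s ≤ t, ω s = u s} =
      (if u 0 = D0 then 1 else 0) *
        ∏ s ∈ Finset.range t, ENNReal.ofReal (ihatProb d (u s) (u (s + 1)))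

/-- `Pairs(E0, E1)`. -/
def Pairs (d : ℕ) (E0 E1 : ClusteringS d) : Set (Pt d × Pt d) :=
  {p | 0 < pHAT d (confOf d E0) p.1 p.2 ∧
    ∃ i : Fin E0.1, p.1 ∈ E0.2 i ∧ E1 = updC d E0 i p.1 p.2}

/-- `Triples(E0, E1)`. -/
def Triples (d : ℕ) (E0 E1 : ClusteringS d) : Set (Fin E0.1 × Pt d × Pt d) :=
  {q | 0 < qIHAT d E0 q.1 q.2.1 q.2.2 ∧ E1 = updC d E0 q.1 q.2.1 q.2.2}

/-- The first standard basis vector of `ℤ^d`. -/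
def e1v (d : ℕ) : Pt d := fun i => if (i : ℕ) = 0 then 1 else 0

/-- Reference dimers and trimers. -/
def Ref (d : ℕ) : Set (Finset (Pt d)) :=
  {A | ∃ x : Pt d, A = {x, x + e1v d} ∨ A = {x, x + e1v d, x + e1v d + e1v d}}

/-- *-adjacency in `ℤ^d`: distinct points differing by at most one in each coordinate. -/
def starAdj (d : ℕ) (x y : Pt d) : Prop := x ≠ y ∧ ∀ i, (x i - y i).natAbs ≤ 1

/-- The *-visible boundary of `A`. -/
def visBdry (d : ℕ) (A : Finset (Pt d)) : Set (Pt d) :=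
  {x | (∃ y ∈ A, starAdj d x y) ∧
    ∃ γ : ℕ → Pt d, γ 0 = x ∧ (∀ t, latAdj d (γ t) (γ (t + 1))) ∧
      (∀ t, γ t ∉ A) ∧ ∀ r : ℝ, ∃ t, r < dist0 d (γ t) 0}

/-- `A` is connected in the nearest-neighbor graph of `ℤ^d`. -/
def LatConnected (d : ℕ) (A : Finset (Pt d)) : Prop :=
  ∀ x ∈ A, ∀ y ∈ A, ∃ (L : ℕ) (γ : ℕ → Pt d), γ 0 = x ∧ γ L = y ∧
    (∀ t < L, latAdj d (γ t) (γ (t + 1))) ∧ ∀ t ≤ L, γ t ∈ A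

/-- Strict lexicographic order on `ℤ^d`. -/
def lexLt (d : ℕ) (x y : Pt d) : Prop :=
  ∃ i : Fin d, (∀ j, j < i → x j = y j) ∧ x i < y i

/-- `x` is the lex (least) element of `A`. -/
def IsLex (d : ℕ) (A : Finset (Pt d)) (x : Pt d) : Prop :=
  x ∈ A ∧ ∀ y ∈ A, y ≠ x → lexLt d x y

open MeasureTheory

section Walk
open Classical
open scoped ENNReal

variable {d : ℕ}

/-- Unit steps, indexed by direction and sign. -/
def stp (s : Fin d × Bool) : Pt d := Pi.single s.1 (if s.2 then 1 else -1)

lemma stp_injective : Function.Injective (stp (d := d)) := by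
  rintro ⟨i, a⟩ ⟨j, b⟩ h
  have hij : i = j := by
    by_contra hne
    have := congrFun h i
    simp only [stp, Pi.single_eq_same, Pi.single_eq_of_ne hne] at this
    cases a <;> simp at this
  subst hij
  have := congrFun h i
  simp only [stp, Pi.single_eq_same] at this
  cases a <;> cases b <;> simp_all

lemma mem_Dir_iff (e : Pt d) : e ∈ Dir d ↔ ∃ s, stp s = e := by
  constructor
  · rintro ⟨i, h | h⟩
    · exact ⟨(i, true), by simp [stp, h]⟩
    · exact ⟨(i, false), by simp [stp, h]⟩
  · rintro ⟨⟨i, a⟩, h⟩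
    cases a
    · exact ⟨i, Or.inr (by simp [← h, stp])⟩
    · exact ⟨i, Or.inl (by simp [← h, stp])⟩

/-- Average over the `2d` steps. -/
noncomputable def av (f : Fin d × Bool → ℝ≥0∞) : ℝ≥0∞ := ((2 * d : ℕ) : ℝ≥0∞)⁻¹ * ∑ s, f s

lemma av_mono {f g : Fin d × Bool → ℝ≥0∞} (h : ∀ s, f s ≤ g s) : av f ≤ av g := by
  unfold av
  gcongr with s
  exact h s

lemma av_add (f g : Fin d × Bool → ℝ≥0∞) : av (fun s => f s + g s) = av f + av g := by
  simp [av, Finset.sum_add_distrib, mul_add]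

lemma av_mul (c : ℝ≥0∞) (f : Fin d × Bool → ℝ≥0∞) : av (fun s => c * f s) = c * av f := by
  simp only [av, ← Finset.mul_sum]; ring

lemma av_zero : av (fun _ : Fin d × Bool => 0) = 0 := by simp [av]

lemma av_tsum {ι : Type*} (f : ι → Fin d × Bool → ℝ≥0∞) :
    av (fun s => ∑' i, f i s) = ∑' i, av (f i) := by
  unfold av
  rw [ENNReal.tsum_mul_left]
  congr 1
  rw [Summable.tsum_finsetSum]
  intros; exact ENNReal.summable

lemma av_sum {ι : Type*} (t : Finset ι) (f : ι → Fin d × Bool → ℝ≥0∞) :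
    av (fun s => ∑ i ∈ t, f i s) = ∑ i ∈ t, av (f i) := by
  unfold av
  rw [← Finset.mul_sum, Finset.sum_comm]

lemma av_const (hd : 0 < d) (c : ℝ≥0∞) : av (fun _ : Fin d × Bool => c) = c := by
  unfold av
  simp only [Finset.sum_const, Finset.card_univ, Fintype.card_prod, Fintype.card_fin,
    Fintype.card_bool, nsmul_eq_mul, ← mul_assoc]
  rw [show ((d * 2 : ℕ) : ℝ≥0∞) = ((2 * d : ℕ) : ℝ≥0∞) by rw [mul_comm],
    ENNReal.inv_mul_cancel, one_mul]
  · simp; omega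
  · exact ENNReal.natCast_ne_top _

lemma le_av (s : Fin d × Bool) (f : Fin d × Bool → ℝ≥0∞) :
    ((2 * d : ℕ) : ℝ≥0∞)⁻¹ * f s ≤ av f := by
  unfold av
  gcongr
  exact Finset.single_le_sum (f := f) (fun _ _ => bot_le) (Finset.mem_univ s)

/-- Expected value of `φ` at the last position before hitting `W`, hitting at time `t+1`. -/
noncomputable def ex (W : Set (Pt d)) (φ : Pt d → ℝ≥0∞) : ℕ → Pt d → ℝ≥0∞
  | 0, x => av fun s => if x + stp s ∈ W then φ x else 0
  | t + 1, x => av fun s => if x + stp s ∈ W then 0 else ex W φ t (x + stp s)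

/-- Expected value of `φ` at the last position before hitting `W`. -/
noncomputable def HV (W : Set (Pt d)) (φ : Pt d → ℝ≥0∞) (x : Pt d) : ℝ≥0∞ := ∑' t, ex W φ t x

lemma HV_eq (W : Set (Pt d)) (φ : Pt d → ℝ≥0∞) (x : Pt d) :
    HV W φ x = av fun s => if x + stp s ∈ W then φ x else HV W φ (x + stp s) := by
  unfold HV
  rw [tsum_eq_zero_add' ENNReal.summable]
  simp only [ex]
  rw [← av_tsum, ← av_add]
  congr 1
  ext s
  split_ifs <;> simp

lemma ex_sum_succ (W : Set (Pt d)) (φ : Pt d → ℝ≥0∞) (T : ℕ) (x : Pt d) :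
    ∑ t ∈ Finset.range (T + 1), ex W φ t x =
      av fun s => if x + stp s ∈ W then φ x else ∑ t ∈ Finset.range T, ex W φ t (x + stp s) := by
  rw [Finset.sum_range_succ']
  simp only [ex]
  rw [← av_sum, ← av_add]
  congr 1
  ext s
  split_ifs <;> simp

lemma HV_le {W : Set (Pt d)} {φ : Pt d → ℝ≥0∞} {f : Pt d → ℝ≥0∞}
    (h : ∀ x, (av fun s => if x + stp s ∈ W then φ x else f (x + stp s)) ≤ f x) (x : Pt d) :
    HV W φ x ≤ f x := by
  unfold HV
  rw [ENNReal.tsum_eq_iSup_nat]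
  refine iSup_le fun T => ?_
  induction T generalizing x with
  | zero => simp
  | succ T ih =>
    rw [ex_sum_succ]
    refine le_trans (av_mono fun s => ?_) (h x)
    split_ifs
    · exact le_rfl
    · exact ih _

lemma HV_mono {W : Set (Pt d)} {φ ψ : Pt d → ℝ≥0∞} (h : ∀ y, φ y ≤ ψ y) (x : Pt d) :
    HV W φ x ≤ HV W ψ x := by
  refine HV_le (f := HV W ψ) (fun x => ?_) x
  conv_rhs => rw [HV_eq]
  refine av_mono fun s => ?_
  split_ifs
  · exact h x
  · exact le_rfl

lemma HV_le_one (hd : 0 < d) {W : Set (Pt d)} {φ : Pt d → ℝ≥0∞} (h : ∀ y, φ y ≤ 1) (x : Pt d) :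
    HV W φ x ≤ 1 := by
  refine HV_le (f := fun _ => 1) (fun x => ?_) x
  refine le_trans (av_mono (g := fun _ => 1) fun s => ?_) (av_const hd 1).le
  split_ifs
  · exact h x
  · exact le_rfl

lemma HV_union_le {W W' : Set (Pt d)} {φ : Pt d → ℝ≥0∞} (h : ∀ y, φ y ≤ 1)
    (x : Pt d) : HV (W ∪ W') φ x ≤ HV W φ x + HV W' (fun _ => 1) x := by
  refine HV_le (f := fun x => HV W φ x + HV W' (fun _ => 1) x) (fun x => ?_) x
  show _ ≤ HV W φ x + HV W' (fun _ => 1) x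
  rw [HV_eq W, HV_eq W', ← av_add]
  refine av_mono fun s => ?_
  by_cases h1 : x + stp s ∈ W
  · simp [h1]
  · by_cases h2 : x + stp s ∈ W'
    · simp only [h1, h2, Set.mem_union, or_true, if_true, if_false]
      exact le_trans (h x) (by simp)
    · simp [h1, h2]

lemma HV_one_mono (hd : 0 < d) {W W' : Set (Pt d)} (h : W ⊆ W') (x : Pt d) :
    HV W (fun _ => 1) x ≤ HV W' (fun _ => 1) x := by
  refine HV_le (f := HV W' (fun _ => 1)) (fun x => ?_) x
  conv_rhs => rw [HV_eq]
  refine av_mono fun s => ?_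
  by_cases h1 : x + stp s ∈ W
  · simp [h1, h h1]
  · simp only [h1, if_false]
    split_ifs
    · exact HV_le_one hd (fun _ => le_rfl) _
    · exact le_rfl

lemma ex_tsum {ι : Type*} (W : Set (Pt d)) (φ : ι → Pt d → ℝ≥0∞) (t : ℕ) (x : Pt d) :
    ex W (fun y => ∑' a, φ a y) t x = ∑' a, ex W (φ a) t x := by
  induction t generalizing x with
  | zero =>
    simp only [ex]
    rw [← av_tsum]
    congr 1; ext s
    split_ifs <;> simp
  | succ t ih =>
    simp only [ex]
    rw [← av_tsum]
    congr 1; ext s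
    split_ifs
    · simp
    · exact ih _

lemma ex_mul (W : Set (Pt d)) (c : ℝ≥0∞) (φ : Pt d → ℝ≥0∞) (t : ℕ) (x : Pt d) :
    ex W (fun y => c * φ y) t x = c * ex W φ t x := by
  induction t generalizing x with
  | zero =>
    simp only [ex]
    rw [← av_mul]
    congr 1; ext s
    split_ifs <;> simp
  | succ t ih =>
    simp only [ex]
    rw [← av_mul]
    congr 1; ext s
    split_ifs
    · simp
    · exact ih _

/-- Point indicator. -/
noncomputable def ind (y : Pt d) : Pt d → ℝ≥0∞ := fun x => if x = y then 1 else 0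

/-- `P_x(τ_W < ∞, S_{τ_W-1} = y)`. -/
noncomputable def kW (W : Set (Pt d)) (x y : Pt d) : ℝ≥0∞ := HV W (ind y) x

/-- `P_x(τ_W < ∞)`. -/
noncomputable def rho (W : Set (Pt d)) (x : Pt d) : ℝ≥0∞ := HV W (fun _ => 1) x

lemma HV_eq_tsum (W : Set (Pt d)) (φ : Pt d → ℝ≥0∞) (x : Pt d) :
    HV W φ x = ∑' y, kW W x y * φ y := by
  have h : φ = fun x => ∑' y, φ y * ind y x := by
    ext x
    rw [tsum_eq_single x]
    · simp [ind]
    · intro y hy; simp [ind, hy.symm]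
  unfold kW HV
  conv_lhs => rw [h]
  simp_rw [ex_tsum, ex_mul]
  rw [ENNReal.tsum_comm]
  congr 1; ext y
  rw [ENNReal.tsum_mul_left, mul_comm]

lemma rho_eq_tsum (W : Set (Pt d)) (x : Pt d) : rho W x = ∑' y, kW W x y := by
  unfold rho; rw [HV_eq_tsum]; simp

lemma rho_le_one (hd : 0 < d) (W : Set (Pt d)) (x : Pt d) : rho W x ≤ 1 :=
  HV_le_one hd (fun _ => le_rfl) x

/-- Escape probability (ignoring membership). -/
noncomputable def es (A : Set (Pt d)) (x : Pt d) : ℝ≥0∞ := 1 - rho A x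

/-- ENNReal version of `prob`. -/
noncomputable def pr (t : ℕ) (P : (Fin t → Pt d) → Prop) : ℝ≥0∞ := ENNReal.ofReal (prob d t P)

lemma pr_eq (t : ℕ) (P : (Fin t → Pt d) → Prop) :
    pr t P = (Nat.card {s : Fin t → Fin d × Bool // P (fun i => stp (s i))} : ℝ≥0∞) *
      (((2 * d : ℕ) : ℝ≥0∞)⁻¹) ^ t := by
  have hc : Nat.card {s : Fin t → Pt d // (∀ i, s i ∈ Dir d) ∧ P s} =
      Nat.card {s : Fin t → Fin d × Bool // P (fun i => stp (s i))} := by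
    symm
    refine Nat.card_congr (Equiv.ofBijective
      (fun s => ⟨fun i => stp (s.1 i), fun i => (mem_Dir_iff _).2 ⟨_, rfl⟩, s.2⟩) ⟨?_, ?_⟩)
    · rintro ⟨s, hs⟩ ⟨s', hs'⟩ h
      simp only [Subtype.mk.injEq] at h ⊢
      ext1 i
      exact stp_injective (congrFun h i)
    · rintro ⟨s, hs, hP⟩
      choose f hf using fun i => (mem_Dir_iff _).1 (hs i)
      have : (fun i => stp (f i)) = s := funext hf
      exact ⟨⟨f, by rw [this]; exact hP⟩, by simp [this]⟩
  unfold pr prob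
  rw [hc]
  rcases Nat.eq_zero_or_pos d with rfl | hd
  · rcases Nat.eq_zero_or_pos t with rfl | ht
    · simp
    · have : IsEmpty {s : Fin t → Fin 0 × Bool // P (fun i => stp (s i))} :=
        ⟨fun s => (s.1 ⟨0, ht⟩).1.elim0⟩
      simp [ht.ne']
  · rw [ENNReal.ofReal_div_of_pos (by positivity), ENNReal.ofReal_pow (by positivity),
      ENNReal.ofReal_natCast, ENNReal.ofReal_natCast, div_eq_mul_inv, ENNReal.inv_pow]

lemma pr_zero (P : (Fin 0 → Pt d) → Prop) : pr 0 P = if P Fin.elim0 then 1 else 0 := by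
  rw [pr_eq]
  have h0 : ∀ s : Fin 0 → Fin d × Bool, (fun i => stp (s i)) = (Fin.elim0 : Fin 0 → Pt d) :=
    fun s => funext fun i => i.elim0
  split_ifs with h
  · have : Nat.card {s : Fin 0 → Fin d × Bool // P (fun i => stp (s i))} = 1 := by
      rw [Nat.card_eq_one_iff_unique]
      exact ⟨⟨fun a b => Subtype.ext (Subsingleton.elim _ _)⟩, ⟨⟨Fin.elim0, by rw [h0]; exact h⟩⟩⟩
    rw [this]; simp
  · have : IsEmpty {s : Fin 0 → Fin d × Bool // P (fun i => stp (s i))} :=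
      ⟨fun s => h (by rw [← h0 s.1]; exact s.2)⟩
    simp

lemma pr_succ (t : ℕ) (P : (Fin (t + 1) → Pt d) → Prop) :
    pr (t + 1) P = av fun s => pr t (fun r => P (Fin.cons (stp s) r)) := by
  simp_rw [pr_eq, av]
  rw [← Finset.sum_mul, pow_succ]
  have : Nat.card {s : Fin (t + 1) → Fin d × Bool // P (fun i => stp (s i))} =
      ∑ a, Nat.card {s : Fin t → Fin d × Bool // P (Fin.cons (stp a) (fun i => stp (s i)))} := by
    rw [← Nat.card_sigma]
    symm
    refine Nat.card_congr (Equiv.ofBijective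
      (fun p => ⟨Fin.cons p.1 p.2.1, ?_⟩) ⟨?_, ?_⟩)
    · have := p.2.2
      convert this using 1
      ext1 i
      refine Fin.cases ?_ (fun j => ?_) i <;> simp
    · rintro ⟨a, s, hs⟩ ⟨b, s', hs'⟩ h
      simp only [Subtype.mk.injEq] at h
      obtain ⟨h1, h2⟩ := Fin.cons_inj.1 h
      subst h1; subst h2; rfl
    · rintro ⟨s, hs⟩
      refine ⟨⟨s 0, fun i => s i.succ, ?_⟩, ?_⟩
      · convert hs using 1
        ext1 i
        refine Fin.cases ?_ (fun j => ?_) i <;> simp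
      · simp only [Subtype.mk.injEq]
        exact Fin.cons_self_tail s
  rw [this]
  push_cast
  ring

lemma wpos_zero (x : Pt d) {T : ℕ} (s : Fin T → Pt d) : wpos d x s 0 = x := by
  simp [wpos]

lemma wpos_cons (x e : Pt d) {T : ℕ} (r : Fin T → Pt d) (u : ℕ) :
    wpos d x (Fin.cons e r : Fin (T + 1) → Pt d) (u + 1) = wpos d (x + e) r u := by
  unfold wpos
  rw [Finset.sum_filter, Fin.sum_univ_succ, Finset.sum_filter]
  simp [add_assoc]

lemma pr_congr {t : ℕ} {P Q : (Fin t → Pt d) → Prop} (h : ∀ r, P r ↔ Q r) : pr t P = pr t Q := by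
  have : P = Q := funext fun r => propext (h r)
  rw [this]

lemma pr_false {t : ℕ} {P : (Fin t → Pt d) → Prop} (h : ∀ r, ¬ P r) : pr t P = 0 := by
  rw [pr_eq]
  have : IsEmpty {s : Fin t → Fin d × Bool // P (fun i => stp (s i))} := ⟨fun s => h _ s.2⟩
  simp

/-- The event in the definition of hitting from `y`. -/
lemma pr_hit (W : Set (Pt d)) (R : Pt d → Prop) (t : ℕ) (x : Pt d) :
    pr (t + 1) (fun s => wpos d x s (t + 1) ∈ W ∧ R (wpos d x s t) ∧
      ∀ u, 1 ≤ u → u < t + 1 → wpos d x s u ∉ W) = ex W (fun y => if R y then 1 else 0) t x := by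
  induction t generalizing x with
  | zero =>
    rw [pr_succ]
    simp only [ex]
    congr 1
    ext s
    rw [pr_zero]
    simp only [wpos_cons, wpos_zero]
    have : ∀ Q : Prop, (∀ u, 1 ≤ u → u < 0 + 1 → Q) := fun Q u h1 h2 => by omega
    by_cases h1 : x + stp s ∈ W
    · by_cases h2 : R x
      · rw [if_pos, if_pos h1, if_pos h2]
        exact ⟨h1, h2, fun u h1 h2 => by omega⟩
      · rw [if_neg (by tauto), if_pos h1, if_neg h2]
    · rw [if_neg (by tauto), if_neg h1]
  | succ t ih =>
    rw [pr_succ]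
    simp only [ex]
    congr 1
    ext s
    simp only [wpos_cons]
    split_ifs with h1
    · refine pr_false fun r hr => hr.2.2 1 le_rfl (by omega) ?_
      have h2 := wpos_cons x (stp s) r 0
      rw [wpos_zero] at h2
      simp only [zero_add] at h2
      rw [h2]; exact h1
    · rw [← ih]
      refine pr_congr fun r => ?_
      refine and_congr_right fun _ => and_congr_right fun _ => ?_
      constructor
      · intro h u hu1 hu2
        have := h (u + 1) (by omega) (by omega)
        rwa [wpos_cons] at this
      · intro h u hu1 hu2
        obtain ⟨u, rfl⟩ : ∃ v, u = v + 1 := ⟨u - 1, by omega⟩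
        rw [wpos_cons]
        rcases Nat.eq_zero_or_pos u with rfl | hu
        · rwa [wpos_zero]
        · exact h u hu (by omega)

lemma pr_avoid (hd : 0 < d) (A : Set (Pt d)) (T : ℕ) (x : Pt d) :
    pr T (fun s => ∀ t, 1 ≤ t → t ≤ T → wpos d x s t ∉ A) +
      ∑ t ∈ Finset.range T, ex A (fun _ => 1) t x = 1 := by
  induction T generalizing x with
  | zero =>
    rw [pr_zero, if_pos (fun t h1 h2 => by omega)]; simp
  | succ T ih =>
    rw [ex_sum_succ, pr_succ, ← av_add]
    conv_rhs => rw [← av_const hd 1]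
    congr 1
    ext s
    split_ifs with h1
    · rw [pr_false, zero_add]
      intro r hr
      refine hr 1 le_rfl (by omega) ?_
      have h2 := wpos_cons x (stp s) r 0
      rw [wpos_zero] at h2
      simp only [zero_add] at h2
      rw [h2]; exact h1
    · refine Eq.trans ?_ (ih (x + stp s))
      congr 1
      refine pr_congr fun r => ?_
      constructor
      · intro h u hu1 hu2
        have := h (u + 1) (by omega) (by omega)
        rwa [wpos_cons] at this
      · intro h u hu1 hu2
        obtain ⟨u, rfl⟩ : ∃ v, u = v + 1 := ⟨u - 1, by omega⟩
        rw [wpos_cons]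
        rcases Nat.eq_zero_or_pos u with rfl | hu
        · rwa [wpos_zero]
        · exact h u hu (by omega)

lemma prob_nonneg (t : ℕ) (P : (Fin t → Pt d) → Prop) : 0 ≤ prob d t P := by
  unfold prob; positivity

lemma pr_ne_top (t : ℕ) (P : (Fin t → Pt d) → Prop) : pr t P ≠ ⊤ := ENNReal.ofReal_ne_top

lemma prob_eq_toReal (t : ℕ) (P : (Fin t → Pt d) → Prop) : prob d t P = (pr t P).toReal := by
  rw [pr, ENNReal.toReal_ofReal (prob_nonneg _ _)]

lemma kW_le_one (hd : 0 < d) (W : Set (Pt d)) (x y : Pt d) : kW W x y ≤ 1 :=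
  HV_le_one hd (fun z => by unfold ind; split_ifs <;> simp) x

lemma hitFrom_eq (W : Set (Pt d)) (x y : Pt d) : hitFrom d W x y = (kW W x y).toReal := by
  unfold hitFrom kW HV
  simp_rw [prob_eq_toReal]
  rw [← ENNReal.tsum_toReal_eq (fun t => pr_ne_top _ _)]
  congr 1
  rw [tsum_eq_zero_add' ENNReal.summable, pr_false (by simp), zero_add]
  congr 1
  ext t
  have := pr_hit W (fun z => z = y) t x
  rw [show ind y = (fun z => @ite _ (z = y) (Classical.propDecidable _) (1 : ℝ≥0∞) 0) by
    ext z; unfold ind; congr, ← this]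
  refine pr_congr fun r => ?_
  simp

lemma retProb_eq (W : Set (Pt d)) (x : Pt d) : retProb d W x = (rho W x).toReal := by
  unfold retProb rho HV
  simp_rw [prob_eq_toReal]
  rw [← ENNReal.tsum_toReal_eq (fun t => pr_ne_top _ _)]
  congr 1
  rw [tsum_eq_zero_add' ENNReal.summable, pr_false (by simp), zero_add]
  congr 1
  ext t
  have := pr_hit W (fun z => True) t x
  simp only [if_true] at this
  rw [← this]
  refine pr_congr fun r => ?_
  simp

lemma esc_eq (hd : 0 < d) (A : Set (Pt d)) (x : Pt d) (hx : x ∈ A) :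
    esc d A x = (es A x).toReal := by
  unfold esc
  rw [if_pos hx]
  simp_rw [prob_eq_toReal]
  rw [← ENNReal.toReal_iInf (fun t => pr_ne_top _ _)]
  congr 1
  unfold es rho HV
  rw [ENNReal.tsum_eq_iSup_nat, ENNReal.sub_iSup ENNReal.one_ne_top]
  congr 1
  ext T
  have := pr_avoid hd A T x
  refine ENNReal.eq_sub_of_add_eq ?_ this
  intro h
  rw [h] at this; simp at this

lemma es_le_one (A : Set (Pt d)) (x : Pt d) : es A x ≤ 1 := tsub_le_self

lemma rho_add_es (hd : 0 < d) (A : Set (Pt d)) (x : Pt d) : es A x + rho A x = 1 :=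
  tsub_add_cancel_of_le (rho_le_one hd A x)

lemma es_eq (hd : 0 < d) (A : Set (Pt d)) (x : Pt d) :
    es A x = av fun s => if x + stp s ∈ A then 0 else es A (x + stp s) := by
  have h1 : rho A x ≠ ⊤ := ne_top_of_le_ne_top ENNReal.one_ne_top (rho_le_one hd A x)
  rw [← ENNReal.add_left_inj h1, rho_add_es hd]
  unfold rho
  rw [HV_eq, ← av_add]
  conv_lhs => rw [← av_const hd 1]
  congr 1; ext s
  split_ifs
  · simp
  · exact (rho_add_es hd _ _).symm

end Walk

section Nash
open Classical
open scoped ENNReal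

/-- Quantitative variance inequality. -/
lemma var_ineq {ι : Type*} {w f : ι → ℝ} (hw : ∀ i, 0 ≤ w i) (hs : HasSum w 1)
    (hf0 : ∀ i, 0 ≤ f i) (hf1 : ∀ i, f i ≤ 1) {a b : ι} {c : ℝ} (hc : 0 ≤ c)
    (ha : c ≤ w a) (hb : c ≤ w b) :
    (∑' i, w i * f i) ^ 2 + c / 2 * (f a - f b) ^ 2 ≤ ∑' i, w i * f i ^ 2 := by
  have s1 : Summable fun i => w i * f i :=
    Summable.of_nonneg_of_le (fun i => mul_nonneg (hw i) (hf0 i))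
      (fun i => mul_le_of_le_one_right (hw i) (hf1 i)) hs.summable
  have s2 : Summable fun i => w i * f i ^ 2 :=
    Summable.of_nonneg_of_le (fun i => mul_nonneg (hw i) (sq_nonneg _))
      (fun i => mul_le_of_le_one_right (hw i) (pow_le_one₀ (hf0 i) (hf1 i))) hs.summable
  set m := ∑' i, w i * f i with hm
  have h1 : HasSum (fun i => w i * (f i - m) ^ 2) (∑' i, w i * f i ^ 2 - 2 * m * m + m ^ 2 * 1) := by
    have := (s2.hasSum.sub (s1.hasSum.mul_left (2 * m))).add (hs.mul_left (m ^ 2))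
    refine this.congr_fun ?_ |> fun h => h
    intro i; ring
  have hp : ∀ i, 0 ≤ w i * (f i - m) ^ 2 := fun i => mul_nonneg (hw i) (sq_nonneg _)
  by_cases hab : a = b
  · subst hab
    have := h1.nonneg hp
    simp only [sub_self]; nlinarith
  · have h2 := sum_le_hasSum {a, b} (fun i _ => hp i) h1
    rw [Finset.sum_pair hab] at h2
    have h3 : c * (f a - m) ^ 2 ≤ w a * (f a - m) ^ 2 := by gcongr
    have h4 : c * (f b - m) ^ 2 ≤ w b * (f b - m) ^ 2 := by gcongr
    nlinarith [mul_nonneg hc (sq_nonneg ((f a - m) + (f b - m)))]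

/-- Squared `ℓ²` norm. -/
noncomputable def nsq {ι : Type*} (f : ι → ℝ) : ℝ≥0∞ := ∑' i, ENNReal.ofReal (f i ^ 2)

/-- Apply a kernel to a bounded function. -/
noncomputable def kap {ι : Type*} (T : ι → ι → ℝ≥0∞) (f : ι → ℝ≥0∞) : ι → ℝ≥0∞ :=
  fun a => ∑' b, T a b * f b

lemma nsq_kap {ι : Type*} {T : ι → ι → ℝ≥0∞} (hsym : ∀ a b, T a b = T b a)
    (hrow : ∀ a, ∑' b, T a b = 1) {f : ι → ℝ≥0∞} (hf : ∀ a, f a ≤ 1) {σ : ι → ι} {c : ℝ}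
    (hc : 0 ≤ c) (h1 : ∀ a, ENNReal.ofReal c ≤ T a a) (h2 : ∀ a, ENNReal.ofReal c ≤ T a (σ a)) :
    nsq (fun a => (kap T f a).toReal) +
      ENNReal.ofReal (c / 2) * nsq (fun a => (f a).toReal - (f (σ a)).toReal) ≤
      nsq (fun a => (f a).toReal) := by
  have hT1 : ∀ a b, T a b ≤ 1 := fun a b => (ENNReal.le_tsum b).trans (hrow a).le
  have hTt : ∀ a b, T a b ≠ ⊤ := fun a b => ne_top_of_le_ne_top ENNReal.one_ne_top (hT1 a b)
  have hft : ∀ a, f a ≠ ⊤ := fun a => ne_top_of_le_ne_top ENNReal.one_ne_top (hf a)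
  have hr : nsq (fun a => (f a).toReal) =
      ∑' a, ∑' b, T a b * ENNReal.ofReal ((f b).toReal ^ 2) := by
    rw [ENNReal.tsum_comm]
    unfold nsq
    congr 1; ext b
    rw [ENNReal.tsum_mul_right]
    simp_rw [hsym _ b]
    rw [hrow, one_mul]
  rw [hr]
  unfold nsq
  rw [← ENNReal.tsum_mul_left, ← ENNReal.tsum_add]
  refine ENNReal.tsum_le_tsum fun a => ?_
  have hs : HasSum (fun b => (T a b).toReal) 1 := by
    have := ENNReal.hasSum_toReal (f := fun b => T a b) (by rw [hrow]; simp)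
    rwa [← ENNReal.tsum_toReal_eq (hTt a), hrow, ENNReal.toReal_one] at this
  have hf1 : ∀ b, (f b).toReal ≤ 1 := fun b => by
    have := ENNReal.toReal_mono ENNReal.one_ne_top (hf b); simpa using this
  have key := var_ineq (w := fun b => (T a b).toReal) (f := fun b => (f b).toReal) (a := a) (b := σ a)
    (fun _ => ENNReal.toReal_nonneg) hs (fun _ => ENNReal.toReal_nonneg) hf1 hc
    ((ENNReal.ofReal_le_iff_le_toReal (hTt _ _)).1 (h1 a))
    ((ENNReal.ofReal_le_iff_le_toReal (hTt _ _)).1 (h2 a))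
  have e1 : (kap T f a).toReal = ∑' b, (T a b).toReal * (f b).toReal := by
    unfold kap
    rw [ENNReal.tsum_toReal_eq (fun b => ENNReal.mul_ne_top (hTt _ _) (hft _))]
    simp
  have e2 : ∑' b, T a b * ENNReal.ofReal ((f b).toReal ^ 2) =
      ENNReal.ofReal (∑' b, (T a b).toReal * (f b).toReal ^ 2) := by
    rw [ENNReal.ofReal_tsum_of_nonneg]
    · congr 1; ext b
      rw [ENNReal.ofReal_mul ENNReal.toReal_nonneg, ENNReal.ofReal_toReal (hTt _ _)]
    · intro b; positivity
    · exact Summable.of_nonneg_of_le (fun b => by positivity)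
        (fun b => mul_le_of_le_one_right ENNReal.toReal_nonneg
          (pow_le_one₀ ENNReal.toReal_nonneg (hf1 b))) hs.summable
  beta_reduce
  rw [e1, e2, ← ENNReal.ofReal_mul (by positivity), ← ENNReal.ofReal_add (by positivity) (by positivity)]
  exact ENNReal.ofReal_le_ofReal key

variable {d : ℕ}

/-- Squared norm of a discrete difference. -/
noncomputable def dl (F : Pt d → ℝ) (v : Pt d) : ℝ≥0∞ := nsq fun x => F x - F (x + v)

lemma dl_zero (F : Pt d → ℝ) : dl F 0 = 0 := by simp [dl, nsq]

lemma dl_add (F : Pt d → ℝ) (u e : Pt d) {n : ℝ} (hn : 0 < n) :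
    dl F (u + e) ≤ ENNReal.ofReal (1 + 1 / n) * dl F u + ENNReal.ofReal (1 + n) * dl F e := by
  have h : dl F e = ∑' x, ENNReal.ofReal ((F (x + u) - F (x + u + e)) ^ 2) :=
    ((Equiv.addRight u).tsum_eq (fun x => ENNReal.ofReal ((F x - F (x + e)) ^ 2))).symm
  rw [h]
  unfold dl nsq
  rw [← ENNReal.tsum_mul_left, ← ENNReal.tsum_mul_left, ← ENNReal.tsum_add]
  refine ENNReal.tsum_le_tsum fun x => ?_
  rw [← ENNReal.ofReal_mul (by positivity), ← ENNReal.ofReal_mul (by positivity),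
    ← ENNReal.ofReal_add (by positivity) (by positivity)]
  refine ENNReal.ofReal_le_ofReal ?_
  beta_reduce
  rw [← add_assoc]
  set A := F x - F (x + u)
  set B := F (x + u) - F (x + u + e)
  have : F x - F (x + u + e) = A + B := by simp [A, B]
  rw [this]
  have h2 : (1 + 1 / n) * A ^ 2 + (1 + n) * B ^ 2 - (A + B) ^ 2 = (A - n * B) ^ 2 / n := by
    field_simp; ring
  have : 0 ≤ (A - n * B) ^ 2 / n := by positivity
  linarith

lemma dl_le (F : Pt d → ℝ) {D : ℝ≥0∞} (hD : ∀ j, dl F (Pi.single j 1) ≤ D) :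
    ∀ (n : ℕ) (v : Fin d → ℕ), ∑ i, v i = n →
      dl F (fun i => (v i : ℤ)) ≤ ENNReal.ofReal ((n : ℝ) ^ 2) * D := by
  intro n
  induction n with
  | zero =>
    intro v hv
    have : (fun i => (v i : ℤ)) = 0 := by
      ext i
      have := (Finset.sum_eq_zero_iff.1 hv) i (Finset.mem_univ i)
      simp [this]
    rw [this, dl_zero]; exact bot_le
  | succ n ih =>
    intro v hv
    obtain ⟨j, hj⟩ : ∃ j, 0 < v j := by
      by_contra hcon
      push Not at hcon
      have : ∑ i, v i = 0 := Finset.sum_eq_zero fun i _ => by have := hcon i; omega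
      omega
    set v' : Fin d → ℕ := Function.update v j (v j - 1) with hv'
    have hvv : (fun i => (v i : ℤ)) = (fun i => (v' i : ℤ)) + Pi.single j 1 := by
      ext i
      by_cases hi : i = j
      · subst hi; simp [v']; omega
      · simp [v', hi]
    have hsum : ∑ i, v' i = n := by
      rw [Finset.sum_update_of_mem (Finset.mem_univ j)]
      rw [Finset.sum_eq_add_sum_sdiff_singleton_of_mem (Finset.mem_univ j)] at hv
      omega
    rw [hvv]
    rcases Nat.eq_zero_or_pos n with rfl | hn
    · have : (fun i => (v' i : ℤ)) = 0 := by
        ext i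
        have := (Finset.sum_eq_zero_iff.1 hsum) i (Finset.mem_univ i)
        simp [this]
      rw [this, zero_add]; simpa using hD j
    · have hn' : (0 : ℝ) < n := by exact_mod_cast hn
      refine (dl_add F _ _ hn').trans ?_
      calc _ ≤ ENNReal.ofReal (1 + 1 / n) * (ENNReal.ofReal ((n : ℝ) ^ 2) * D)
            + ENNReal.ofReal (1 + n) * D := by
            gcongr
            · exact ih v' hsum
            · exact hD j
        _ = ENNReal.ofReal (((n + 1 : ℕ) : ℝ) ^ 2) * D := by
          rw [← mul_assoc, ← add_mul, ← ENNReal.ofReal_mul (by positivity),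
            ← ENNReal.ofReal_add (by positivity) (by positivity)]
          congr 2
          push_cast
          field_simp
          ring

/-- Nash-type inequality by box averaging. -/
lemma nash_box (F : Pt d → ℝ≥0∞) (hF : ∑' x, F x ≤ 1) {D : ℝ≥0∞}
    (hD : ∀ j, dl (fun x => (F x).toReal) (Pi.single j 1) ≤ D) (R : ℕ) (hR : 0 < R) :
    nsq (fun x => (F x).toReal) ≤ 2 * ((R : ℝ≥0∞) ^ d)⁻¹ + 2 * ENNReal.ofReal (((d * R : ℕ) : ℝ) ^ 2) * D := by
  have hF1 : ∀ x, F x ≤ 1 := fun x => (ENNReal.le_tsum x).trans hF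
  have hFt : ∀ x, F x ≠ ⊤ := fun x => ne_top_of_le_ne_top ENNReal.one_ne_top (hF1 x)
  let em : (Fin d → Fin R) → Pt d := fun v i => ((v i : ℕ) : ℤ)
  have hem : Function.Injective em := by
    intro v w h
    ext i
    have := congrFun h i
    simpa [em] using this
  have hcard : Fintype.card (Fin d → Fin R) = R ^ d := by simp
  set B : ℝ := (R : ℝ) ^ d with hB
  have hBpos : 0 < B := by positivity
  have hBe : ENNReal.ofReal B = (R : ℝ≥0∞) ^ d := by
    rw [hB, ENNReal.ofReal_pow (by positivity), ENNReal.ofReal_natCast]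
  -- box average
  set av0 : Pt d → ℝ≥0∞ := fun x => ((R : ℝ≥0∞) ^ d)⁻¹ * ∑ v, F (x + em v) with hav
  have hRd0 : (R : ℝ≥0∞) ^ d ≠ 0 := by
    have : (R : ℝ≥0∞) ≠ 0 := by exact_mod_cast hR.ne'
    exact pow_ne_zero _ this
  have hRdt : (R : ℝ≥0∞) ^ d ≠ ⊤ := ENNReal.pow_ne_top (ENNReal.natCast_ne_top _)
  have hav_le : ∀ x, av0 x ≤ ((R : ℝ≥0∞) ^ d)⁻¹ := by
    intro x
    have : ∑ v, F (x + em v) ≤ 1 := by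
      refine le_trans ?_ hF
      have := ENNReal.tsum_comp_le_tsum_of_injective (f := fun v => x + em v)
        (fun v w h => hem (add_left_cancel h)) F
      rwa [tsum_fintype] at this
    calc av0 x ≤ ((R : ℝ≥0∞) ^ d)⁻¹ * 1 := by simp only [hav]; gcongr
      _ = _ := mul_one _
  have hav_sum : ∑' x, av0 x ≤ 1 := by
    simp only [hav]
    rw [ENNReal.tsum_mul_left, Summable.tsum_finsetSum (fun _ _ => ENNReal.summable)]
    have : ∀ v, ∑' x, F (x + em v) = ∑' x, F x := fun v => (Equiv.addRight (em v)).tsum_eq F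
    simp_rw [this]
    rw [Finset.sum_const, Finset.card_univ, hcard, nsmul_eq_mul, ← mul_assoc]
    push_cast
    rw [ENNReal.inv_mul_cancel hRd0 hRdt, one_mul]; exact hF
  have hpt : ∀ x, ENNReal.ofReal ((F x).toReal ^ 2) ≤ 2 * (((R : ℝ≥0∞) ^ d)⁻¹ * av0 x) +
      2 * (((R : ℝ≥0∞) ^ d)⁻¹ * ∑ v, ENNReal.ofReal (((F x).toReal - (F (x + em v)).toReal) ^ 2)) := by
    intro x
    have havt : av0 x ≠ ⊤ := ne_top_of_le_ne_top (ENNReal.inv_ne_top.2 hRd0) (hav_le x)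
    have e1 : (av0 x).toReal = B⁻¹ * ∑ v, (F (x + em v)).toReal := by
      simp only [hav]
      rw [ENNReal.toReal_mul, ENNReal.toReal_sum (fun v _ => hFt _), ENNReal.toReal_inv, ← hBe,
        ENNReal.toReal_ofReal hBpos.le]
    have e2 : (av0 x).toReal ≤ B⁻¹ := by
      have := ENNReal.toReal_mono (ENNReal.inv_ne_top.2 hRd0) (hav_le x)
      rwa [ENNReal.toReal_inv, ← hBe, ENNReal.toReal_ofReal hBpos.le] at this
    have e3 : (F x).toReal ^ 2 ≤ 2 * (B⁻¹ * (av0 x).toReal) +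
        2 * (B⁻¹ * ∑ v, ((F x).toReal - (F (x + em v)).toReal) ^ 2) := by
      have hsq : (∑ v : Fin d → Fin R, ((F x).toReal - (F (x + em v)).toReal)) ^ 2 ≤
          B * ∑ v, ((F x).toReal - (F (x + em v)).toReal) ^ 2 := by
        have := sq_sum_le_card_mul_sum_sq (s := (Finset.univ : Finset (Fin d → Fin R)))
          (f := fun v => (F x).toReal - (F (x + em v)).toReal)
        rw [Finset.card_univ, hcard] at this
        simpa [hB] using this
      have hs : ∑ v : Fin d → Fin R, ((F x).toReal - (F (x + em v)).toReal) =
          B * (F x).toReal - B * (av0 x).toReal := by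
        rw [Finset.sum_sub_distrib, e1, ← mul_assoc, mul_inv_cancel₀ hBpos.ne', one_mul]
        simp [hB]
      set S := ∑ v : Fin d → Fin R, ((F x).toReal - (F (x + em v)).toReal) ^ 2
      set p := (F x).toReal
      set q := (av0 x).toReal
      have hq0 : 0 ≤ q := ENNReal.toReal_nonneg
      rw [hs] at hsq
      have h5 : (p - q) ^ 2 ≤ B⁻¹ * S := by
        rw [inv_mul_eq_div, le_div_iff₀ hBpos]
        have : (B * p - B * q) ^ 2 = B * ((p - q) ^ 2 * B) := by ring
        rw [this] at hsq
        exact le_of_mul_le_mul_left hsq hBpos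
      have h6 : q ^ 2 ≤ B⁻¹ * q := by rw [sq]; gcongr
      nlinarith [sq_nonneg (p - 2 * q)]
    calc ENNReal.ofReal ((F x).toReal ^ 2) ≤ _ := ENNReal.ofReal_le_ofReal e3
      _ = _ := by
        have hBi : ENNReal.ofReal B⁻¹ = ((R : ℝ≥0∞) ^ d)⁻¹ := by
          rw [ENNReal.ofReal_inv_of_pos hBpos, hBe]
        rw [ENNReal.ofReal_add (by positivity) (by positivity), ENNReal.ofReal_mul (by norm_num),
          ENNReal.ofReal_mul (by positivity), ENNReal.ofReal_mul (by norm_num),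
          ENNReal.ofReal_mul (by positivity), ENNReal.ofReal_toReal havt, hBi,
          ENNReal.ofReal_sum_of_nonneg (fun _ _ => sq_nonneg _)]
        norm_num
  unfold nsq
  refine (ENNReal.tsum_le_tsum hpt).trans ?_
  have hdl : ∀ v : Fin d → Fin R, ∑' x, ENNReal.ofReal (((F x).toReal - (F (x + em v)).toReal) ^ 2) ≤
      ENNReal.ofReal (((d * R : ℕ) : ℝ) ^ 2) * D := by
    intro v
    refine (dl_le _ hD _ (fun i => (v i : ℕ)) rfl).trans ?_
    gcongr
    calc ∑ i, (v i : ℕ) ≤ ∑ i : Fin d, R := Finset.sum_le_sum fun i _ => (v i).2.le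
      _ = d * R := by simp
  rw [ENNReal.tsum_add]
  refine add_le_add ?_ ?_
  · rw [ENNReal.tsum_mul_left, ENNReal.tsum_mul_left]
    gcongr
    calc ((R : ℝ≥0∞) ^ d)⁻¹ * ∑' x, av0 x ≤ ((R : ℝ≥0∞) ^ d)⁻¹ * 1 := by gcongr
      _ = _ := mul_one _
  · rw [ENNReal.tsum_mul_left, ENNReal.tsum_mul_left,
      Summable.tsum_finsetSum (fun _ _ => ENNReal.summable), mul_assoc]
    refine mul_le_mul_right ?_ _
    calc _ ≤ ((R : ℝ≥0∞) ^ d)⁻¹ * ∑ v : Fin d → Fin R, ENNReal.ofReal (((d * R : ℕ) : ℝ) ^ 2) * D := by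
          gcongr with v; exact hdl v
      _ = _ := by
        rw [Finset.sum_const, Finset.card_univ, hcard, nsmul_eq_mul]
        push_cast
        rw [← mul_assoc, ENNReal.inv_mul_cancel hRd0 hRdt, one_mul]

end Nash

section Nash2
open Classical
open scoped ENNReal

lemma decay_seq (C1 C2 : ℝ) (hC1 : 0 < C1) (hC2 : 0 < C2) : ∃ K : ℝ, 0 < K ∧ ∀ a : ℕ → ℝ,
    (∀ n, 0 ≤ a n) → a 0 ≤ 1 → (∀ n, a (n + 1) ≤ a n) →
    (∀ n (R : ℕ), 0 < R → a n ≤ C1 / (R : ℝ) ^ 5 + C2 * (R : ℝ) ^ 2 * (a n - a (n + 1))) →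
    ∀ n, a n ≤ K * ((n : ℝ) + 1) ^ (-(5 / 2) : ℝ) := by
  obtain ⟨R0, hR0⟩ := exists_nat_ge (64 * C1 + 1)
  have hR1 : (1 : ℝ) ≤ R0 := by linarith
  have hR0' : C1 / (R0 : ℝ) ^ 5 ≤ 1 / 64 := by
    rw [div_le_iff₀ (by positivity)]
    have : (R0 : ℝ) ≤ (R0 : ℝ) ^ 5 := le_self_pow₀ hR1 (by norm_num)
    linarith
  obtain ⟨L, hL⟩ := exists_nat_ge (32 * C2 * (R0 : ℝ) ^ 2 + 1)
  have hL1 : (1 : ℝ) ≤ L := by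
    have : 0 ≤ 32 * C2 * (R0 : ℝ) ^ 2 := by positivity
    linarith
  refine ⟨(4 * L : ℝ) ^ (5 / 2 : ℝ), by positivity, ?_⟩
  intro a ha0 ha1 hant hN
  have anti : Antitone a := antitone_nat_of_succ_le hant
  have main : ∀ j : ℕ, a (L * 4 ^ j) ≤ (1 / 32 : ℝ) ^ j := by
    intro j
    induction j with
    | zero => simpa using (anti (Nat.zero_le _)).trans ha1
    | succ j ih =>
      by_contra hcon
      push Not at hcon
      set v : ℝ := (1 / 32 : ℝ) ^ (j + 1) with hv
      have hvpos : 0 < v := by positivity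
      set δ : ℝ := v / (2 * C2 * (R0 : ℝ) ^ 2 * 4 ^ j) with hδ
      have hstep : ∀ n, n < L * 4 ^ (j + 1) → δ ≤ a n - a (n + 1) := by
        intro n hn
        have h1 : v < a n := hcon.trans_le (anti hn.le)
        have h2 := hN n (R0 * 2 ^ j) (by
          have : 0 < R0 := by exact_mod_cast (by linarith : (0:ℝ) < R0)
          positivity)
        have h3 : C1 / ((R0 * 2 ^ j : ℕ) : ℝ) ^ 5 ≤ v / 2 := by
          have : ((R0 * 2 ^ j : ℕ) : ℝ) ^ 5 = (R0 : ℝ) ^ 5 * 32 ^ j := by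
            push_cast
            rw [mul_pow, ← pow_mul, mul_comm j 5, pow_mul]; norm_num
          rw [this, ← div_div]
          calc C1 / (R0 : ℝ) ^ 5 / 32 ^ j ≤ (1 / 64) / 32 ^ j := by gcongr
            _ = v / 2 := by rw [hv, pow_succ, div_pow]; field_simp; norm_num
        have h4 : ((R0 * 2 ^ j : ℕ) : ℝ) ^ 2 = (R0 : ℝ) ^ 2 * 4 ^ j := by
          push_cast
          rw [mul_pow, ← pow_mul, mul_comm j 2, pow_mul]; norm_num
        rw [h4] at h2
        rw [hδ, div_le_iff₀ (by positivity)]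
        nlinarith
      have htel : ∀ m, m ≤ 3 * L * 4 ^ j → (m : ℝ) * δ ≤ a (L * 4 ^ j) - a (L * 4 ^ j + m) := by
        intro m
        induction m with
        | zero => intro _; simp
        | succ m ihm =>
          intro hm
          have := ihm (by omega)
          have h5 := hstep (L * 4 ^ j + m) (by rw [pow_succ]; nlinarith)
          push_cast
          rw [← add_assoc]
          linarith
      have h6 := htel _ le_rfl
      have h7 := ha0 (L * 4 ^ j + 3 * L * 4 ^ j)
      have h8 : (1 / 32 : ℝ) ^ j = 32 * v := by rw [hv, pow_succ]; ring
      have h9 : ((3 * L * 4 ^ j : ℕ) : ℝ) * δ = 3 * L * v / (2 * C2 * (R0 : ℝ) ^ 2) := by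
        rw [hδ]; push_cast; field_simp
      have hend : a (L * 4 ^ j + 3 * L * 4 ^ j) > v := by
        have : L * 4 ^ j + 3 * L * 4 ^ j = L * 4 ^ (j + 1) := by ring
        rw [this]; exact hcon
      have h10 : 32 * v ≤ 3 * L * v / (2 * C2 * (R0 : ℝ) ^ 2) := by
        rw [le_div_iff₀ (by positivity)]
        nlinarith
      linarith
  intro n
  have hfin : ∀ y : ℝ, 0 < y → ((n : ℝ) + 1) ≤ 4 * L * y → y ^ (-(5 / 2) : ℝ) ≤
      (4 * L : ℝ) ^ (5 / 2 : ℝ) * ((n : ℝ) + 1) ^ (-(5 / 2) : ℝ) := by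
    intro y hy hn
    have h1 : ((n : ℝ) + 1) ^ (5 / 2 : ℝ) ≤ (4 * L : ℝ) ^ (5 / 2 : ℝ) * y ^ (5 / 2 : ℝ) := by
      rw [← Real.mul_rpow (by positivity) hy.le]
      exact Real.rpow_le_rpow (by positivity) hn (by norm_num)
    rw [Real.rpow_neg hy.le, Real.rpow_neg (by positivity), ← div_eq_mul_inv,
      le_div_iff₀ (by positivity), inv_mul_le_iff₀ (by positivity)]
    linarith
  rcases lt_or_ge n L with hnL | hnL
  · refine ((anti (Nat.zero_le n)).trans ha1).trans ?_
    have := hfin 1 one_pos (by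
      have : (n : ℝ) + 1 ≤ L := by exact_mod_cast hnL
      linarith)
    simpa using this
  · have hLpos : 0 < L := by exact_mod_cast (by linarith : (0:ℝ) < L)
    set j := Nat.log 4 (n / L) with hj
    have hq : n / L ≠ 0 := (Nat.div_pos hnL hLpos).ne'
    have h1 : L * 4 ^ j ≤ n := by
      have := Nat.pow_log_le_self 4 hq
      rw [mul_comm]; exact (Nat.le_div_iff_mul_le hLpos).1 this
    have h2 : n < L * 4 ^ (j + 1) := by
      have := Nat.lt_pow_succ_log_self (b := 4) (by norm_num) (n / L)
      rw [mul_comm]; exact (Nat.div_lt_iff_lt_mul hLpos).1 this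
    refine ((anti h1).trans (main j)).trans ?_
    have h3 := hfin ((4 : ℝ) ^ j) (by positivity) (by
      have : (n : ℝ) + 1 ≤ L * 4 ^ (j + 1) := by exact_mod_cast h2
      rw [pow_succ] at this; linarith)
    refine le_trans (le_of_eq ?_) h3
    rw [← Real.rpow_natCast, ← Real.rpow_natCast, ← Real.rpow_mul (by norm_num),
      mul_comm (j : ℝ), Real.rpow_mul (by norm_num)]
    congr 1
    rw [show (4 : ℝ) = 2 ^ (2 : ℝ) by norm_num, ← Real.rpow_mul (by norm_num),
      show (2 : ℝ) * -(5 / 2) = -5 by norm_num, Real.rpow_neg (by norm_num)]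
    norm_num

variable {d : ℕ}

/-- Iterates of a kernel on a function. -/
noncomputable def kit {ι : Type*} (T : ι → ι → ℝ≥0∞) (f : ι → ℝ≥0∞) (n : ℕ) : ι → ℝ≥0∞ :=
  (kap T)^[n] f

lemma kit_succ {ι : Type*} (T : ι → ι → ℝ≥0∞) (f : ι → ℝ≥0∞) (n : ℕ) :
    kit T f (n + 1) = kap T (kit T f n) := by
  unfold kit; rw [Function.iterate_succ_apply']

lemma kap_sum {ι : Type*} {T : ι → ι → ℝ≥0∞} (hsym : ∀ a b, T a b = T b a)
    (hrow : ∀ a, ∑' b, T a b = 1) (f : ι → ℝ≥0∞) : ∑' a, kap T f a = ∑' a, f a := by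
  unfold kap
  rw [ENNReal.tsum_comm]
  congr 1; ext b
  rw [ENNReal.tsum_mul_right]
  simp_rw [hsym _ b]
  rw [hrow, one_mul]

lemma nsq_le_of_sum {ι : Type*} {f : ι → ℝ≥0∞} (h : ∑' a, f a ≤ 1) :
    nsq (fun a => (f a).toReal) ≤ 1 := by
  refine le_trans (ENNReal.tsum_le_tsum fun a => ?_) h
  have h1 : f a ≤ 1 := (ENNReal.le_tsum a).trans h
  have h2 : (f a).toReal ≤ 1 := by
    have := ENNReal.toReal_mono ENNReal.one_ne_top h1; simpa using this
  refine ENNReal.ofReal_le_of_le_toReal ?_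
  nlinarith [ENNReal.toReal_nonneg (a := f a)]

/-- Abstract heat kernel decay on `ℤ^d × Fin d`. -/
theorem heat_decay (hd : 5 ≤ d) (c : ℝ) (hc : 0 < c) : ∃ K : ℝ, 0 < K ∧
    ∀ T : (Pt d × Fin d) → (Pt d × Fin d) → ℝ≥0∞, (∀ a b, T a b = T b a) →
    (∀ a, ∑' b, T a b = 1) →
    (∀ x i j, ENNReal.ofReal c ≤ T (x, i) (x, j)) →
    (∀ x i j, ENNReal.ofReal c ≤ T (x, j) (x + Pi.single j 1, i)) →
    ∀ f : Pt d × Fin d → ℝ≥0∞, ∑' a, f a ≤ 1 → ∀ n,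
      nsq (fun b => (kit T f n b).toReal) ≤
        ENNReal.ofReal (K * ((n : ℝ) + 1) ^ (-(5 / 2) : ℝ)) := by
  have hd0 : (0 : ℝ) < d := by exact_mod_cast (by omega : 0 < d)
  obtain ⟨K, hK, hdec⟩ := decay_seq (2 * d) (d * (2 * (d : ℝ) ^ 2 * (8 / c))) (by positivity) (by positivity)
  refine ⟨K, hK, ?_⟩
  intro T hsym hrow h1 h2 f hf
  have hsum : ∀ n, ∑' a, kit T f n a ≤ 1 := by
    intro n
    induction n with
    | zero => exact hf
    | succ n ih => rw [kit_succ, kap_sum hsym hrow]; exact ih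
  have hle : ∀ n a, kit T f n a ≤ 1 := fun n a => (ENNReal.le_tsum a).trans (hsum n)
  set A : ℕ → ℝ≥0∞ := fun n => nsq (fun b => (kit T f n b).toReal) with hA
  have hA1 : ∀ n, A n ≤ 1 := fun n => nsq_le_of_sum (hsum n)
  have hAt : ∀ n, A n ≠ ⊤ := fun n => ne_top_of_le_ne_top ENNReal.one_ne_top (hA1 n)
  have hstep : ∀ n (σ : Pt d × Fin d → Pt d × Fin d), (∀ a, ENNReal.ofReal c ≤ T a (σ a)) →
      A (n + 1) + ENNReal.ofReal (c / 2) *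
        nsq (fun a => (kit T f n a).toReal - (kit T f n (σ a)).toReal) ≤ A n := by
    intro n σ hσ
    have := nsq_kap hsym hrow (hle n) hc.le (fun a => h1 a.1 a.2 a.2) hσ
    simp only [hA, kit_succ]; exact this
  have hanti : ∀ n, A (n + 1) ≤ A n := fun n =>
    le_trans le_self_add (hstep n id (fun a => h1 a.1 a.2 a.2))
  have hdrop : ∀ n (σ : Pt d × Fin d → Pt d × Fin d), (∀ a, ENNReal.ofReal c ≤ T a (σ a)) →
      nsq (fun a => (kit T f n a).toReal - (kit T f n (σ a)).toReal) ≤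
        ENNReal.ofReal (2 / c) * (A n - A (n + 1)) := by
    intro n σ hσ
    have h3 := ENNReal.le_sub_of_add_le_left (hAt (n + 1)) (hstep n σ hσ)
    calc nsq (fun a => (kit T f n a).toReal - (kit T f n (σ a)).toReal)
        = ENNReal.ofReal (2 / c) * (ENNReal.ofReal (c / 2) *
          nsq (fun a => (kit T f n a).toReal - (kit T f n (σ a)).toReal)) := by
          rw [← mul_assoc, ← ENNReal.ofReal_mul (by positivity)]
          rw [show 2 / c * (c / 2) = 1 by field_simp]; simp
      _ ≤ _ := by gcongr
  have hpart : ∀ n i j, dl (fun x => (kit T f n (x, i)).toReal) (Pi.single j 1) ≤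
      ENNReal.ofReal (8 / c) * (A n - A (n + 1)) := by
    intro n i j
    have e1 := hdrop n (fun a => (a.1, j)) (fun a => h1 a.1 a.2 j)
    have e2 := hdrop n (fun a => (a.1 + Pi.single a.2 1, i)) (fun a => h2 a.1 i a.2)
    have g1 : ∑' x, ENNReal.ofReal (((kit T f n (x, i)).toReal - (kit T f n (x, j)).toReal) ^ 2) ≤
        ENNReal.ofReal (2 / c) * (A n - A (n + 1)) :=
      le_trans (ENNReal.tsum_comp_le_tsum_of_injective (f := fun x : Pt d => (x, i))
        (fun x y h => (Prod.mk.inj h).1) _) e1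
    have g2 : ∑' x, ENNReal.ofReal (((kit T f n (x, j)).toReal -
        (kit T f n (x + Pi.single j 1, i)).toReal) ^ 2) ≤
        ENNReal.ofReal (2 / c) * (A n - A (n + 1)) :=
      le_trans (ENNReal.tsum_comp_le_tsum_of_injective (f := fun x : Pt d => (x, j))
        (fun x y h => (Prod.mk.inj h).1) _) e2
    calc dl (fun x => (kit T f n (x, i)).toReal) (Pi.single j 1)
        ≤ ∑' x, (2 * ENNReal.ofReal (((kit T f n (x, i)).toReal - (kit T f n (x, j)).toReal) ^ 2) +
          2 * ENNReal.ofReal (((kit T f n (x, j)).toReal -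
            (kit T f n (x + Pi.single j 1, i)).toReal) ^ 2)) := by
          unfold dl nsq
          refine ENNReal.tsum_le_tsum fun x => ?_
          rw [← ENNReal.ofReal_ofNat 2, ← ENNReal.ofReal_mul (by norm_num),
            ← ENNReal.ofReal_mul (by norm_num), ← ENNReal.ofReal_add (by positivity) (by positivity)]
          refine ENNReal.ofReal_le_ofReal ?_
          set p := (kit T f n (x, i)).toReal
          set q := (kit T f n (x, j)).toReal
          set r := (kit T f n (x + Pi.single j 1, i)).toReal
          nlinarith [sq_nonneg (p - q - (q - r))]
      _ ≤ 2 * (ENNReal.ofReal (2 / c) * (A n - A (n + 1))) +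
          2 * (ENNReal.ofReal (2 / c) * (A n - A (n + 1))) := by
          rw [ENNReal.tsum_add, ENNReal.tsum_mul_left, ENNReal.tsum_mul_left]
          gcongr
      _ = _ := by
        rw [← two_mul, ← mul_assoc, ← mul_assoc, ← ENNReal.ofReal_ofNat 2,
          ← ENNReal.ofReal_mul (by norm_num), ← ENNReal.ofReal_mul (by norm_num)]
        congr 2; ring
  have hmain := hdec (fun n => (A n).toReal) (fun n => ENNReal.toReal_nonneg)
    (by have := ENNReal.toReal_mono ENNReal.one_ne_top (hA1 0); simpa using this)
    (fun n => ENNReal.toReal_mono (hAt n) (hanti n))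
    (by
      intro n R hR
      have hRr : (1 : ℝ) ≤ R := by exact_mod_cast hR
      have hsl : A n = ∑ i, nsq (fun x => (kit T f n (x, i)).toReal) := by
        simp only [hA, nsq]
        rw [ENNReal.tsum_prod', ENNReal.tsum_comm, tsum_fintype]
      have hb : A n ≤ ENNReal.ofReal (2 * d / (R : ℝ) ^ 5 +
          d * (2 * (d : ℝ) ^ 2 * (8 / c)) * (R : ℝ) ^ 2 * ((A n).toReal - (A (n + 1)).toReal)) := by
        have hs0 : 0 ≤ (A n).toReal - (A (n + 1)).toReal :=
          sub_nonneg.2 (ENNReal.toReal_mono (hAt n) (hanti n))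
        have hsub : A n - A (n + 1) = ENNReal.ofReal ((A n).toReal - (A (n + 1)).toReal) := by
          rw [ENNReal.ofReal_sub _ ENNReal.toReal_nonneg, ENNReal.ofReal_toReal (hAt n),
            ENNReal.ofReal_toReal (hAt _)]
        have hi : ∀ i, nsq (fun x => (kit T f n (x, i)).toReal) ≤
            ENNReal.ofReal (2 / (R : ℝ) ^ 5 + 2 * ((d : ℝ) * R) ^ 2 * (8 / c * ((A n).toReal - (A (n + 1)).toReal))) := by
          intro i
          refine (nash_box (fun x => kit T f n (x, i)) ?_ (hpart n i) R hR).trans ?_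
          · exact le_trans (ENNReal.tsum_comp_le_tsum_of_injective (f := fun x : Pt d => (x, i))
              (fun x y h => (Prod.mk.inj h).1) _) (hsum n)
          · rw [ENNReal.ofReal_add (by positivity) (by positivity)]
            refine add_le_add ?_ ?_
            · rw [ENNReal.ofReal_div_of_pos (by positivity), ENNReal.ofReal_ofNat, div_eq_mul_inv,
                ENNReal.ofReal_pow (by positivity), ENNReal.ofReal_natCast]
              gcongr
              exact_mod_cast hR
            · rw [ENNReal.ofReal_mul (by positivity), ENNReal.ofReal_mul (by norm_num),
                ENNReal.ofReal_mul (by positivity), hsub, ENNReal.ofReal_ofNat]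
              push_cast
              exact le_rfl
        rw [hsl]
        refine (Finset.sum_le_sum fun i _ => hi i).trans ?_
        rw [Finset.sum_const, Finset.card_univ, Fintype.card_fin, nsmul_eq_mul,
          ← ENNReal.ofReal_natCast, ← ENNReal.ofReal_mul (by positivity)]
        rw [hsl] at hs0 ⊢
        refine ENNReal.ofReal_le_ofReal (le_of_eq ?_)
        ring
      have hs0 : 0 ≤ (A n).toReal - (A (n + 1)).toReal :=
        sub_nonneg.2 (ENNReal.toReal_mono (hAt n) (hanti n))
      exact ENNReal.toReal_le_of_le_ofReal (by positivity) hb)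
  intro n
  exact (ENNReal.le_ofReal_iff_toReal_le (hAt n) (by positivity)).2 (hmain n)

end Nash2

section Green
open Classical
open scoped ENNReal

variable {d : ℕ}

lemma tsum_mul_le_cs {ι : Type*} {f g : ι → ℝ≥0∞} {u v : ℝ≥0∞} (hu : u ≠ 0) (hu' : u ≠ ⊤)
    (hv : v ≠ 0) (hv' : v ≠ ⊤) (hf : ∑' i, f i ^ 2 ≤ u ^ 2) (hg : ∑' i, g i ^ 2 ≤ v ^ 2) :
    ∑' i, f i * g i ≤ 2 * (u * v) := by
  have hpt : ∀ i, f i * g i ≤ u * v * ((f i / u) ^ 2 + (g i / v) ^ 2) := by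
    intro i
    have h1 : f i * g i = u * v * ((f i / u) * (g i / v)) := by
      conv_lhs => rw [← ENNReal.mul_div_cancel hu hu' (b := f i),
        ← ENNReal.mul_div_cancel hv hv' (b := g i)]
      ring
    rw [h1]
    gcongr
    rcases le_total (f i / u) (g i / v) with h | h
    · calc _ ≤ (g i / v) * (g i / v) := by gcongr
        _ ≤ _ := by rw [← sq]; exact le_add_self
    · calc _ ≤ (f i / u) * (f i / u) := by gcongr
        _ ≤ _ := by rw [← sq]; exact le_self_add
  have hdiv : ∀ (F : ι → ℝ≥0∞) (w : ℝ≥0∞), w ≠ 0 → w ≠ ⊤ → ∑' i, F i ^ 2 ≤ w ^ 2 →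
      ∑' i, (F i / w) ^ 2 ≤ 1 := by
    intro F w hw hw' hF
    simp_rw [div_eq_mul_inv, mul_pow]
    rw [ENNReal.tsum_mul_right]
    calc _ ≤ w ^ 2 * w⁻¹ ^ 2 := by gcongr
      _ = 1 := by rw [← mul_pow, ENNReal.mul_inv_cancel hw hw', one_pow]
  refine (ENNReal.tsum_le_tsum hpt).trans ?_
  rw [ENNReal.tsum_mul_left, ENNReal.tsum_add]
  calc u * v * (∑' i, (f i / u) ^ 2 + ∑' i, (g i / v) ^ 2) ≤ u * v * (1 + 1) := by
        gcongr
        · exact hdiv f u hu hu' hf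
        · exact hdiv g v hv hv' hg
    _ = _ := by ring

/-- The decay profile `(n+1)^{-5/4}`. -/
noncomputable def psi (n : ℕ) : ℝ≥0∞ := ENNReal.ofReal (((n : ℝ) + 1) ^ (-(5 / 4) : ℝ))

lemma psi_ne_zero (n : ℕ) : psi n ≠ 0 := by
  unfold psi
  rw [Ne, ENNReal.ofReal_eq_zero, not_le]; positivity

lemma psi_ne_top (n : ℕ) : psi n ≠ ⊤ := ENNReal.ofReal_ne_top

lemma psi_sq (n : ℕ) : psi n ^ 2 = ENNReal.ofReal (((n : ℝ) + 1) ^ (-(5 / 2) : ℝ)) := by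
  unfold psi
  rw [← ENNReal.ofReal_pow (by positivity), ← Real.rpow_natCast, ← Real.rpow_mul (by positivity)]
  norm_num

lemma psi_sum : ∑' n, psi n ≠ ⊤ := by
  have hs : Summable fun n : ℕ => ((n : ℝ) + 1) ^ (-(5 / 4) : ℝ) := by
    have := (summable_nat_add_iff 1).2 (Real.summable_nat_rpow.2 (by norm_num : (-(5/4) : ℝ) < -1))
    simpa using this
  unfold psi
  rw [← ENNReal.ofReal_tsum_of_nonneg (fun n => by positivity) hs]
  exact ENNReal.ofReal_ne_top

/-- Reversal of a step. -/
def nstp : (Fin d × Bool) ≃ (Fin d × Bool) where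
  toFun s := (s.1, !s.2)
  invFun s := (s.1, !s.2)
  left_inv s := by simp
  right_inv s := by simp

lemma stp_nstp (s : Fin d × Bool) : stp (nstp s) = - stp s := by
  rcases s with ⟨i, b⟩
  cases b <;> simp [stp, nstp, Pi.single_neg]

lemma av_equiv (π : (Fin d × Bool) ≃ (Fin d × Bool)) (f : Fin d × Bool → ℝ≥0∞) :
    av (fun s => f (π s)) = av f := by
  unfold av; rw [Equiv.sum_comp π f]

/-- Lazy walk kernel. -/
noncomputable def lzK (x y : Pt d) : ℝ≥0∞ :=
  2⁻¹ * ind y x + 2⁻¹ * av fun s => ind y (x + stp s)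

lemma lzK_symm (x y : Pt d) : lzK x y = lzK y x := by
  unfold lzK
  congr 1
  · simp [ind, eq_comm]
  · rw [← av_equiv nstp (fun s => ind x (y + stp s))]
    congr 2; ext s
    simp only [ind, stp_nstp]
    congr 1
    rw [eq_iff_iff]
    constructor <;> rintro rfl <;> simp

lemma tsum_ind (y : Pt d) (φ : Pt d → ℝ≥0∞) : ∑' z, ind z y * φ z = φ y := by
  rw [tsum_eq_single y]
  · simp [ind]
  · intro z hz; simp [ind, hz.symm]

lemma lzK_apply (x : Pt d) (φ : Pt d → ℝ≥0∞) :
    ∑' y, lzK x y * φ y = 2⁻¹ * φ x + 2⁻¹ * av fun s => φ (x + stp s) := by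
  unfold lzK
  simp_rw [add_mul, mul_assoc]
  rw [ENNReal.tsum_add, ENNReal.tsum_mul_left, ENNReal.tsum_mul_left, tsum_ind]
  congr 2
  have : ∀ y, (av fun s => ind y (x + stp s)) * φ y = av fun s => ind y (x + stp s) * φ y := by
    intro y
    rw [mul_comm, ← av_mul]; congr 1; ext s; ring
  simp_rw [this]
  rw [← av_tsum]
  simp_rw [tsum_ind]

/-- Lazy walk transition probabilities to the origin. -/
noncomputable def lzp : ℕ → Pt d → ℝ≥0∞
  | 0, x => ind 0 x
  | t + 1, x => 2⁻¹ * lzp t x + 2⁻¹ * av fun s => lzp t (x + stp s)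

/-- Lazy Green function. -/
noncomputable def hh (x : Pt d) : ℝ≥0∞ := ∑' t, lzp t x

lemma half_add_half : (2⁻¹ : ℝ≥0∞) + 2⁻¹ = 1 := ENNReal.inv_two_add_inv_two

theorem lzp_sq (hd : 5 ≤ d) : ∃ K : ℝ≥0∞, K ≠ 0 ∧ K ≠ ⊤ ∧ ∀ t, ∑' x : Pt d, lzp t x ^ 2 ≤ (K * psi t) ^ 2 := by
  have hd0 : (0 : ℝ) < d := by exact_mod_cast (by omega : 0 < d)
  have hde0 : (d : ℝ≥0∞) ≠ 0 := by exact_mod_cast (by omega : d ≠ 0)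
  have hdt : (d : ℝ≥0∞) ≠ ⊤ := ENNReal.natCast_ne_top _
  obtain ⟨K, hK, hdec⟩ := heat_decay hd (1 / (4 * (d : ℝ) ^ 2)) (by positivity)
  set T : (Pt d × Fin d) → (Pt d × Fin d) → ℝ≥0∞ := fun a b => (d : ℝ≥0∞)⁻¹ * lzK a.1 b.1 with hT
  have hTap : ∀ (φ : Pt d → ℝ≥0∞) a, ∑' b : Pt d × Fin d, T a b * φ b.1 =
      2⁻¹ * φ a.1 + 2⁻¹ * av fun s => φ (a.1 + stp s) := by
    intro φ a
    rw [ENNReal.tsum_prod', ← lzK_apply]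
    congr 1; ext y
    simp only [hT, tsum_fintype, Finset.sum_const, Finset.card_univ, Fintype.card_fin, nsmul_eq_mul]
    rw [← mul_assoc, ← mul_assoc, ENNReal.mul_inv_cancel hde0 hdt, one_mul]
  have hce : ENNReal.ofReal (1 / (4 * (d : ℝ) ^ 2)) = (d : ℝ≥0∞)⁻¹ * (2⁻¹ * ((2 * d : ℕ) : ℝ≥0∞)⁻¹) := by
    rw [show (1 / (4 * (d : ℝ) ^ 2)) = (d : ℝ)⁻¹ * ((2 : ℝ)⁻¹ * ((2 * d : ℕ) : ℝ)⁻¹) by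
      push_cast; field_simp; norm_num]
    rw [ENNReal.ofReal_mul (by positivity), ENNReal.ofReal_mul (by positivity),
      ENNReal.ofReal_inv_of_pos hd0, ENNReal.ofReal_inv_of_pos (by norm_num),
      ENNReal.ofReal_inv_of_pos (by positivity), ENNReal.ofReal_natCast, ENNReal.ofReal_natCast,
      ENNReal.ofReal_ofNat]
  set f0 : Pt d × Fin d → ℝ≥0∞ := fun a => (d : ℝ≥0∞)⁻¹ * lzp 0 a.1 with hf0
  have hkit : ∀ t, kit T f0 t = fun a => (d : ℝ≥0∞)⁻¹ * lzp t a.1 := by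
    intro t
    induction t with
    | zero => rfl
    | succ t ih =>
      rw [kit_succ, ih]
      ext a
      unfold kap
      rw [hTap (fun x => (d : ℝ≥0∞)⁻¹ * lzp t x), lzp, av_mul]
      ring
  have hap := hdec T (fun a b => by simp only [hT]; rw [lzK_symm])
    (fun a => by
      have := hTap (fun _ => 1) a
      simp only [mul_one] at this
      rw [this, av_const (by omega), mul_one, half_add_half])
    (fun x i j => by
      rw [hce]
      simp only [hT]
      gcongr
      unfold lzK
      refine le_trans ?_ le_self_add
      gcongr
      simp only [ind, if_true]
      exact ENNReal.inv_le_one.2 (by exact_mod_cast (by omega : 1 ≤ 2 * d)))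
    (fun x i j => by
      rw [hce]
      simp only [hT]
      gcongr
      unfold lzK
      refine le_trans ?_ le_add_self
      gcongr
      refine le_trans ?_ (le_av (j, true) _)
      simp [ind, stp])
    f0 (by
      rw [ENNReal.tsum_prod']
      simp only [hf0, lzp, tsum_fintype, Finset.sum_const, Finset.card_univ, Fintype.card_fin, nsmul_eq_mul]
      simp_rw [← mul_assoc]
      rw [ENNReal.tsum_mul_left, ENNReal.mul_inv_cancel hde0 hdt, one_mul, tsum_eq_single 0]
      · simp [ind]
      · intro x hx; simp [ind, hx])
  have hl1 : ∀ t (x : Pt d), lzp t x ≤ 1 := by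
    intro t
    induction t with
    | zero => intro x; simp only [lzp, ind]; split_ifs <;> simp
    | succ t ih =>
      intro x
      simp only [lzp]
      calc _ ≤ 2⁻¹ * 1 + 2⁻¹ * av (fun _ : Fin d × Bool => (1 : ℝ≥0∞)) := by
            gcongr
            · exact ih x
            · exact av_mono fun s => ih _
        _ = 1 := by rw [av_const (by omega), mul_one, half_add_half]
  have hsum : ∀ t, ∑' x : Pt d, lzp t x ^ 2 ≤ d * ENNReal.ofReal (K * ((t : ℝ) + 1) ^ (-(5 / 2) : ℝ)) := by
    intro t
    have h1 := hap t
    rw [hkit] at h1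
    have h2 : nsq (fun b : Pt d × Fin d => ((d : ℝ≥0∞)⁻¹ * lzp t b.1).toReal) =
        (d : ℝ≥0∞)⁻¹ * ∑' x : Pt d, lzp t x ^ 2 := by
      unfold nsq
      have : ∀ b : Pt d × Fin d, ENNReal.ofReal (((d : ℝ≥0∞)⁻¹ * lzp t b.1).toReal ^ 2) =
          ((d : ℝ≥0∞)⁻¹) ^ 2 * lzp t b.1 ^ 2 := by
        intro b
        have hlt : lzp t b.1 ≠ ⊤ := ne_top_of_le_ne_top ENNReal.one_ne_top (hl1 t b.1)
        rw [ENNReal.ofReal_pow ENNReal.toReal_nonneg, ENNReal.ofReal_toReal, mul_pow]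
        exact ENNReal.mul_ne_top (ENNReal.inv_ne_top.2 hde0) hlt
      simp_rw [this]
      rw [ENNReal.tsum_prod', ← ENNReal.tsum_mul_left]
      congr 1; ext x
      simp only [tsum_fintype, Finset.sum_const, Finset.card_univ, Fintype.card_fin, nsmul_eq_mul]
      rw [sq, ← mul_assoc, ← mul_assoc, ENNReal.mul_inv_cancel hde0 hdt, one_mul]
    rw [h2] at h1
    calc ∑' x : Pt d, lzp t x ^ 2 = d * ((d : ℝ≥0∞)⁻¹ * ∑' x : Pt d, lzp t x ^ 2) := by
          rw [← mul_assoc, ENNReal.mul_inv_cancel hde0 hdt, one_mul]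
      _ ≤ _ := by gcongr
  refine ⟨ENNReal.ofReal (d * K + 1), ?_, ENNReal.ofReal_ne_top, fun t => (hsum t).trans ?_⟩
  · rw [Ne, ENNReal.ofReal_eq_zero, not_le]; positivity
  · rw [mul_pow, psi_sq, ← ENNReal.ofReal_pow (by positivity), ← ENNReal.ofReal_natCast,
      ← ENNReal.ofReal_mul (by positivity), ← ENNReal.ofReal_mul (by positivity)]
    refine ENNReal.ofReal_le_ofReal ?_
    rw [← mul_assoc]
    gcongr
    have : 0 < d * K := by positivity
    nlinarith

/-- Sup norm on the lattice. -/
def nm (x : Pt d) : ℕ := Finset.univ.sup fun i => (x i).natAbs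

lemma nm_le {x : Pt d} {r : ℕ} : nm x ≤ r ↔ ∀ i, (x i).natAbs ≤ r := by
  simp [nm]

lemma le_nm (x : Pt d) (i : Fin d) : (x i).natAbs ≤ nm x := nm_le.1 le_rfl i

lemma nm_add (x y : Pt d) : nm (x + y) ≤ nm x + nm y := by
  rw [nm_le]; intro i
  have := le_nm x i; have := le_nm y i
  simp only [Pi.add_apply]; omega

lemma nm_neg (x : Pt d) : nm (-x) = nm x := by simp [nm]

lemma nm_stp (s : Fin d × Bool) : nm (stp s) ≤ 1 := by
  rw [nm_le]; intro i
  rcases s with ⟨j, b⟩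
  by_cases h : i = j
  · subst h; cases b <;> simp [stp]
  · simp [stp, h]

lemma nm_sub_comm (x y : Pt d) : nm (x - y) = nm (y - x) := by
  rw [← nm_neg, neg_sub]

lemma nm_zero_iff (x : Pt d) : nm x = 0 ↔ x = 0 := by
  constructor
  · intro h
    ext i
    have := le_nm x i
    simp only [Pi.zero_apply]; omega
  · rintro rfl; simp [nm]

lemma nm_tri (x y z : Pt d) : nm (x - z) ≤ nm (x - y) + nm (y - z) := by
  have := nm_add (x - y) (y - z); simpa using this

lemma lzp_zero_of_lt (t : ℕ) (x : Pt d) (h : t < nm x) : lzp t x = 0 := by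
  induction t generalizing x with
  | zero =>
    have : x ≠ 0 := by rintro rfl; simp [nm] at h
    simp [lzp, ind, this]
  | succ t ih =>
    rw [lzp, ih x (by omega)]
    have : (fun s => lzp t (x + stp s)) = fun _ => 0 := by
      ext s
      apply ih
      have h1 := nm_tri x (x + stp s) 0
      have h2 := nm_stp s
      have h3 : x - (x + stp s) = - stp s := by abel
      rw [h3, nm_neg] at h1
      simp only [sub_zero] at h1
      omega
    rw [this, av_zero]; simp

lemma lzp_neg (t : ℕ) (x : Pt d) : lzp t (-x) = lzp t x := by
  induction t generalizing x with
  | zero => simp [lzp, ind]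
  | succ t ih =>
    rw [lzp, lzp, ih, ← av_equiv nstp]
    congr 3; ext s
    rw [stp_nstp, ← ih (x + stp s)]
    congr 1; abel

lemma hh_neg (x : Pt d) : hh (-x) = hh x := by simp [hh, lzp_neg]

lemma one_le_hh : 1 ≤ hh (0 : Pt d) := by
  refine le_trans ?_ (ENNReal.le_tsum 0)
  simp [lzp, ind]

/-- Uniform decay of the Green function. -/
theorem hh_decay (hd : 5 ≤ d) : ∃ H : ℕ → ℝ≥0∞, (∀ r, H r ≠ ⊤) ∧ Filter.Tendsto H Filter.atTop (nhds 0) ∧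
    (∀ r s, r ≤ s → H s ≤ H r) ∧
    ∀ (x : Pt d) r, r ≤ nm x → hh x ≤ H r := by
  obtain ⟨K, hK0, hKt, hK⟩ := lzp_sq hd
  have hpt : ∀ t (x : Pt d), lzp t x ≤ K * psi t := by
    intro t x
    have := (ENNReal.le_tsum x).trans (hK t)
    exact (ENNReal.pow_le_pow_left_iff (by norm_num)).1 this
  have hS : ∑' t, K * psi t ≠ ⊤ := by
    rw [ENNReal.tsum_mul_left]; exact ENNReal.mul_ne_top hKt psi_sum
  refine ⟨fun r => ∑' t, K * psi (t + r), ?_, ENNReal.tendsto_sum_nat_add _ hS, ?_, ?_⟩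
  · intro r
    refine ne_top_of_le_ne_top hS ?_
    exact ENNReal.tsum_comp_le_tsum_of_injective (f := fun t => t + r) (fun a b h => by simpa using h)
      (fun t => K * psi t)
  · intro r s hrs
    have := ENNReal.tsum_comp_le_tsum_of_injective (f := fun t => t + (s - r)) (fun a b h => by simpa using h)
      (fun t => K * psi (t + r))
    have e : ∀ t, K * psi (t + s) = K * psi (t + (s - r) + r) := by
      intro t
      have h9 : t + (s - r) + r = t + s := by omega
      rw [h9]
    refine le_trans ?_ this
    exact ENNReal.tsum_le_tsum fun t => (e t).le
  · intro x r hr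
    unfold hh
    rw [← ENNReal.summable.sum_add_tsum_nat_add' (k := r)]
    rw [Finset.sum_eq_zero, zero_add]
    · exact ENNReal.tsum_le_tsum fun t => hpt _ _
    · intro t ht
      rw [Finset.mem_range] at ht
      exact lzp_zero_of_lt t x (by omega)

lemma hh_ne_top (hd : 5 ≤ d) (x : Pt d) : hh x ≠ ⊤ := by
  obtain ⟨H, h1, _, _, h2⟩ := hh_decay hd
  exact ne_top_of_le_ne_top (h1 0) (h2 x 0 (Nat.zero_le _))

lemma hh_eq (x : Pt d) : hh x = ind 0 x + (2⁻¹ * hh x + 2⁻¹ * av fun s => hh (x + stp s)) := by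
  conv_lhs => unfold hh
  rw [tsum_eq_zero_add' ENNReal.summable]
  simp only [lzp]
  rw [ENNReal.tsum_add, ENNReal.tsum_mul_left, ENNReal.tsum_mul_left, ← av_tsum]
  rfl

lemma hh_super (hd : 5 ≤ d) (x : Pt d) : (av fun s => hh (x + stp s)) ≤ hh x := by
  have h1 := hh_eq x
  have ht := hh_ne_top hd x
  set a := av fun s => hh (x + stp s)
  have h2 : 2⁻¹ * hh x + 2⁻¹ * a ≤ hh x := by conv_rhs => rw [h1]
                                              exact le_add_self
  have h3 : hh x = 2⁻¹ * hh x + 2⁻¹ * hh x := by rw [← add_mul, half_add_half, one_mul]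
  conv_rhs at h2 => rw [h3]
  have h4 : 2⁻¹ * a ≤ 2⁻¹ * hh x :=
    (ENNReal.add_le_add_iff_left (ENNReal.mul_ne_top (by simp) ht)).1 h2
  calc a = 2 * (2⁻¹ * a) := by rw [← mul_assoc, ENNReal.mul_inv_cancel (by simp) (by simp), one_mul]
    _ ≤ 2 * (2⁻¹ * hh x) := by gcongr
    _ = hh x := by rw [← mul_assoc, ENNReal.mul_inv_cancel (by simp) (by simp), one_mul]

theorem rho_le_hh (hd : 5 ≤ d) (W : Finset (Pt d)) (x : Pt d) :
    rho (↑W) x ≤ ∑ w ∈ W, hh (x - w) := by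
  refine HV_le (f := fun x => ∑ w ∈ W, hh (x - w)) (fun x => ?_) x
  have : ∑ w ∈ W, (av fun s => hh (x - w + stp s)) ≤ ∑ w ∈ W, hh (x - w) :=
    Finset.sum_le_sum fun w _ => hh_super hd _
  refine le_trans ?_ this
  rw [← av_sum]
  refine av_mono fun s => ?_
  split_ifs with h
  · refine le_trans ?_ (Finset.single_le_sum (f := fun w => hh (x - w + stp s)) (fun _ _ => bot_le)
      (Finset.mem_coe.1 h))
    rw [show x - (x + stp s) + stp s = 0 by abel]
    exact one_le_hh
  · refine le_of_eq (Finset.sum_congr rfl fun w _ => ?_)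
    congr 1; abel

end Green

section Sym
open Classical
open scoped ENNReal

variable {d : ℕ}

/-- A lattice symmetry: an injective map acting on steps by a permutation. -/
def IsSy (g : Pt d → Pt d) : Prop :=
  Function.Injective g ∧ ∃ π : (Fin d × Bool) ≃ (Fin d × Bool), ∀ x s, g (x + stp s) = g x + stp (π s)

lemma isSy_sym (σ : Equiv.Perm (Fin d)) (ε : Fin d → ℤ) (v : Pt d) (hε : ∀ i, ε i = 1 ∨ ε i = -1) :
    IsSy (SymImage d σ ε v) := by
  constructor
  · intro x y h
    ext j
    have := congrFun h (σ.symm j)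
    simp only [SymImage, Equiv.apply_symm_apply, add_right_inj] at this
    rcases hε (σ.symm j) with h | h <;> rw [h] at this <;> linarith
  · have hinv : ∀ s : Fin d × Bool, (if ε s.1 = 1 then (if ε s.1 = 1 then s.2 else !s.2) else
        !(if ε s.1 = 1 then s.2 else !s.2)) = s.2 := by
      intro s; split_ifs <;> simp
    refine ⟨⟨fun s => (σ.symm s.1, if ε (σ.symm s.1) = 1 then s.2 else !s.2),
      fun s => (σ s.1, if ε s.1 = 1 then s.2 else !s.2), ?_, ?_⟩, ?_⟩
    · intro s
      refine Prod.ext (by simp) ?_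
      simp only
      split_ifs <;> simp
    · intro s
      refine Prod.ext (by simp) ?_
      simp only [Equiv.symm_apply_apply]
      split_ifs <;> simp
    · rintro x ⟨j, b⟩
      ext i
      simp only [SymImage, Pi.add_apply, stp, Equiv.coe_fn_mk]
      by_cases hij : σ i = j
      · subst hij
        simp only [Pi.single_eq_same, Equiv.symm_apply_apply]
        rcases hε i with h | h <;> rw [h] <;> cases b <;> norm_num <;> ring
      · have : i ≠ σ.symm j := fun h => hij (by simp [h])
        simp [hij, this]

lemma ex_sy {g : Pt d → Pt d} (hg : IsSy g) (W : Set (Pt d)) (φ : Pt d → ℝ≥0∞) (t : ℕ) (x : Pt d) :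
    ex (g '' W) φ t (g x) = ex W (fun y => φ (g y)) t x := by
  obtain ⟨hi, π, hπ⟩ := hg
  induction t generalizing x with
  | zero =>
    simp only [ex]
    rw [← av_equiv π]
    simp_rw [← hπ, hi.mem_set_image]
  | succ t ih =>
    simp only [ex]
    rw [← av_equiv π]
    simp_rw [← hπ, hi.mem_set_image, ih]

lemma HV_sy {g : Pt d → Pt d} (hg : IsSy g) (W : Set (Pt d)) (φ : Pt d → ℝ≥0∞) (x : Pt d) :
    HV (g '' W) φ (g x) = HV W (fun y => φ (g y)) x := by
  unfold HV; simp_rw [ex_sy hg]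

lemma rho_sy {g : Pt d → Pt d} (hg : IsSy g) (W : Set (Pt d)) (x : Pt d) :
    rho (g '' W) (g x) = rho W x := HV_sy hg W _ x

lemma es_sy {g : Pt d → Pt d} (hg : IsSy g) (W : Set (Pt d)) (x : Pt d) :
    es (g '' W) (g x) = es W x := by unfold es; rw [rho_sy hg]

lemma kW_sy {g : Pt d → Pt d} (hg : IsSy g) (W : Set (Pt d)) (x y : Pt d) :
    kW (g '' W) (g x) (g y) = kW W x y := by
  unfold kW
  rw [HV_sy hg]
  congr 1; ext z
  simp [ind, hg.1.eq_iff]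

lemma isSy_add (v : Pt d) : IsSy (fun x => v + x) :=
  ⟨add_right_injective v, Equiv.refl _, fun x s => by simp [add_assoc]⟩

lemma isSy_comp {g h : Pt d → Pt d} (hg : IsSy g) (hh : IsSy h) : IsSy (fun x => g (h x)) := by
  obtain ⟨hi, π, hπ⟩ := hg
  obtain ⟨hi', π', hπ'⟩ := hh
  exact ⟨hi.comp hi', π'.trans π, fun x s => by beta_reduce; rw [hπ', hπ]; rfl⟩

/-- Some symmetry fixing the origin takes one given step to another. -/
lemma exists_sy_step (s s' : Fin d × Bool) : ∃ g : Pt d → Pt d, IsSy g ∧ g 0 = 0 ∧ g (stp s) = stp s' := by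
  have h := isSy_sym (Equiv.swap s.1 s'.1) (fun _ => if s.2 = s'.2 then 1 else -1) 0
    (fun i => by split_ifs <;> simp)
  refine ⟨_, h, by ext i; simp [SymImage], ?_⟩
  ext i
  rcases s with ⟨a, b⟩
  rcases s' with ⟨a', b'⟩
  simp only [SymImage, stp, Pi.zero_apply, zero_add]
  by_cases hi : i = a'
  · subst hi
    simp only [Equiv.swap_apply_right, Pi.single_eq_same]
    cases b <;> cases b' <;> simp
  · have : Equiv.swap a a' i ≠ a := by
      intro h
      apply hi
      have := congrArg (Equiv.swap a a') h
      simpa using this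
    simp [hi, this]

/-- Killed walk. -/
noncomputable def kl (W : Set (Pt d)) : ℕ → Pt d → Pt d → ℝ≥0∞
  | 0, x, y => ind y x
  | t + 1, x, y => av fun s => if x + stp s ∈ W then 0 else kl W t (x + stp s) y

lemma ex_eq_kl (W : Set (Pt d)) (y : Pt d) (t : ℕ) (x : Pt d) :
    ex W (ind y) t x = kl W t x y * av fun s => if y + stp s ∈ W then 1 else 0 := by
  induction t generalizing x with
  | zero =>
    simp only [ex, kl, ind]
    by_cases h : x = y
    · subst h; simp
    · simp [h, av_zero]
  | succ t ih =>
    simp only [ex, kl]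
    rw [mul_comm, ← av_mul]
    congr 1; ext s
    split_ifs
    · simp
    · rw [ih, mul_comm]

lemma av_comm (f : Fin d × Bool → Fin d × Bool → ℝ≥0∞) :
    (av fun s => av fun r => f s r) = av fun r => av fun s => f s r := by
  unfold av
  simp_rw [Finset.mul_sum]
  rw [Finset.sum_comm]

lemma kl_last (W : Set (Pt d)) (t : ℕ) (x y : Pt d) (hx : x ∉ W) (hy : y ∉ W) :
    kl W (t + 1) x y = av fun s => if y + stp s ∈ W then 0 else kl W t x (y + stp s) := by
  induction t generalizing x with
  | zero =>
    rw [kl, ← av_equiv nstp]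
    congr 1; ext s
    simp only [kl, ind, stp_nstp]
    by_cases h : x + -stp s = y
    · subst h
      simp [hx, hy]
    · have h' : ¬ (x = y + stp s) := by
        intro h'; apply h; rw [h']; simp
      simp [h, h']
  | succ t ih =>
    rw [kl]
    have h1 : ∀ s, (if x + stp s ∈ W then 0 else kl W (t + 1) (x + stp s) y) =
        av fun r => (if x + stp s ∈ W then 0 else if y + stp r ∈ W then 0 else kl W t (x + stp s) (y + stp r)) := by
      intro s
      split_ifs with h
      · rw [av_zero]
      · exact ih _ h
    simp_rw [h1]
    rw [av_comm]
    congr 1; ext r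
    split_ifs with h
    · simp [av_zero]
    · rw [kl]

lemma kl_symm (W : Set (Pt d)) (t : ℕ) (x y : Pt d) (hx : x ∉ W) (hy : y ∉ W) :
    kl W t x y = kl W t y x := by
  induction t generalizing x with
  | zero => simp [kl, ind, eq_comm]
  | succ t ih =>
    rw [kl_last W t y x hy hx, kl]
    congr 1; ext s
    split_ifs with h
    · rfl
    · exact ih _ h

lemma av_adj (z : Pt d) (s : Fin d × Bool) :
    (av fun r => if z + stp s + stp r ∈ ({z} : Set (Pt d)) then 1 else 0) = ((2 * d : ℕ) : ℝ≥0∞)⁻¹ := by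
  unfold av
  rw [Finset.sum_eq_single (nstp s)]
  · simp [stp_nstp]
  · intro r _ hr
    rw [if_neg]
    intro h
    apply hr
    apply stp_injective
    rw [stp_nstp]
    simp only [Set.mem_singleton_iff, add_assoc, add_eq_left] at h
    rw [eq_neg_iff_add_eq_zero, add_comm]; exact h
  · simp

lemma stp_ne_zero (s : Fin d × Bool) : stp s ≠ 0 := by
  intro h
  have := congrFun h s.1
  simp only [stp, Pi.single_eq_same, Pi.zero_apply] at this
  split_ifs at this <;> omega

lemma kW_symm_single (z : Pt d) (s s' : Fin d × Bool) :
    kW {z} (z + stp s) (z + stp s') = kW {z} (z + stp s') (z + stp s) := by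
  unfold kW HV
  congr 1; ext t
  have e1 := av_adj z s
  have e2 := av_adj z s'
  simp only [Set.mem_singleton_iff] at e1 e2
  rw [ex_eq_kl, ex_eq_kl]
  simp only [Set.mem_singleton_iff]
  rw [e1, e2, kl_symm]
  · simp [stp_ne_zero]
  · simp [stp_ne_zero]

/-- Off-support: the last position before hitting `W` is off `W` and adjacent to `W`. -/
lemma kW_supp (W : Set (Pt d)) (x y : Pt d) (hx : x ∉ W) (h : kW W x y ≠ 0) :
    y ∉ W ∧ ∃ s, y + stp s ∈ W := by
  have h1 : ∃ t, ex W (ind y) t x ≠ 0 := by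
    by_contra hc
    push Not at hc
    exact h (by simp [kW, HV, hc])
  obtain ⟨t, ht⟩ := h1
  rw [ex_eq_kl] at ht
  have hk : kl W t x y ≠ 0 := left_ne_zero_of_mul ht
  have ha := right_ne_zero_of_mul ht
  constructor
  · clear ht ha h
    induction t generalizing x with
    | zero =>
      simp only [kl, ind] at hk
      by_cases he : x = y
      · rwa [← he]
      · simp [he] at hk
    | succ t ih =>
      rw [kl] at hk
      by_contra hy
      apply hk
      have : (fun s => if x + stp s ∈ W then 0 else kl W t (x + stp s) y) = fun _ => 0 := by
        ext s
        split_ifs with h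
        · rfl
        · by_contra h2
          exact ih _ h h2 hy
      rw [this, av_zero]
  · by_contra hc
    push Not at hc
    apply ha
    simp [hc, av_zero]

lemma kW_step (W : Set (Pt d)) (x y : Pt d) (s : Fin d × Bool) (h : x + stp s ∉ W) :
    ((2 * d : ℕ) : ℝ≥0∞)⁻¹ * kW W (x + stp s) y ≤ kW W x y := by
  conv_rhs => rw [kW, HV_eq]
  refine le_trans ?_ (le_av s _)
  rw [if_neg h, kW]

lemma kW_self (W : Set (Pt d)) (y : Pt d) (s : Fin d × Bool) (h : y + stp s ∈ W) :
    ((2 * d : ℕ) : ℝ≥0∞)⁻¹ ≤ kW W y y := by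
  rw [kW, HV_eq]
  refine le_trans ?_ (le_av s _)
  simp [h, ind]

lemma es_step (hd : 0 < d) (A : Set (Pt d)) (x : Pt d) (s : Fin d × Bool) (h : x + stp s ∉ A) :
    ((2 * d : ℕ) : ℝ≥0∞)⁻¹ * es A (x + stp s) ≤ es A x := by
  rw [es_eq hd A x]
  refine le_trans ?_ (le_av s _)
  rw [if_neg h]

lemma es_ray (hd : 0 < d) (A : Set (Pt d)) (x : Pt d) (s : Fin d × Bool) (L : ℕ)
    (h : ∀ t : ℕ, 1 ≤ t → t ≤ L → x + t • stp s ∉ A) :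
    (((2 * d : ℕ) : ℝ≥0∞)⁻¹) ^ L * es A (x + L • stp s) ≤ es A x := by
  induction L with
  | zero => simp
  | succ L ih =>
    refine le_trans ?_ (ih fun t h1 h2 => h t h1 (by omega))
    rw [pow_succ, mul_assoc]
    gcongr
    have := es_step hd A (x + L • stp s) s (by
      have := h (L + 1) (by omega) le_rfl
      rwa [add_smul, one_smul, ← add_assoc] at this)
    rwa [add_smul, one_smul, ← add_assoc]

lemma kW_ray (W : Set (Pt d)) (x y : Pt d) (s : Fin d × Bool) (L : ℕ)
    (h : ∀ t : ℕ, 1 ≤ t → t ≤ L → x + t • stp s ∉ W) :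
    (((2 * d : ℕ) : ℝ≥0∞)⁻¹) ^ L * kW W (x + L • stp s) y ≤ kW W x y := by
  induction L with
  | zero => simp
  | succ L ih =>
    refine le_trans ?_ (ih fun t h1 h2 => h t h1 (by omega))
    rw [pow_succ, mul_assoc]
    gcongr
    have := kW_step W (x + L • stp s) y s (by
      have := h (L + 1) (by omega) le_rfl
      rwa [add_smul, one_smul, ← add_assoc] at this)
    rwa [add_smul, one_smul, ← add_assoc]

lemma inv2d_ne_zero : ((2 * d : ℕ) : ℝ≥0∞)⁻¹ ≠ 0 := by
  simp only [Ne, ENNReal.inv_eq_zero]; exact ENNReal.natCast_ne_top _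

lemma es_half (hd : 5 ≤ d) (A : Finset (Pt d)) (p : Pt d) (η : ℝ≥0∞)
    (h : ∀ a ∈ A, hh (p - a) ≤ η) (hη : A.card * η ≤ 2⁻¹) : 2⁻¹ ≤ es (↑A) p := by
  have h1 : rho (↑A) p ≤ 2⁻¹ := by
    refine (rho_le_hh hd A p).trans ((Finset.sum_le_sum h).trans ?_)
    simpa using hη
  have h2 := rho_add_es (by omega) (↑A : Set (Pt d)) p
  unfold es
  calc (2⁻¹ : ℝ≥0∞) = 1 - 2⁻¹ := by
        refine ENNReal.eq_sub_of_add_eq (by simp) half_add_half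
    _ ≤ _ := tsub_le_tsub_left h1 _

lemma small_hh (hd : 5 ≤ d) (n : ℕ) : ∃ R : ℕ, ∀ η' : Pt d, R ≤ nm η' → (n : ℝ≥0∞) * hh η' ≤ 2⁻¹ := by
  obtain ⟨H, hH, hlim, hmono, hle⟩ := hh_decay hd
  have h2 : Filter.Tendsto (fun r => (n : ℝ≥0∞) * H r) Filter.atTop (nhds 0) := by
    have := ENNReal.Tendsto.const_mul hlim (Or.inr (ENNReal.natCast_ne_top n))
    simpa using this
  have h3 := (h2.eventually (gt_mem_nhds (by simp : (0 : ℝ≥0∞) < 2⁻¹))).exists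
  obtain ⟨R, hR⟩ := h3
  exact ⟨R, fun x hx => (mul_le_mul_right (hle x R hx) _).trans hR.le⟩

lemma nm_ray (s : Fin d × Bool) (t : ℕ) : nm (t • stp s) = t := by
  apply le_antisymm
  · rw [nm_le]; intro i
    have := (le_nm (stp s) i).trans (nm_stp s)
    simp only [Pi.smul_apply, nsmul_eq_mul, Int.natAbs_mul, Int.natAbs_natCast]
    nlinarith
  · have := le_nm (t • stp s) s.1
    have h1 : (stp s s.1).natAbs = 1 := by
      simp only [stp, Pi.single_eq_same]; split_ifs <;> rfl
    simp only [Pi.smul_apply, nsmul_eq_mul, Int.natAbs_mul, Int.natAbs_natCast] at this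
    rw [← nsmul_eq_mul, h1, mul_one] at this
    exact this

lemma es_pos_ray (hd : 5 ≤ d) (A : Finset (Pt d)) (x : Pt d) (s : Fin d × Bool)
    (h : ∀ t : ℕ, 1 ≤ t → x + t • stp s ∉ A) : es (↑A : Set (Pt d)) x ≠ 0 := by
  obtain ⟨R, hR⟩ := small_hh hd A.card
  set M := A.sup fun a => nm (x - a) with hM
  have h1 := es_ray (by omega) (↑A) x s (R + M) (fun t h1 _ => by simpa using h t h1)
  have h2 : 2⁻¹ ≤ es (↑A : Set (Pt d)) (x + (R + M) • stp s) := by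
    have hcl : ∀ a ∈ A, (A.card : ℝ≥0∞) * hh (x + (R + M) • stp s - a) ≤ 2⁻¹ := by
      intro a ha
      apply hR
      have e1 : nm (x - a) ≤ M := Finset.le_sup (f := fun a => nm (x - a)) ha
      have e2 := nm_tri ((R + M) • stp s) (a - x) 0
      have e3 : (R + M) • stp s - (a - x) = x + (R + M) • stp s - a := by abel
      rw [e3, sub_zero, sub_zero, nm_ray, nm_sub_comm a x] at e2
      omega
    refine es_half hd A _ (A.sup fun a => hh (x + (R + M) • stp s - a)) (fun a ha => Finset.le_sup (f := fun a => hh (x + (R + M) • stp s - a)) ha) ?_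
    rcases A.eq_empty_or_nonempty with rfl | hne
    · simp
    · obtain ⟨a, ha, he⟩ := Finset.exists_mem_eq_sup A hne (fun a => hh (x + (R + M) • stp s - a))
      rw [he]; exact hcl a ha
  intro h0
  rw [h0] at h1
  have h3 : (((2 * d : ℕ) : ℝ≥0∞)⁻¹) ^ (R + M) * 2⁻¹ = 0 :=
    le_antisymm ((mul_le_mul_right h2 _).trans h1) bot_le
  rcases mul_eq_zero.1 h3 with h4 | h4
  · exact pow_ne_zero _ inv2d_ne_zero h4
  · simp at h4

/-- Uniform escape bound for small sets. -/
theorem es_unif (hd : 5 ≤ d) : ∃ c : ℝ≥0∞, c ≠ 0 ∧ c ≤ 1 ∧ ∀ (A : Finset (Pt d)) (x : Pt d), A.card ≤ 3 → x ∈ A →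
    c ≤ es (↑A : Set (Pt d)) x := by
  obtain ⟨R, hR⟩ := small_hh hd 3
  refine ⟨(((2 * d : ℕ) : ℝ≥0∞)⁻¹) ^ (2 * R) * 2⁻¹, ?_, ?_, ?_⟩
  · exact mul_ne_zero (pow_ne_zero _ inv2d_ne_zero) (by simp)
  · refine mul_le_one' (pow_le_one' ?_ _) (by simp)
    exact ENNReal.inv_le_one.2 (by exact_mod_cast (by omega : 1 ≤ 2 * d))
  intro A x hA hx
  have hdir : ∃ i : Fin d, ∀ a ∈ A.erase x, ∃ j, j ≠ i ∧ (a i - x i).natAbs ≤ (a j - x j).natAbs := by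
    by_contra hc
    push Not at hc
    choose f hf1 hf2 using hc
    have hcard : (A.erase x).card < (Finset.univ : Finset (Fin d)).card := by
      rw [Finset.card_erase_of_mem hx, Finset.card_univ, Fintype.card_fin]; omega
    obtain ⟨i, _, j, _, hij, he⟩ := Finset.exists_ne_map_eq_of_card_lt_of_maps_to hcard
      (f := f) (fun i _ => hf1 i)
    have h1 := hf2 i j hij.symm
    have h2 := hf2 j i hij
    rw [he] at h1
    omega
  obtain ⟨i, hi⟩ := hdir
  have hcoord : ∀ (t : ℕ) j, (x + t • stp (i, true)) j = x j + if j = i then (t : ℤ) else 0 := by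
    intro t j
    by_cases h : j = i
    · subst h; simp [stp]
    · simp [stp, h]
  have h1 := es_ray (by omega) (↑A : Set (Pt d)) x (i, true) (2 * R) (fun t ht _ hm => by
    have hne : x + t • stp (i, true) ≠ x := by
      intro he
      have := congrFun he i
      rw [hcoord] at this; simp at this; omega
    obtain ⟨j, hj, hle⟩ := hi _ (Finset.mem_erase.2 ⟨hne, by simpa using hm⟩)
    rw [hcoord, hcoord] at hle
    simp [hj] at hle; omega)
  refine le_trans (mul_le_mul_right ?_ _) h1
  have hcl : ∀ a ∈ A, (3 : ℕ) * hh (x + (2 * R) • stp (i, true) - a) ≤ 2⁻¹ := by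
    intro a ha
    apply hR
    by_cases hax : a = x
    · subst hax
      rw [add_sub_cancel_left, nm_ray]; omega
    · obtain ⟨j, hj, hle⟩ := hi a (Finset.mem_erase.2 ⟨hax, ha⟩)
      have e1 := le_nm (x + (2 * R) • stp (i, true) - a) i
      have e2 := le_nm (x + (2 * R) • stp (i, true) - a) j
      rw [Pi.sub_apply, hcoord] at e1 e2
      simp only [hj, if_true, if_false] at e1 e2
      push_cast at e1 e2
      omega
  have hne : A.Nonempty := ⟨x, hx⟩
  refine es_half hd A _ (A.sup fun a => hh (x + (2 * R) • stp (i, true) - a)) (fun a ha => Finset.le_sup (f := fun a => hh (x + (2 * R) • stp (i, true) - a)) ha) ?_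
  obtain ⟨a, ha, he⟩ := Finset.exists_mem_eq_sup A hne (fun a => hh (x + (2 * R) • stp (i, true) - a))
  rw [he]
  refine le_trans ?_ (hcl a ha)
  gcongr

end Sym

section Lower
open Classical
open scoped ENNReal

variable {d : ℕ}

lemma inv_pow_conv (t : ℝ) (h1 : t < 1) (h2 : -1 < t) (m : ℕ) :
    2 + m * (m + 1) * t ^ 2 ≤ ((1 + t)⁻¹) ^ m + ((1 - t)⁻¹) ^ m ∧
      2 * m * t ^ 2 ≤ t * (((1 - t)⁻¹) ^ m - ((1 + t)⁻¹) ^ m) := by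
  have hp : 0 < 1 + t := by linarith
  have hq : 0 < 1 - t := by linarith
  induction m with
  | zero => norm_num
  | succ m ih =>
    obtain ⟨i1, i2⟩ := ih
    have ea : ((1 + t)⁻¹) ^ m = (1 + t) * ((1 + t)⁻¹) ^ (m + 1) := by
      rw [pow_succ]; field_simp
    have eb : ((1 - t)⁻¹) ^ m = (1 - t) * ((1 - t)⁻¹) ^ (m + 1) := by
      rw [pow_succ]; field_simp
    rw [ea, eb] at i1 i2
    have pa : 0 < ((1 + t)⁻¹) ^ (m + 1) := by positivity
    have pb : 0 < ((1 - t)⁻¹) ^ (m + 1) := by positivity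
    set a := ((1 + t)⁻¹) ^ (m + 1)
    set b := ((1 - t)⁻¹) ^ (m + 1)
    have hm : (0 : ℝ) ≤ 2 * m * t ^ 2 := by positivity
    have hm2 : (0 : ℝ) ≤ m * (m + 1) * t ^ 2 := by positivity
    have k1 : t * (b - a) = t * ((1 - t) * b - (1 + t) * a) + t ^ 2 * (a + b) := by ring
    have k2 : 0 ≤ t * (b - a) := by
      rw [k1]; have : 0 ≤ t ^ 2 * (a + b) := by positivity
      linarith
    have k3 : a + b = (1 + t) * a + (1 - t) * b + t * (b - a) := by ring
    have k4 : 2 ≤ a + b := by rw [k3]; linarith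
    have k5 : 2 * (m + 1) * t ^ 2 ≤ t * (b - a) := by
      rw [k1]; nlinarith [sq_nonneg t]
    push_cast
    constructor
    · nlinarith
    · linarith

/-- Squared Euclidean norm. -/
noncomputable def r2 (x : Pt d) : ℝ := ∑ i, ((x i : ℝ)) ^ 2

lemma r2_nonneg (x : Pt d) : 0 ≤ r2 x := Finset.sum_nonneg fun _ _ => sq_nonneg _

lemma r2_add (x : Pt d) (i : Fin d) (b : Bool) :
    r2 (x + stp (i, b)) = r2 x + 1 + (if b then 1 else -1) * (2 * (x i : ℝ)) := by
  unfold r2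
  rw [← Finset.add_sum_erase _ _ (Finset.mem_univ i), ← Finset.add_sum_erase _ (fun i => (x i : ℝ) ^ 2) (Finset.mem_univ i)]
  have : ∑ j ∈ Finset.univ.erase i, (((x + stp (i, b)) j : ℤ) : ℝ) ^ 2 = ∑ j ∈ Finset.univ.erase i, (x j : ℝ) ^ 2 := by
    refine Finset.sum_congr rfl fun j hj => ?_
    have : j ≠ i := Finset.ne_of_mem_erase hj
    simp [stp, this]
  rw [this]
  cases b <;> simp [stp] <;> ring

/-- Polynomially decaying, eventually strictly subharmonic function. -/
noncomputable def h2 (x : Pt d) : ℝ := ((r2 x + 1)⁻¹) ^ d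

lemma h2_sub (hd : 5 ≤ d) (x : Pt d) (hx : 2 * ((d : ℝ) + 1) < r2 x + 2) :
    2 * d * h2 x < ∑ s, h2 (x + stp s) := by
  have hd0 : (0 : ℝ) < d := by exact_mod_cast (by omega : 0 < d)
  set u := r2 x + 2 with hu
  have hupos : 0 < u := by nlinarith
  rw [Fintype.sum_prod_type]
  simp only [Fintype.sum_bool]
  have hxi : ∀ i : Fin d, (x i : ℝ) ^ 2 ≤ r2 x := fun i =>
    Finset.single_le_sum (f := fun i => (x i : ℝ) ^ 2) (fun _ _ => sq_nonneg _) (Finset.mem_univ i)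
  have key : ∀ i : Fin d, (u⁻¹) ^ d * (2 + d * (d + 1) * (2 * (x i : ℝ) / u) ^ 2) ≤
      h2 (x + stp (i, true)) + h2 (x + stp (i, false)) := by
    intro i
    have hlt : |2 * (x i : ℝ)| < u := by
      rw [abs_lt]; constructor <;> nlinarith [hxi i, sq_nonneg ((x i : ℝ) - 1), sq_nonneg ((x i : ℝ) + 1)]
    have ht1 : 2 * (x i : ℝ) / u < 1 := by rw [div_lt_one hupos]; exact (abs_lt.1 hlt).2
    have ht2 : -1 < 2 * (x i : ℝ) / u := by rw [lt_div_iff₀ hupos]; linarith [(abs_lt.1 hlt).1]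
    have := (inv_pow_conv _ ht1 ht2 d).1
    have e1 : h2 (x + stp (i, true)) = (u⁻¹) ^ d * ((1 + 2 * (x i : ℝ) / u)⁻¹) ^ d := by
      unfold h2
      rw [← mul_pow, ← mul_inv, r2_add]
      congr 2
      field_simp
      simp only [hu, if_true]; ring
    have e2 : h2 (x + stp (i, false)) = (u⁻¹) ^ d * ((1 - 2 * (x i : ℝ) / u)⁻¹) ^ d := by
      unfold h2
      rw [← mul_pow, ← mul_inv, r2_add]
      congr 2
      field_simp
      simp [hu]; ring
    rw [e1, e2, ← mul_add]
    gcongr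
  refine lt_of_lt_of_le ?_ (Finset.sum_le_sum fun i _ => key i)
  rw [← Finset.mul_sum, Finset.sum_add_distrib]
  have e3 : ∑ i : Fin d, (d : ℝ) * (d + 1) * (2 * (x i : ℝ) / u) ^ 2 = d * (d + 1) * 4 * (u - 2) / u ^ 2 := by
    rw [← Finset.mul_sum]
    have : ∀ i : Fin d, (2 * (x i : ℝ) / u) ^ 2 = 4 / u ^ 2 * (x i : ℝ) ^ 2 := by intro i; ring
    simp_rw [this]
    rw [← Finset.mul_sum, show ∑ i, (x i : ℝ) ^ 2 = u - 2 by rw [hu]; unfold r2; ring]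
    ring
  rw [e3]
  simp only [Finset.sum_const, Finset.card_univ, Fintype.card_fin, nsmul_eq_mul]
  have e4 : h2 x = (u⁻¹) ^ d * ((1 - 1 / u)⁻¹) ^ d := by
    unfold h2
    rw [← mul_pow, ← mul_inv]
    congr 2
    field_simp
    simp only [hu]; ring
  rw [e4]
  have hb : 1 - d / u ≤ (1 - 1 / u) ^ d := by
    have := one_add_mul_le_pow (a := -(1 / u)) (by
      have : 1 / u ≤ 1 := by rw [div_le_one hupos]; nlinarith
      linarith) d
    calc 1 - d / u = 1 + d * -(1 / u) := by ring
      _ ≤ _ := this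
      _ = _ := by ring
  have hpos : 0 < 1 - d / u := by
    rw [sub_pos, div_lt_one hupos]; linarith
  have hb2 : ((1 - 1 / u)⁻¹) ^ d ≤ (1 - d / u)⁻¹ := by
    rw [inv_pow]; exact inv_anti₀ hpos hb
  calc 2 * (d : ℝ) * ((u⁻¹) ^ d * ((1 - 1 / u)⁻¹) ^ d) ≤ 2 * d * ((u⁻¹) ^ d * (1 - d / u)⁻¹) := by gcongr
    _ < (u⁻¹) ^ d * (d * 2 + d * (d + 1) * 4 * (u - 2) / u ^ 2) := by
        rw [show 2 * (d : ℝ) * ((u⁻¹) ^ d * (1 - d / u)⁻¹) = (u⁻¹) ^ d * (2 * d * (1 - d / u)⁻¹) by ring]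
        refine mul_lt_mul_of_pos_left ?_ (by positivity)
        have hud : 0 < u - d := by linarith
        rw [show 2 * (d : ℝ) * (1 - d / u)⁻¹ = 2 * d * (u / (u - d)) by
          congr 1; field_simp]
        rw [show (d : ℝ) * 2 + d * (d + 1) * 4 * (u - 2) / u ^ 2 = 2 * d * ((u ^ 2 + 2 * (d + 1) * (u - 2)) / u ^ 2) by
          field_simp; ring]
        refine mul_lt_mul_of_pos_left ?_ (by positivity)
        rw [div_lt_div_iff₀ hud (by positivity)]
        have : 0 < (u - 2 * (d + 1)) := by linarith
        nlinarith [mul_pos this hupos, mul_pos hd0 (mul_pos this hupos), mul_pos hd0 hupos, mul_pos hd0 hd0]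

lemma rho_step (hd : 0 < d) (W : Set (Pt d)) (x : Pt d) (s : Fin d × Bool) :
    ((2 * d : ℕ) : ℝ≥0∞)⁻¹ * rho W (x + stp s) ≤ rho W x := by
  conv_rhs => rw [rho, HV_eq]
  refine le_trans ?_ (le_av s _)
  gcongr
  split_ifs
  · exact rho_le_one hd _ _
  · exact le_rfl

lemma rho_adj (W : Set (Pt d)) (x : Pt d) (s : Fin d × Bool) (h : x + stp s ∈ W) :
    ((2 * d : ℕ) : ℝ≥0∞)⁻¹ ≤ rho W x := by
  conv_rhs => rw [rho, HV_eq]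
  refine le_trans ?_ (le_av s _)
  simp [h]

lemma rho_zero_ne (hd : 0 < d) (x : Pt d) : rho {0} x ≠ 0 := by
  have main : ∀ (N : ℕ) (x : Pt d), x ≠ 0 → (∑ i, (x i).natAbs) ≤ N → rho {0} x ≠ 0 := by
    intro N
    induction N with
    | zero =>
      intro x hx h
      exfalso; apply hx
      ext i
      have := Finset.single_le_sum (f := fun i => (x i).natAbs) (fun _ _ => Nat.zero_le _) (Finset.mem_univ i)
      simp only [Pi.zero_apply] at *; omega
    | succ N ih =>
      intro x hx h
      obtain ⟨i, hi⟩ : ∃ i, x i ≠ 0 := by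
        by_contra hc
        push Not at hc
        exact hx (funext hc)
      set s : Fin d × Bool := (i, decide (x i < 0)) with hs
      by_cases h0 : x + stp s = 0
      · intro hr
        have := rho_adj {0} x s h0
        rw [hr] at this
        exact inv2d_ne_zero (le_antisymm this bot_le)
      · have hlt : (∑ j, ((x + stp s) j).natAbs) ≤ N := by
          rw [← Finset.add_sum_erase _ _ (Finset.mem_univ i)] at h ⊢
          have : ∑ j ∈ Finset.univ.erase i, ((x + stp s) j).natAbs = ∑ j ∈ Finset.univ.erase i, (x j).natAbs := by
            refine Finset.sum_congr rfl fun j hj => ?_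
            have : j ≠ i := Finset.ne_of_mem_erase hj
            simp [stp, hs, this]
          rw [this]
          have h3 : ((x + stp s) i).natAbs + 1 = (x i).natAbs := by
            simp only [Pi.add_apply, stp, hs, Pi.single_eq_same, decide_eq_true_eq]
            split_ifs <;> omega
          omega
        intro hr
        have := rho_step hd {0} x s
        rw [hr] at this
        exact mul_ne_zero inv2d_ne_zero (ih _ h0 hlt) (le_antisymm this bot_le)
  by_cases hx : x = 0
  · subst hx
    intro hr
    have := rho_step hd {0} (0 : Pt d) (⟨0, hd⟩, true)
    rw [hr] at this
    refine mul_ne_zero inv2d_ne_zero (main _ _ ?_ le_rfl) (le_antisymm this bot_le)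
    simp [stp_ne_zero]
  · exact main _ x hx le_rfl

lemma finite_r2 (M : ℝ) : {x : Pt d | r2 x ≤ M}.Finite := by
  obtain ⟨N, hN⟩ := exists_nat_ge M
  refine (Set.finite_Icc (fun _ : Fin d => -(N : ℤ)) (fun _ => (N : ℤ))).subset fun x hx => ?_
  have hxi : ∀ i : Fin d, (x i) ^ 2 ≤ (N : ℤ) := fun i => by
    have h1 : (x i : ℝ) ^ 2 ≤ r2 x :=
      Finset.single_le_sum (f := fun i => (x i : ℝ) ^ 2) (fun _ _ => sq_nonneg _) (Finset.mem_univ i)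
    have h2 : (x i : ℝ) ^ 2 ≤ N := h1.trans (le_trans hx hN)
    exact_mod_cast h2
  constructor <;> intro i
  · have := hxi i; simp only; nlinarith [sq_nonneg (x i)]
  · have := hxi i; simp only; nlinarith [sq_nonneg (x i)]

lemma h2_le_one (x : Pt d) : h2 x ≤ 1 := by
  unfold h2
  refine pow_le_one₀ (by have := r2_nonneg x; positivity) (inv_le_one_of_one_le₀ (by linarith [r2_nonneg x]))

theorem rho_lower_real (hd : 5 ≤ d) : ∃ c : ℝ, 0 < c ∧ ∀ x : Pt d, c * h2 x ≤ (rho {0} x).toReal := by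
  have hd' : 0 < d := by omega
  have hd0 : (0 : ℝ) < d := by exact_mod_cast hd'
  set ρ : Pt d → ℝ := fun x => (rho {0} x).toReal with hρ
  have ht : ∀ x : Pt d, rho {0} x ≠ ⊤ := fun x => ne_top_of_le_ne_top ENNReal.one_ne_top (rho_le_one hd' _ _)
  have hpos : ∀ x, 0 < ρ x := fun x => ENNReal.toReal_pos (rho_zero_ne hd' x) (ht x)
  have hsup : ∀ x, ∑ s, ρ (x + stp s) ≤ 2 * d * ρ x := by
    intro x
    have h1 : (av fun s => rho {0} (x + stp s)) ≤ rho {0} x := by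
      conv_rhs => rw [rho, HV_eq]
      refine av_mono fun s => ?_
      split_ifs
      · exact rho_le_one hd' _ _
      · exact le_rfl
    have h2 := ENNReal.toReal_mono (ht x) h1
    rw [av, ENNReal.toReal_mul, ENNReal.toReal_sum (fun s _ => ht _), ENNReal.toReal_inv,
      ENNReal.toReal_natCast] at h2
    rw [inv_mul_le_iff₀ (by positivity)] at h2
    push_cast at h2
    exact h2
  have hfin := finite_r2 (d := d) (2 * d)
  obtain ⟨x1, hx1, hmin⟩ := Set.exists_min_image _ ρ hfin ⟨0, by simp [r2]⟩
  refine ⟨ρ x1, hpos x1, ?_⟩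
  set c := ρ x1 with hc
  have hcpos : 0 < c := hpos x1
  by_contra hcon
  push Not at hcon
  obtain ⟨x0, hx0⟩ := hcon
  set w : Pt d → ℝ := fun x => c * h2 x - ρ x with hw
  have hw0 : 0 < w x0 := by simp only [hw]; linarith
  have hF : {x : Pt d | w x0 ≤ c * h2 x}.Finite := by
    refine (finite_r2 (d := d) (c / w x0)).subset fun x hx => ?_
    have h3 : (1 : ℝ) ≤ r2 x + 1 := by linarith [r2_nonneg x]
    have h4 : h2 x ≤ (r2 x + 1)⁻¹ := by
      unfold h2
      exact pow_le_of_le_one (by positivity) (inv_le_one_of_one_le₀ h3) (by omega)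
    have h5 : w x0 ≤ c * (r2 x + 1)⁻¹ := le_trans hx (by gcongr)
    rw [← div_eq_mul_inv, le_div_iff₀ (by linarith)] at h5
    show r2 x ≤ _
    rw [le_div_iff₀ hw0]
    nlinarith
  obtain ⟨y, hy, hmax⟩ := Set.exists_max_image _ w hF ⟨x0, by
    show w x0 ≤ _
    simp only [hw]; linarith [hpos x0]⟩
  have hx0y : w x0 ≤ w y := hmax x0 (by
    show w x0 ≤ _
    simp only [hw]; linarith [hpos x0])
  have hglob : ∀ z, w z ≤ w y := by
    intro z
    by_cases hz : w x0 ≤ c * h2 z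
    · exact hmax z hz
    · have : w z ≤ c * h2 z := by simp only [hw]; linarith [hpos z]
      linarith
  by_cases hball : r2 y ≤ 2 * d
  · have h3 := hmin y hball
    have h4 : w y ≤ 0 := by
      simp only [hw]
      nlinarith [h2_le_one y]
    linarith
  · have h3 := h2_sub hd y (by push Not at hball; linarith)
    have h4 := hsup y
    have h5 : ∑ s, w (y + stp s) ≤ 2 * d * w y := by
      refine (Finset.sum_le_sum fun s _ => hglob (y + stp s)).trans ?_
      simp; linarith
    have h6 : ∑ s, w (y + stp s) = c * ∑ s, h2 (y + stp s) - ∑ s, ρ (y + stp s) := by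
      simp only [hw]; rw [Finset.sum_sub_distrib, Finset.mul_sum]
    rw [h6] at h5
    simp only [hw] at h5
    nlinarith

theorem rho_lower (hd : 5 ≤ d) : ∃ C : ℝ≥0∞, C ≠ ⊤ ∧ 1 ≤ C ∧ ∀ x : Pt d,
    (rho {0} x)⁻¹ ≤ C * ((nm x + 1 : ℕ) : ℝ≥0∞) ^ (2 * d) := by
  obtain ⟨c, hc, hlow⟩ := rho_lower_real hd
  refine ⟨ENNReal.ofReal (c⁻¹ * (d : ℝ) ^ d) + 1, by simp, by simp, fun x => ?_⟩
  have hd0 : (1 : ℝ) ≤ d := by exact_mod_cast (by omega : 1 ≤ d)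
  have ht : rho {0} x ≠ ⊤ := ne_top_of_le_ne_top ENNReal.one_ne_top (rho_le_one (by omega) _ _)
  have h1 : r2 x + 1 ≤ d * ((nm x : ℝ) + 1) ^ 2 := by
    have : r2 x ≤ d * (nm x : ℝ) ^ 2 := by
      unfold r2
      refine (Finset.sum_le_sum (g := fun _ => (nm x : ℝ) ^ 2) fun i _ => ?_).trans (by simp)
      rw [← sq_abs (x i : ℝ)]
      gcongr
      have := le_nm x i
      rw [← Int.cast_abs, Int.abs_eq_natAbs]
      exact_mod_cast this
    nlinarith [Nat.cast_nonneg (α := ℝ) (nm x)]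
  have h2' : ((d * ((nm x : ℝ) + 1) ^ 2)⁻¹) ^ d ≤ h2 x := by
    unfold h2
    have := r2_nonneg x
    gcongr
  have h3 : c * ((d * ((nm x : ℝ) + 1) ^ 2)⁻¹) ^ d ≤ (rho {0} x).toReal :=
    le_trans (by gcongr) (hlow x)
  have h4 : ENNReal.ofReal (c * ((d * ((nm x : ℝ) + 1) ^ 2)⁻¹) ^ d) ≤ rho {0} x := by
    rw [← ENNReal.ofReal_toReal ht]; exact ENNReal.ofReal_le_ofReal h3
  refine (ENNReal.inv_le_inv.2 h4).trans ?_
  rw [← ENNReal.ofReal_inv_of_pos (by positivity)]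
  have e : (c * ((d * ((nm x : ℝ) + 1) ^ 2)⁻¹) ^ d)⁻¹ = (c⁻¹ * (d : ℝ) ^ d) * ((nm x + 1 : ℕ) : ℝ) ^ (2 * d) := by
    rw [inv_pow, mul_inv, inv_inv, mul_pow, ← pow_mul]; push_cast; ring
  rw [e, ENNReal.ofReal_mul (by positivity), ENNReal.ofReal_pow (by positivity), ENNReal.ofReal_natCast]
  gcongr
  exact le_self_add

end Lower

section Cluster
open Classical
open scoped ENNReal

variable {d : ℕ}

/-- Good clusters: two or three points, two of which are adjacent. -/
def Good (A : Finset (Pt d)) : Prop :=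
  2 ≤ A.card ∧ A.card ≤ 3 ∧ ∃ z s, z ∈ A ∧ z + stp s ∈ A

/-- The type of good clusters. -/
abbrev Kl (d : ℕ) := {A : Finset (Pt d) // Good A}

/-- Capacity of a finite set. -/
noncomputable def capE (A : Finset (Pt d)) : ℝ≥0∞ := ∑ x ∈ A, es (↑A) x

lemma capE_le (A : Finset (Pt d)) : capE A ≤ A.card := by
  unfold capE
  refine (Finset.sum_le_sum fun x _ => es_le_one _ x).trans (by simp)

/-- Cluster kernel. -/
noncomputable def Tk (A A' : Kl d) : ℝ≥0∞ :=
  3⁻¹ * (∑ x ∈ A.1, es (↑A.1) x / rho (↑(A.1.erase x)) x *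
      ∑' y, kW (↑(A.1.erase x)) x y * (if A'.1 = insert y (A.1.erase x) then 1 else 0)
    + (3 - capE A.1) * (if A' = A then 1 else 0))

/-- Extension by zero of a function on good clusters. -/
noncomputable def ext0 (F : Kl d → ℝ≥0∞) (A : Finset (Pt d)) : ℝ≥0∞ :=
  if h : Good A then F ⟨A, h⟩ else 0

lemma tsum_ext0 (F : Kl d → ℝ≥0∞) (B : Finset (Pt d)) :
    ∑' A' : Kl d, (if A'.1 = B then 1 else 0) * F A' = ext0 F B := by
  unfold ext0
  split_ifs with h
  · rw [tsum_eq_single ⟨B, h⟩]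
    · simp
    · rintro ⟨A', hA'⟩ hne
      have : A' ≠ B := fun e => hne (by simp [e])
      simp [this]
  · rw [ENNReal.tsum_eq_zero]
    rintro ⟨A', hA'⟩
    have : A' ≠ B := fun e => h (e ▸ hA')
    simp [this]

lemma Tk_apply (F : Kl d → ℝ≥0∞) (A : Kl d) :
    kap Tk F A = 3⁻¹ * (∑ x ∈ A.1, es (↑A.1) x / rho (↑(A.1.erase x)) x *
      HV (↑(A.1.erase x)) (fun y => ext0 F (insert y (A.1.erase x))) x + (3 - capE A.1) * F A) := by
  unfold kap Tk
  simp_rw [mul_assoc]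
  rw [ENNReal.tsum_mul_left]
  congr 1
  simp_rw [add_mul]
  rw [ENNReal.tsum_add]
  congr 1
  · simp_rw [Finset.sum_mul]
    rw [Summable.tsum_finsetSum (fun _ _ => ENNReal.summable)]
    refine Finset.sum_congr rfl fun x _ => ?_
    simp_rw [mul_assoc]
    rw [ENNReal.tsum_mul_left]
    congr 1
    rw [HV_eq_tsum]
    simp_rw [← ENNReal.tsum_mul_right]
    rw [ENNReal.tsum_comm]
    congr 1; ext y
    simp_rw [mul_assoc]
    rw [ENNReal.tsum_mul_left, tsum_ext0]
  · simp_rw [mul_assoc]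
    rw [ENNReal.tsum_mul_left]
    congr 1
    rw [tsum_eq_single A]
    · simp
    · intro A' h; simp [h]

lemma good_move {A : Finset (Pt d)} (hA : Good A) {x y : Pt d} (hx : x ∈ A)
    (h : kW (↑(A.erase x)) x y ≠ 0) : Good (insert y (A.erase x)) := by
  obtain ⟨h1, s, h2⟩ := kW_supp _ x y (by simp) h
  have h1' : y ∉ A.erase x := fun h => h1 (Finset.mem_coe.2 h)
  have h2' : y + stp s ∈ A.erase x := Finset.mem_coe.1 h2
  have hc : (insert y (A.erase x)).card = A.card := by
    rw [Finset.card_insert_of_notMem h1', Finset.card_erase_of_mem hx]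
    have := hA.1; omega
  exact ⟨by rw [hc]; exact hA.1, by rw [hc]; exact hA.2.1, y, s, by simp, by
    rw [Finset.mem_insert]; exact Or.inr h2'⟩

lemma rho_single (x a : Pt d) : rho {a} x = rho {0} (x - a) := by
  have := rho_sy (isSy_add a) {0} (x - a)
  simpa using this

lemma rho_erase_ne (hd : 0 < d) {A : Finset (Pt d)} (hA : 2 ≤ A.card) {x : Pt d} (hx : x ∈ A) :
    rho (↑(A.erase x)) x ≠ 0 := by
  have : (A.erase x).Nonempty := by
    rw [← Finset.card_pos, Finset.card_erase_of_mem hx]; omega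
  obtain ⟨a, ha⟩ := this
  have h1 : rho {a} x ≤ rho (↑(A.erase x)) x := HV_one_mono hd (Set.singleton_subset_iff.2 (Finset.mem_coe.2 ha)) x
  rw [rho_single] at h1
  intro h0
  rw [h0] at h1
  exact rho_zero_ne hd _ (le_antisymm h1 bot_le)

lemma rho_ne_top (hd : 0 < d) (W : Set (Pt d)) (x : Pt d) : rho W x ≠ ⊤ :=
  ne_top_of_le_ne_top ENNReal.one_ne_top (rho_le_one hd _ _)

lemma HV_congr_supp {W : Set (Pt d)} {φ χ : Pt d → ℝ≥0∞} {x : Pt d}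
    (h : ∀ y, kW W x y ≠ 0 → φ y = χ y) : HV W φ x = HV W χ x := by
  rw [HV_eq_tsum, HV_eq_tsum]
  congr 1; ext y
  by_cases h0 : kW W x y = 0
  · simp [h0]
  · rw [h y h0]

lemma HV_mono_supp {W : Set (Pt d)} {φ χ : Pt d → ℝ≥0∞} {x : Pt d}
    (h : ∀ y, kW W x y ≠ 0 → φ y ≤ χ y) : HV W φ x ≤ HV W χ x := by
  rw [HV_eq_tsum, HV_eq_tsum]
  refine ENNReal.tsum_le_tsum fun y => ?_
  by_cases h0 : kW W x y = 0
  · simp [h0]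
  · gcongr; exact h y h0

lemma HV_const (W : Set (Pt d)) (c : ℝ≥0∞) (x : Pt d) : HV W (fun _ => c) x = c * rho W x := by
  rw [HV_eq_tsum, ENNReal.tsum_mul_right, rho_eq_tsum, mul_comm]

lemma Tk_row (hd : 0 < d) (A : Kl d) : ∑' A', Tk A A' = 1 := by
  have h := Tk_apply (fun _ => 1) A
  unfold kap at h
  simp only [mul_one] at h
  rw [h]
  have h1 : ∀ x ∈ A.1, es (↑A.1) x / rho (↑(A.1.erase x)) x *
      HV (↑(A.1.erase x)) (fun y => ext0 (fun _ : Kl d => 1) (insert y (A.1.erase x))) x = es (↑A.1) x := by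
    intro x hx
    rw [HV_congr_supp (χ := fun _ => 1)]
    · exact ENNReal.div_mul_cancel (rho_erase_ne hd A.2.1 hx) (rho_ne_top hd _ _)
    · intro y hy
      unfold ext0
      rw [dif_pos (good_move A.2 hx hy)]
  rw [Finset.sum_congr rfl h1]
  have h2 : capE A.1 ≤ 3 := (capE_le A.1).trans (by exact_mod_cast A.2.2.1)
  change 3⁻¹ * (capE A.1 + (3 - capE A.1)) = 1
  rw [add_tsub_cancel_of_le h2, ENNReal.inv_mul_cancel (by simp) (by simp)]

lemma Tk_supp {A A' : Kl d} (h : Tk A A' ≠ 0) :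
    A' = A ∨ ∃ x ∈ A.1, ∃ y, kW (↑(A.1.erase x)) x y ≠ 0 ∧ A'.1 = insert y (A.1.erase x) := by
  by_contra hc
  push Not at hc
  apply h
  unfold Tk
  rw [if_neg hc.1, mul_zero, add_zero, Finset.sum_eq_zero, mul_zero]
  intro x hx
  have : ∀ y, kW (↑(A.1.erase x)) x y * (if A'.1 = insert y (A.1.erase x) then 1 else 0) = 0 := by
    intro y
    by_cases h0 : kW (↑(A.1.erase x)) x y = 0
    · rw [h0, zero_mul]
    · rw [if_neg (hc.2 x hx y h0), mul_zero]
  rw [ENNReal.tsum_eq_zero.2 this, mul_zero]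

lemma Tk_card {A A' : Kl d} (h : Tk A A' ≠ 0) : A'.1.card = A.1.card := by
  rcases Tk_supp h with rfl | ⟨x, hx, y, hy, he⟩
  · rfl
  · rw [he]
    have h1' : y ∉ A.1.erase x := fun h => (kW_supp _ x y (by simp) hy).1 (Finset.mem_coe.2 h)
    rw [Finset.card_insert_of_notMem h1', Finset.card_erase_of_mem hx]
    have := A.2.1; omega

/-- The dimer at `x` in direction `i`. -/
def dim (a : Pt d × Fin d) : Kl d := ⟨{a.1, a.1 + stp (a.2, true)}, by
  have h : a.1 ≠ a.1 + stp (a.2, true) := by simp [stp_ne_zero]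
  refine ⟨by rw [Finset.card_pair h], by rw [Finset.card_pair h]; norm_num, a.1, (a.2, true), by simp, by simp⟩⟩

lemma dim_inj : Function.Injective (dim (d := d)) := by
  rintro ⟨x, i⟩ ⟨y, j⟩ h
  have h1 : ({x, x + stp (i, true)} : Finset (Pt d)) = {y, y + stp (j, true)} := congrArg Subtype.val h
  have hx : x = y ∨ x = y + stp (j, true) := by
    have : x ∈ ({y, y + stp (j, true)} : Finset (Pt d)) := by rw [← h1]; simp
    simpa using this
  have hy : y = x ∨ y = x + stp (i, true) := by
    have : y ∈ ({x, x + stp (i, true)} : Finset (Pt d)) := by rw [h1]; simp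
    simpa using this
  have hxy : x = y := by
    rcases hx with hx | hx
    · exact hx
    · rcases hy with hy | hy
      · exact hy.symm
      · exfalso
        have e : stp (j, true) + stp (i, true) = 0 := by
          have h5 := hx
          rw [hy] at h5
          rw [add_assoc] at h5
          have := left_eq_add.1 h5
          rw [add_comm]; exact this
        have := congrFun e i
        simp only [stp, Pi.add_apply, Pi.zero_apply, Pi.single_eq_same, if_true] at this
        by_cases hij : i = j
        · subst hij; simp at this
        · simp [hij] at this
  subst hxy
  have hz : x + stp (i, true) = x + stp (j, true) := by
    have : x + stp (i, true) ∈ ({x, x + stp (j, true)} : Finset (Pt d)) := by rw [← h1]; simp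
    simpa [stp_ne_zero] using this
  have := stp_injective (add_left_cancel hz)
  simp at this
  rw [this]

lemma pair_of_card {A : Finset (Pt d)} (hA : Good A) (hc : A.card = 2) :
    ∃ z s, A = {z, z + stp s} := by
  obtain ⟨_, _, z, s, h1, h2⟩ := hA
  refine ⟨z, s, ?_⟩
  have hne : z ≠ z + stp s := by simp [stp_ne_zero]
  symm
  apply Finset.eq_of_subset_of_card_le
  · intro a ha
    simp only [Finset.mem_insert, Finset.mem_singleton] at ha
    rcases ha with rfl | rfl <;> assumption
  · rw [hc, Finset.card_pair hne]

lemma dim_surj (A : Kl d) (hc : A.1.card = 2) : ∃ a, dim a = A := by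
  obtain ⟨z, ⟨i, b⟩, h⟩ := pair_of_card A.2 hc
  cases b
  · refine ⟨(z + stp (i, false), i), Subtype.ext ?_⟩
    rw [h, dim]
    have e : z + stp (i, false) + stp (i, true) = z := by
      have : stp (i, true) = - stp (i, false) := by rw [← stp_nstp]; rfl
      rw [this]; simp
    simp only [e]
    exact Finset.pair_comm _ _
  · exact ⟨(z, i), Subtype.ext h.symm⟩

lemma dim_card (a : Pt d × Fin d) : (dim a).1.card = 2 := by
  rw [dim, Finset.card_pair]; simp [stp_ne_zero]

/-- Reference escape probability. -/
lemma dimer_const (hd : 0 < d) : ∃ e0 r0 : ℝ≥0∞, ∀ (z : Pt d) s,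
    es ({z, z + stp s} : Set (Pt d)) (z + stp s) = e0 ∧ rho {z} (z + stp s) = r0 := by
  set s0 : Fin d × Bool := (⟨0, hd⟩, true)
  refine ⟨es ({0, stp s0} : Set (Pt d)) (stp s0), rho {0} (stp s0), fun z s => ?_⟩
  obtain ⟨g, hg, hg0, hgs⟩ := exists_sy_step s0 s
  have hG := isSy_comp (isSy_add z) hg
  constructor
  · have := es_sy hG {0, stp s0} (stp s0)
    rw [← this]
    simp only [Set.image_pair, hg0, hgs, add_zero]
  · have := rho_sy hG {0} (stp s0)
    rw [← this]
    simp only [Set.image_singleton, hg0, hgs, add_zero]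

lemma adj_of_card {A : Kl d} (hc : A.1.card = 2) {x z : Pt d} (hx : x ∈ A.1) (hz : z ∈ A.1) (h : x ≠ z) :
    ∃ s, x = z + stp s ∧ A.1 = {z, z + stp s} := by
  obtain ⟨p, s, hp⟩ := pair_of_card A.2 hc
  rw [hp] at hx hz
  simp only [Finset.mem_insert, Finset.mem_singleton] at hx hz
  rcases hx with rfl | rfl <;> rcases hz with rfl | rfl
  · exact absurd rfl h
  · refine ⟨nstp s, by simp [stp_nstp], ?_⟩
    rw [hp, stp_nstp, Finset.pair_comm]; simp
  · exact ⟨s, rfl, hp⟩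
  · exact absurd rfl h

lemma erase_of_card {A : Finset (Pt d)} (hc : A.card = 2) {x z : Pt d} (hx : x ∈ A) (hz : z ∈ A) (h : x ≠ z) :
    A.erase x = {z} := by
  have h1 : (A.erase x).card = 1 := by rw [Finset.card_erase_of_mem hx, hc]
  obtain ⟨w, hw⟩ := Finset.card_eq_one.1 h1
  have : z ∈ A.erase x := Finset.mem_erase.2 ⟨h.symm, hz⟩
  rw [hw] at this ⊢
  rw [Finset.mem_singleton.1 this]

lemma Tk_dimer (e0 r0 : ℝ≥0∞) (h0 : ∀ (z : Pt d) s,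
    es ({z, z + stp s} : Set (Pt d)) (z + stp s) = e0 ∧ rho {z} (z + stp s) = r0) (A A' : Kl d)
    (hc : A.1.card = 2) (hc' : A'.1.card = 2) (hne : A' ≠ A) :
    Tk A A' = 3⁻¹ * (e0 / r0) * ∑ z ∈ A.1 ∩ A'.1, ∑ x ∈ A.1.erase z, ∑ y ∈ A'.1.erase z, kW {z} x y := by
  have hk : ∀ x ∈ A.1, ∀ z ∈ A.1.erase x, ∑' y, kW (↑(A.1.erase x)) x y *
      (if A'.1 = insert y (A.1.erase x) then 1 else 0) = if z ∈ A'.1 then ∑ y ∈ A'.1.erase z, kW {z} x y else 0 := by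
    intro x hx z hz
    have hz' := Finset.mem_erase.1 hz
    rw [erase_of_card hc hx hz'.2 hz'.1.symm]
    split_ifs with hzA
    · rw [tsum_eq_sum (s := A'.1.erase z)]
      · refine Finset.sum_congr rfl fun y hy => ?_
        have hy' := Finset.mem_erase.1 hy
        have := erase_of_card hc' hy'.2 hzA hy'.1
        rw [← this, Finset.insert_erase hy'.2]; simp [this]
      · intro y hy
        rw [if_neg, mul_zero]
        intro he
        apply hy
        rw [Finset.mem_erase]
        constructor
        · rintro rfl
          rw [he] at hc'; simp at hc'
        · rw [he]; simp
    · rw [ENNReal.tsum_eq_zero]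
      intro y
      rw [if_neg, mul_zero]
      intro he
      apply hzA
      rw [he]; simp
  have h1 : ∀ x ∈ A.1, es (↑A.1) x / rho (↑(A.1.erase x)) x *
      ∑' y, kW (↑(A.1.erase x)) x y * (if A'.1 = insert y (A.1.erase x) then 1 else 0) =
      (e0 / r0) * ∑ z ∈ A.1.erase x, if z ∈ A'.1 then ∑ y ∈ A'.1.erase z, kW {z} x y else 0 := by
    intro x hx
    have hne : (A.1.erase x).Nonempty := by
      rw [← Finset.card_pos, Finset.card_erase_of_mem hx]; omega
    obtain ⟨z, hz⟩ := hne
    have hz' := Finset.mem_erase.1 hz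
    rw [hk x hx z hz]
    have he := erase_of_card hc hx hz'.2 hz'.1.symm
    obtain ⟨s, hs1, hs2⟩ := adj_of_card hc hx hz'.2 hz'.1.symm
    rw [he, Finset.sum_singleton]
    have hA : (↑A.1 : Set (Pt d)) = {z, z + stp s} := by rw [hs2]; simp
    rw [hA, hs1, Finset.coe_singleton, (h0 z s).1, (h0 z s).2]
  unfold Tk
  rw [if_neg hne, mul_zero, add_zero, Finset.sum_congr rfl h1, ← Finset.mul_sum, mul_assoc]
  congr 2
  rw [← Finset.filter_mem_eq_inter, Finset.sum_filter]
  have hcomm : ∑ x ∈ A.1, ∑ z ∈ A.1.erase x, (if z ∈ A'.1 then ∑ y ∈ A'.1.erase z, kW {z} x y else 0) =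
      ∑ z ∈ A.1, ∑ x ∈ A.1.erase z, (if z ∈ A'.1 then ∑ y ∈ A'.1.erase z, kW {z} x y else 0) := by
    refine Finset.sum_comm' ?_
    intro x z
    simp only [Finset.mem_erase]
    tauto
  rw [hcomm]
  refine Finset.sum_congr rfl fun z hz => ?_
  split_ifs
  · rfl
  · simp

lemma Tk_symm_dimer (hd : 0 < d) (A A' : Kl d) (hc : A.1.card = 2) (hc' : A'.1.card = 2) :
    Tk A A' = Tk A' A := by
  by_cases hne : A' = A
  · rw [hne]
  · obtain ⟨e0, r0, h0⟩ := dimer_const hd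
    rw [Tk_dimer e0 r0 h0 A A' hc hc' hne, Tk_dimer e0 r0 h0 A' A hc' hc (Ne.symm hne)]
    congr 1
    rw [Finset.inter_comm]
    refine Finset.sum_congr rfl fun z hz => ?_
    rw [Finset.sum_comm]
    have hz' := Finset.mem_inter.1 hz
    refine Finset.sum_congr rfl fun y hy => Finset.sum_congr rfl fun x hx => ?_
    rw [Finset.mem_erase] at hx hy
    obtain ⟨s, rfl, _⟩ := adj_of_card hc hx.2 hz'.2 hx.1
    obtain ⟨s', rfl, _⟩ := adj_of_card hc' hy.2 hz'.1 hy.1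
    exact kW_symm_single z s s'

lemma kW_two (z y : Pt d) (s r : Fin d × Bool) (h : r ≠ nstp s) :
    (((2 * d : ℕ) : ℝ≥0∞)⁻¹) ^ 2 * kW {z} (z + stp r) y ≤ kW {z} (z + stp s) y := by
  have h1 := kW_step {z} (z + stp s) y r (by
    simp only [Set.mem_singleton_iff, add_assoc, add_eq_left]
    intro e
    apply h
    apply stp_injective
    rw [stp_nstp, eq_neg_iff_add_eq_zero, add_comm]; exact e)
  have h2 := kW_step {z} (z + stp s + stp r) y (nstp s) (by
    rw [stp_nstp]
    have : z + stp s + stp r + -stp s = z + stp r := by abel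
    rw [this]
    simp [stp_ne_zero])
  have e : z + stp s + stp r + stp (nstp s) = z + stp r := by rw [stp_nstp]; abel
  rw [e] at h2
  refine le_trans ?_ h1
  rw [sq, mul_assoc]
  gcongr

lemma inv2d_le_one (hd : 0 < d) : ((2 * d : ℕ) : ℝ≥0∞)⁻¹ ≤ 1 :=
  ENNReal.inv_le_one.2 (by exact_mod_cast (by omega : 1 ≤ 2 * d))

lemma kW_lower (hd : 5 ≤ d) (z : Pt d) (s s' : Fin d × Bool) :
    (((2 * d : ℕ) : ℝ≥0∞)⁻¹) ^ 5 ≤ kW {z} (z + stp s) (z + stp s') := by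
  have hself : ((2 * d : ℕ) : ℝ≥0∞)⁻¹ ≤ kW {z} (z + stp s') (z + stp s') :=
    kW_self _ _ (nstp s') (by rw [stp_nstp]; simp)
  have h1 : ∀ r, s' ≠ nstp r → (((2 * d : ℕ) : ℝ≥0∞)⁻¹) ^ 3 ≤ kW {z} (z + stp r) (z + stp s') := by
    intro r hr
    refine le_trans ?_ (kW_two z _ r s' hr)
    rw [pow_succ]
    gcongr
  by_cases hs : s' = nstp s
  · obtain ⟨i, hi⟩ : ∃ i : Fin d, i ≠ s.1 := by
      by_cases h : s.1 = ⟨0, by omega⟩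
      · exact ⟨⟨1, by omega⟩, by rw [h]; simp⟩
      · exact ⟨⟨0, by omega⟩, fun e => h e.symm⟩
    have h2 := kW_two z (z + stp s') s (i, true) (fun e => hi (congrArg Prod.fst e))
    refine le_trans ?_ h2
    rw [show 5 = 2 + 3 by norm_num, pow_add]
    gcongr
    apply h1
    rw [hs]
    intro e
    exact hi (congrArg Prod.fst e).symm
  · refine le_trans ?_ (h1 s hs)
    exact pow_le_pow_right_of_le_one' (inv2d_le_one (by omega)) (by norm_num)

lemma Tk_ge (hd : 0 < d) (A A' : Kl d) (x y : Pt d) (hx : x ∈ A.1) (h : A'.1 = insert y (A.1.erase x)) :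
    3⁻¹ * (es (↑A.1) x * kW (↑(A.1.erase x)) x y) ≤ Tk A A' := by
  unfold Tk
  gcongr
  refine le_trans ?_ le_self_add
  refine le_trans ?_ (Finset.single_le_sum (f := fun x => es (↑A.1) x / rho (↑(A.1.erase x)) x *
      ∑' y, kW (↑(A.1.erase x)) x y * (if A'.1 = insert y (A.1.erase x) then 1 else 0)) (fun _ _ => bot_le) hx)
  gcongr
  · rw [div_eq_mul_inv]
    nth_rewrite 1 [← mul_one (es _ _)]
    gcongr
    exact ENNReal.one_le_inv.2 (rho_le_one hd _ _)
  · refine le_trans ?_ (ENNReal.le_tsum y)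
    simp [h]

lemma kit_dim (F : Kl d → ℝ≥0∞) (n : ℕ) (a : Pt d × Fin d) :
    kit Tk F n (dim a) = kit (fun a b => Tk (dim a) (dim b)) (fun b => F (dim b)) n a := by
  induction n generalizing a with
  | zero => rfl
  | succ n ih =>
    rw [kit_succ, kit_succ]
    unfold kap
    simp_rw [← ih]
    symm
    refine dim_inj.tsum_eq (f := fun A' => Tk (dim a) A' * kit Tk F n A') ?_
    intro A' h
    have : Tk (dim a) A' ≠ 0 := left_ne_zero_of_mul h
    exact dim_surj A' (by rw [Tk_card this, dim_card])

lemma kit_pair {X : Type*} (T : X → X → ℝ≥0∞) (hT : ∀ a b, T a b = T b a) (f g : X → ℝ≥0∞) (n : ℕ) :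
    ∑' a, g a * kit T f n a = ∑' a, kit T g n a * f a := by
  have h1 : ∀ f g : X → ℝ≥0∞, ∑' a, g a * kap T f a = ∑' a, kap T g a * f a := by
    intro f g
    unfold kap
    simp_rw [← ENNReal.tsum_mul_left, ← ENNReal.tsum_mul_right]
    rw [ENNReal.tsum_comm]
    congr 1; ext a; congr 1; ext b
    rw [hT b a]; ring
  induction n generalizing g with
  | zero => rfl
  | succ n ih =>
    have : kit T (kap T g) n = kap T (kit T g n) := by
      unfold kit
      rw [← Function.iterate_succ_apply, Function.iterate_succ_apply']
    rw [kit_succ, kit_succ, h1, ih, this]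

end Cluster

section Dimer
open Classical
open scoped ENNReal

variable {d : ℕ}

lemma kit_one {X : Type*} (T : X → X → ℝ≥0∞) (hT : ∀ a, ∑' b, T a b = 1) (n : ℕ) :
    kit T (fun _ => 1) n = fun _ => 1 := by
  induction n with
  | zero => rfl
  | succ n ih =>
    rw [kit_succ, ih]
    unfold kap
    simp [hT]

lemma lzp_shift_sq (K : ℝ≥0∞) (hK : ∀ t, ∑' x : Pt d, lzp t x ^ 2 ≤ (K * psi t) ^ 2) (t : ℕ) (w : Fin d → Pt d) :
    ∑' b : Pt d × Fin d, lzp t (b.1 + w b.2) ^ 2 ≤ ((d : ℝ≥0∞) * K * psi t) ^ 2 := by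
  rw [ENNReal.tsum_prod', ENNReal.tsum_comm, tsum_fintype]
  have h1 : ∀ i : Fin d, ∑' x : Pt d, lzp t (x + w i) ^ 2 ≤ (K * psi t) ^ 2 := by
    intro i
    refine le_trans (le_of_eq ?_) (hK t)
    exact (Equiv.addRight (w i)).tsum_eq (fun x => lzp t x ^ 2)
  refine (Finset.sum_le_sum fun i _ => h1 i).trans ?_
  rw [Finset.sum_const, Finset.card_univ, Fintype.card_fin, nsmul_eq_mul, mul_assoc, mul_pow (d : ℝ≥0∞)]
  gcongr
  rcases Nat.eq_zero_or_pos d with h | h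
  · rw [h]; simp
  · exact_mod_cast Nat.le_self_pow (by norm_num) d

theorem dimer_decay (hd : 5 ≤ d) : ∃ C : ℝ≥0∞, C ≠ ⊤ ∧ ∀ A : Kl d, A.1.card = 2 → ∀ (z : Pt d) α,
    kit Tk (fun A' => ∑ x ∈ A'.1, hh (x - z)) α A ≤ C * psi α := by
  have hd0 : 0 < d := by omega
  obtain ⟨ces, hces0, hces1, hces⟩ := es_unif hd
  obtain ⟨K2, hK20, hK2t, hK2⟩ := lzp_sq hd
  set cE : ℝ≥0∞ := 3⁻¹ * (ces * (((2 * d : ℕ) : ℝ≥0∞)⁻¹) ^ 5) with hcE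
  have hces_t : ces ≠ ⊤ := ne_top_of_le_ne_top ENNReal.one_ne_top hces1
  have h2d : (((2 * d : ℕ) : ℝ≥0∞)⁻¹) ^ 5 ≠ 0 := pow_ne_zero _ (ENNReal.inv_ne_zero.2 (ENNReal.natCast_ne_top _))
  have h2dt : (((2 * d : ℕ) : ℝ≥0∞)⁻¹) ^ 5 ≠ ⊤ := ENNReal.pow_ne_top (ne_top_of_le_ne_top ENNReal.one_ne_top (inv2d_le_one hd0))
  have hc0 : cE ≠ 0 := mul_ne_zero (by simp) (mul_ne_zero hces0 h2d)
  have hct : cE ≠ ⊤ := ENNReal.mul_ne_top (by simp) (ENNReal.mul_ne_top hces_t h2dt)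
  obtain ⟨K, hK, hdec⟩ := heat_decay hd cE.toReal (ENNReal.toReal_pos hc0 hct)
  rw [ENNReal.ofReal_toReal hct] at hdec
  set T : (Pt d × Fin d) → (Pt d × Fin d) → ℝ≥0∞ := fun a b => Tk (dim a) (dim b) with hT
  have hrow : ∀ a, ∑' b, T a b = 1 := by
    intro a
    rw [← Tk_row hd0 (dim a)]
    refine dim_inj.tsum_eq (f := fun A' => Tk (dim a) A') ?_
    intro A' h
    exact dim_surj A' (by rw [Tk_card h, dim_card])
  have hsym : ∀ a b, T a b = T b a := fun a b => Tk_symm_dimer hd0 _ _ (dim_card a) (dim_card b)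
  have hlow : ∀ a b : Pt d × Fin d, ∀ z s s', (dim a).1 = {z, z + stp s} → (dim b).1 = {z, z + stp s'} → cE ≤ T a b := by
    intro a b z s s' ha hb
    have hx : z + stp s ∈ (dim a).1 := by rw [ha]; simp
    have hz : z ∈ (dim a).1 := by rw [ha]; simp
    have hne : z + stp s ≠ z := by simp [stp_ne_zero]
    have he : (dim a).1.erase (z + stp s) = {z} := erase_of_card (dim_card a) hx hz hne
    refine le_trans ?_ (Tk_ge hd0 (dim a) (dim b) (z + stp s) (z + stp s') hx (by rw [he, hb, Finset.pair_comm]))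
    rw [hcE, he, Finset.coe_singleton]
    gcongr
    · exact hces _ _ (by rw [dim_card]; norm_num) hx
    · exact kW_lower hd z s s'
  have hdec' := hdec T hsym hrow (fun x i j => hlow _ _ x (i, true) (j, true) rfl rfl) (fun x i j => by
    refine hlow _ _ (x + stp (j, true)) (nstp (j, true)) (i, true) ?_ ?_
    · change ({x, x + stp (j, true)} : Finset (Pt d)) = _
      rw [stp_nstp, add_neg_cancel_right, Finset.pair_comm]
    · change ({x + Pi.single j 1, x + Pi.single j 1 + stp (i, true)} : Finset (Pt d)) = _
      simp [stp])
  set k : ℝ≥0∞ := ENNReal.ofReal (Real.sqrt K) with hk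
  have hk0 : k ≠ 0 := by
    rw [hk, Ne, ENNReal.ofReal_eq_zero, not_le]; exact Real.sqrt_pos.2 hK
  have hkt : k ≠ ⊤ := ENNReal.ofReal_ne_top
  have hk2 : ∀ n : ℕ, ENNReal.ofReal (K * ((n : ℝ) + 1) ^ (-(5 / 2) : ℝ)) = (k * psi n) ^ 2 := by
    intro n
    rw [mul_pow, psi_sq, ENNReal.ofReal_mul hK.le, hk, ← ENNReal.ofReal_pow (Real.sqrt_nonneg _), Real.sq_sqrt hK.le]
  have hdE : (d : ℝ≥0∞) ≠ 0 := by exact_mod_cast hd0.ne'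
  refine ⟨4 * (k * ((d : ℝ≥0∞) * K2)) * ∑' t, psi t, ENNReal.mul_ne_top (ENNReal.mul_ne_top (by simp)
    (ENNReal.mul_ne_top hkt (ENNReal.mul_ne_top (by simp) hK2t))) psi_sum, ?_⟩
  intro A hA z α
  obtain ⟨a, rfl⟩ := dim_surj A hA
  rw [kit_dim]
  set δ : Pt d × Fin d → ℝ≥0∞ := fun b => if b = a then 1 else 0 with hδ
  have hδs : ∀ F : Pt d × Fin d → ℝ≥0∞, ∑' b, δ b * F b = F a := by
    intro F
    rw [tsum_eq_single a]
    · simp [hδ]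
    · intro b hb; simp [hδ, hb]
  set p := kit T δ α with hp
  have hp1 : ∑' b, p b = 1 := by
    have := kit_pair T hsym (fun _ => 1) δ α
    rw [kit_one T hrow, hδs] at this
    simpa using this.symm
  have hpt : ∀ b, p b ≠ ⊤ := fun b => ne_top_of_le_ne_top ENNReal.one_ne_top (hp1 ▸ ENNReal.le_tsum b)
  have hp2 : ∑' b, p b ^ 2 ≤ (k * psi α) ^ 2 := by
    rw [← hk2]
    refine le_trans (le_of_eq ?_) (hdec' δ (by simpa using (hδs fun _ => 1).le) α)
    unfold nsq
    congr 1; ext b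
    rw [ENNReal.ofReal_pow ENNReal.toReal_nonneg, ENNReal.ofReal_toReal (hpt b)]
  have hmain := kit_pair T hsym (fun b => ∑ x ∈ (dim b).1, hh (x - z)) δ α
  rw [hδs] at hmain
  rw [hmain]
  have hw : ∀ w : Fin d → Pt d, ∑' b, p b * hh (b.1 + w b.2) ≤ 2 * (k * psi α * ((d : ℝ≥0∞) * K2)) * ∑' t, psi t := by
    intro w
    unfold hh
    simp_rw [← ENNReal.tsum_mul_left]
    rw [ENNReal.tsum_comm]
    refine ENNReal.tsum_le_tsum fun t => ?_
    refine (tsum_mul_le_cs (mul_ne_zero hk0 (psi_ne_zero _)) (ENNReal.mul_ne_top hkt (psi_ne_top _))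
      (mul_ne_zero (mul_ne_zero hdE hK20) (psi_ne_zero t)) (ENNReal.mul_ne_top (ENNReal.mul_ne_top (by simp) hK2t) (psi_ne_top t))
      hp2 (lzp_shift_sq K2 hK2 t w)).trans (le_of_eq (by ring))
  have hsum : ∀ b : Pt d × Fin d, ∑ x ∈ (dim b).1, hh (x - z) = hh (b.1 + (fun _ => -z) b.2) +
      hh (b.1 + (fun i => stp (i, true) - z) b.2) := by
    intro b
    rw [dim, Finset.sum_pair (by simp [stp_ne_zero])]
    congr 2
    simp only
    abel
  simp_rw [hsum, mul_add]
  rw [ENNReal.tsum_add]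
  refine (add_le_add (hw fun _ => -z) (hw fun i => stp (i, true) - z)).trans (le_of_eq (by ring))

/-- Spread of a finite set. -/
def sp (A : Finset (Pt d)) : ℕ := A.sup fun x => A.sup fun y => nm (x - y)

lemma sp_le {A : Finset (Pt d)} {r : ℕ} : sp A ≤ r ↔ ∀ x ∈ A, ∀ y ∈ A, nm (x - y) ≤ r := by
  simp [sp, Finset.sup_le_iff]

lemma le_sp {A : Finset (Pt d)} {x y : Pt d} (hx : x ∈ A) (hy : y ∈ A) : nm (x - y) ≤ sp A :=
  sp_le.1 le_rfl x hx y hy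

lemma sp_move {A : Finset (Pt d)} {x y : Pt d} (h : kW (↑(A.erase x)) x y ≠ 0) :
    sp (insert y (A.erase x)) ≤ sp (A.erase x) + 1 := by
  obtain ⟨h1, s, h2⟩ := kW_supp _ x y (by simp) h
  have h2' : y + stp s ∈ A.erase x := Finset.mem_coe.1 h2
  have key : ∀ a ∈ A.erase x, nm (y - a) ≤ sp (A.erase x) + 1 := by
    intro a ha
    have e1 := nm_tri y (y + stp s) a
    have e2 := le_sp h2' ha
    have e3 : nm (y - (y + stp s)) ≤ 1 := by
      rw [nm_sub_comm, add_sub_cancel_left]; exact nm_stp s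
    omega
  rw [sp_le]
  intro a ha b hb
  rcases Finset.mem_insert.1 ha with ha1 | ha1 <;> rcases Finset.mem_insert.1 hb with hb1 | hb1
  · rw [ha1, hb1, sub_self, (nm_zero_iff _).2 rfl]; omega
  · rw [ha1]; exact key b hb1
  · rw [hb1, nm_sub_comm]; exact key a ha1
  · have := le_sp ha1 hb1; omega

lemma sp_mono {A B : Finset (Pt d)} (h : A ⊆ B) : sp A ≤ sp B :=
  sp_le.2 fun _ hx _ hy => le_sp (h hx) (h hy)

lemma Tk_near {A A' : Kl d} (h : Tk A A' ≠ 0) :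
    sp A'.1 ≤ sp A.1 + 1 ∧ ∀ y ∈ A'.1, ∃ x ∈ A.1, nm (y - x) ≤ 1 := by
  rcases Tk_supp h with rfl | ⟨x, hx, y, hy, he⟩
  · exact ⟨by omega, fun y hy => ⟨y, hy, by rw [sub_self, (nm_zero_iff _).2 rfl]; omega⟩⟩
  · rw [he]
    refine ⟨(sp_move hy).trans (Nat.add_le_add_right (sp_mono (Finset.erase_subset _ _)) 1), fun b hb => ?_⟩
    rcases Finset.mem_insert.1 hb with rfl | hb
    · obtain ⟨h1, s, h2⟩ := kW_supp _ x b (by simp) hy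
      have h2' : b + stp s ∈ A.1.erase x := Finset.mem_coe.1 h2
      refine ⟨_, Finset.mem_of_mem_erase h2', ?_⟩
      rw [nm_sub_comm, add_sub_cancel_left]; exact nm_stp s
    · exact ⟨b, Finset.mem_of_mem_erase hb, by rw [sub_self, (nm_zero_iff _).2 rfl]; omega⟩

lemma sp_pair (z : Pt d) (s : Fin d × Bool) : sp {z, z + stp s} ≤ 1 := by
  rw [sp_le]
  intro a ha b hb
  simp only [Finset.mem_insert, Finset.mem_singleton] at ha hb
  have h0 : nm (0 : Pt d) = 0 := (nm_zero_iff _).2 rfl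
  have h1 := nm_stp s
  have h2 := nm_neg (stp s)
  rcases ha with rfl | rfl <;> rcases hb with rfl | rfl <;> simp [h0, h1, h2]

lemma exists_good_removal (A : Kl d) : ∃ x ∈ A.1, sp (A.1.erase x) ≤ 1 := by
  obtain ⟨h2, h3, z, s, hz, hs⟩ := A.2
  have hne : z ≠ z + stp s := by simp [stp_ne_zero]
  have hsub : ({z, z + stp s} : Finset (Pt d)) ⊆ A.1 := by
    intro a ha
    simp only [Finset.mem_insert, Finset.mem_singleton] at ha
    rcases ha with rfl | rfl <;> assumption
  by_cases hc : A.1.card = 2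
  · have : ({z, z + stp s} : Finset (Pt d)) = A.1 :=
      Finset.eq_of_subset_of_card_le hsub (by rw [Finset.card_pair hne, hc])
    exact ⟨z, hz, (sp_mono (Finset.erase_subset _ _)).trans (by rw [← this]; exact sp_pair z s)⟩
  · have hex : (A.1 \ {z, z + stp s}).Nonempty := by
      rw [← Finset.card_pos, Finset.card_sdiff_of_subset hsub, Finset.card_pair hne]; omega
    obtain ⟨x, hx⟩ := hex
    rw [Finset.mem_sdiff] at hx
    refine ⟨x, hx.1, ?_⟩
    have : ({z, z + stp s} : Finset (Pt d)) = A.1.erase x := by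
      apply Finset.eq_of_subset_of_card_le
      · intro a ha
        exact Finset.mem_erase.2 ⟨fun e => hx.2 (e ▸ ha), hsub ha⟩
      · rw [Finset.card_erase_of_mem hx.1, Finset.card_pair hne]; omega
    rw [← this]; exact sp_pair z s

lemma kap_affine {X : Type*} (T : X → X → ℝ≥0∞) (hT : ∀ a, ∑' b, T a b = 1) (f : X → ℝ≥0∞) (u v : ℝ≥0∞) :
    kap T (fun a => u * f a + v) = fun a => u * kap T f a + v := by
  ext a
  unfold kap
  simp_rw [mul_add]
  rw [ENNReal.tsum_add, ENNReal.tsum_mul_right, hT, one_mul, ← ENNReal.tsum_mul_left]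
  congr 2; ext b; ring

lemma kap_mono {X : Type*} (T : X → X → ℝ≥0∞) {f g : X → ℝ≥0∞} (h : ∀ a, f a ≤ g a) (a : X) :
    kap T f a ≤ kap T g a := ENNReal.tsum_le_tsum fun b => by gcongr; exact h b

lemma kit_mono {X : Type*} (T : X → X → ℝ≥0∞) {f g : X → ℝ≥0∞} (h : ∀ a, f a ≤ g a) (n : ℕ) (a : X) :
    kit T f n a ≤ kit T g n a := by
  induction n generalizing a with
  | zero => exact h a
  | succ n ih => rw [kit_succ, kit_succ]; exact kap_mono T ih a

lemma kit_affine {X : Type*} (T : X → X → ℝ≥0∞) (hT : ∀ a, ∑' b, T a b = 1) (f : X → ℝ≥0∞) (u v : ℝ≥0∞) (n : ℕ) :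
    kit T (fun a => u * f a + v) n = fun a => u * kit T f n a + v := by
  induction n with
  | zero => rfl
  | succ n ih => rw [kit_succ, kit_succ, ih, kap_affine T hT]

lemma kit_succ' {X : Type*} (T : X → X → ℝ≥0∞) (f : X → ℝ≥0∞) (n : ℕ) :
    kit T f (n + 1) = kit T (kap T f) n := Function.iterate_succ_apply _ _ _

lemma kit_drift {X : Type*} (T : X → X → ℝ≥0∞) (hT : ∀ a, ∑' b, T a b = 1) (V : X → ℝ≥0∞) (l K L : ℝ≥0∞)
    (hl : l ≤ 1) (hL : l * L + K ≤ L) (h : ∀ a, kap T V a ≤ l * V a + K) (n : ℕ) (a : X) :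
    kit T V n a ≤ V a + L := by
  induction n with
  | zero => exact le_self_add
  | succ n ih =>
    rw [kit_succ']
    refine (kit_mono T h n a).trans ?_
    rw [kit_affine T hT]
    calc l * kit T V n a + K ≤ l * (V a + L) + K := by gcongr
      _ = l * V a + (l * L + K) := by ring
      _ ≤ 1 * V a + L := by gcongr
      _ = V a + L := by rw [one_mul]

theorem V_drift (hd : 5 ≤ d) : ∃ (V : Kl d → ℝ≥0∞) (L : ℝ≥0∞) (M : ℕ → ℝ≥0∞), L ≠ ⊤ ∧ (∀ r, M r ≠ ⊤) ∧
    (∀ A, 1 ≤ V A) ∧ (∀ A : Kl d, ∀ x ∈ A.1, (rho (↑(A.1.erase x)) x)⁻¹ ≤ V A) ∧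
    (∀ n A, kit Tk V n A ≤ V A + L) ∧ (∀ (A : Kl d) r, sp A.1 ≤ r → V A ≤ M r) := by
  have hd0 : 0 < d := by omega
  obtain ⟨C, hCt, hC1, hC⟩ := rho_lower (d := d) hd
  obtain ⟨ces, hces0, hces1, hces⟩ := es_unif hd
  set c : ℝ≥0∞ := 3⁻¹ * ces with hc
  have hc0 : c ≠ 0 := mul_ne_zero (by simp) hces0
  have hlt : 1 - c < 1 := ENNReal.sub_lt_self ENNReal.one_ne_top one_ne_zero hc0
  obtain ⟨l, hl1, hl2⟩ := exists_between hlt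
  have hb : ∃ b : ℕ, 1 ≤ b ∧ (1 - c) * (1 + (b : ℝ≥0∞)⁻¹) ^ (2 * d) ≤ l := by
    have h1 : Filter.Tendsto (fun b : ℕ => (1 - c) * (1 + (b : ℝ≥0∞)⁻¹) ^ (2 * d)) Filter.atTop (nhds ((1 - c) * (1 + 0) ^ (2 * d))) := by
      refine ENNReal.Tendsto.const_mul (ENNReal.Tendsto.pow (Filter.Tendsto.add tendsto_const_nhds ENNReal.tendsto_inv_nat_nhds_zero)) (Or.inr ?_)
      exact ne_top_of_le_ne_top ENNReal.one_ne_top tsub_le_self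
    rw [add_zero, one_pow, mul_one] at h1
    obtain ⟨b, hb1, hb2⟩ := ((h1.eventually (gt_mem_nhds hl1)).and (Filter.eventually_ge_atTop 1)).exists
    exact ⟨b, hb2, hb1.le⟩
  obtain ⟨b, hb1, hb⟩ := hb
  set M : ℕ → ℝ≥0∞ := fun r => C * ((r + b : ℕ) : ℝ≥0∞) ^ (2 * d) with hM
  have hMt : ∀ r, M r ≠ ⊤ := fun r => ENNReal.mul_ne_top hCt (ENNReal.pow_ne_top (ENNReal.natCast_ne_top _))
  have hMmono : ∀ r s, r ≤ s → M r ≤ M s := by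
    intro r s h
    simp only [hM]
    gcongr
  have hl1' : l ≠ ⊤ := ne_top_of_le_ne_top ENNReal.one_ne_top hl2.le
  have hsub0 : 1 - l ≠ 0 := (tsub_pos_of_lt hl2).ne'
  have hsubt : 1 - l ≠ ⊤ := ne_top_of_le_ne_top ENNReal.one_ne_top tsub_le_self
  refine ⟨fun A => M (sp A.1), M 2 / (1 - l), M, ENNReal.div_ne_top (hMt 2) hsub0, hMt, ?_, ?_, ?_, ?_⟩
  · intro A
    refine hC1.trans ?_
    conv_lhs => rw [← mul_one C]
    simp only [hM]
    gcongr
    apply one_le_pow₀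
    exact_mod_cast (by omega : 1 ≤ sp A.1 + b)
  · intro A x hx
    have : (A.1.erase x).Nonempty := by
      rw [← Finset.card_pos, Finset.card_erase_of_mem hx]; have := A.2.1; omega
    obtain ⟨a, ha⟩ := this
    have h1 : rho {a} x ≤ rho (↑(A.1.erase x)) x :=
      HV_one_mono hd0 (Set.singleton_subset_iff.2 (Finset.mem_coe.2 ha)) x
    rw [rho_single] at h1
    refine (ENNReal.inv_le_inv.2 h1).trans ((hC _).trans ?_)
    have := le_sp hx (Finset.mem_of_mem_erase ha)
    simp only [hM]
    gcongr
  · intro n A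
    refine kit_drift Tk (Tk_row hd0) _ l (M 2) _ hl2.le ?_ ?_ n A
    · have e : (1 - l) * (M 2 / (1 - l)) = M 2 := ENNReal.mul_div_cancel hsub0 hsubt
      conv_lhs => rw [← mul_one (M 2 / (1 - l)), ← mul_assoc]
      nth_rewrite 2 [← e]
      rw [mul_one, ← add_mul, add_tsub_cancel_of_le hl2.le, one_mul]
    · intro A
      set F : Kl d → ℝ≥0∞ := fun A' => if sp A'.1 ≤ 2 then 1 else 0 with hF
      set F' : Kl d → ℝ≥0∞ := fun A' => if sp A'.1 ≤ 2 then 0 else 1 with hF'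
      have hFF : kap Tk F A + kap Tk F' A = 1 := by
        rw [← Tk_row hd0 A]
        unfold kap
        rw [← ENNReal.tsum_add]
        congr 1; ext A'
        simp only [hF, hF']
        split_ifs <;> simp
      have hFl : c ≤ kap Tk F A := by
        obtain ⟨x, hx, hsp⟩ := exists_good_removal A
        rw [Tk_apply, hc]
        gcongr
        refine le_trans ?_ le_self_add
        refine le_trans ?_ (Finset.single_le_sum (f := fun x => es (↑A.1) x / rho (↑(A.1.erase x)) x *
          HV (↑(A.1.erase x)) (fun y => ext0 F (insert y (A.1.erase x))) x) (fun _ _ => bot_le) hx)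
        beta_reduce
        have : HV (↑(A.1.erase x)) (fun y => ext0 F (insert y (A.1.erase x))) x = rho (↑(A.1.erase x)) x := by
          unfold rho
          refine HV_congr_supp fun y hy => ?_
          unfold ext0
          rw [dif_pos (good_move A.2 hx hy)]
          simp only [hF]
          rw [if_pos]
          have := sp_move hy
          omega
        rw [this, ENNReal.div_mul_cancel (rho_erase_ne hd0 A.2.1 hx) (rho_ne_top hd0 _ _)]
        exact hces _ _ A.2.2.1 hx
      have hF'l : kap Tk F' A ≤ 1 - c := by
        refine ENNReal.le_sub_of_add_le_left (ne_top_of_le_ne_top ENNReal.one_ne_top (hFl.trans (hFF ▸ le_self_add))) ?_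
        rw [← hFF]; gcongr
      have hpt : ∀ A', Tk A A' * M (sp A'.1) ≤ Tk A A' * (M (sp A.1 + 1) * F' A' + M 2) := by
        intro A'
        by_cases h : Tk A A' = 0
        · simp [h]
        gcongr
        by_cases h2 : sp A'.1 ≤ 2
        · exact (hMmono _ _ h2).trans le_add_self
        · simp only [hF', if_neg h2, mul_one]
          exact (hMmono _ _ (Tk_near h).1).trans le_self_add
      calc kap Tk (fun A => M (sp A.1)) A ≤ kap Tk (fun A' => M (sp A.1 + 1) * F' A' + M 2) A :=
            ENNReal.tsum_le_tsum hpt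
        _ = M (sp A.1 + 1) * kap Tk F' A + M 2 := by rw [kap_affine Tk (Tk_row hd0)]
        _ ≤ l * M (sp A.1) + M 2 := by
          refine add_le_add ?_ le_rfl
          refine (mul_le_mul_right hF'l _).trans ?_
          have hm : ((sp A.1 + 1 + b : ℕ) : ℝ≥0∞) ≤ (1 + (b : ℝ≥0∞)⁻¹) * ((sp A.1 + b : ℕ) : ℝ≥0∞) := by
            have hbb : (b : ℝ≥0∞)⁻¹ * b = 1 := ENNReal.inv_mul_cancel (by exact_mod_cast (by omega : b ≠ 0)) (by simp)
            have : (1 : ℝ≥0∞) ≤ (b : ℝ≥0∞)⁻¹ * ((sp A.1 + b : ℕ) : ℝ≥0∞) := by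
              rw [← hbb]; gcongr; omega
            rw [add_mul, one_mul]
            refine le_trans (le_of_eq ?_) (add_le_add le_rfl this)
            push_cast; ring
          simp only [hM]
          calc C * ((sp A.1 + 1 + b : ℕ) : ℝ≥0∞) ^ (2 * d) * (1 - c)
              ≤ C * ((1 + (b : ℝ≥0∞)⁻¹) * ((sp A.1 + b : ℕ) : ℝ≥0∞)) ^ (2 * d) * (1 - c) := by gcongr
            _ = ((1 - c) * (1 + (b : ℝ≥0∞)⁻¹) ^ (2 * d)) * (C * ((sp A.1 + b : ℕ) : ℝ≥0∞) ^ (2 * d)) := by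
              rw [mul_pow]; ring
            _ ≤ l * (C * ((sp A.1 + b : ℕ) : ℝ≥0∞) ^ (2 * d)) := by gcongr
  · intro A r h
    exact hMmono _ _ h

end Dimer

section TwoBody
open Classical
open scoped ENNReal

variable {X : Type*}

/-- Kernel acting on the first coordinate. -/
noncomputable def L1 (T : X → X → ℝ≥0∞) : Module.End ℝ≥0∞ (X → X → ℝ≥0∞) where
  toFun f A B := ∑' A', T A A' * f A' B
  map_add' f g := by
    funext A B
    simp only [Pi.add_apply, mul_add]
    exact ENNReal.tsum_add
  map_smul' c f := by
    funext A B
    simp only [Pi.smul_apply, smul_eq_mul, RingHom.id_apply]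
    rw [← ENNReal.tsum_mul_left]
    congr 1; ext A'; ring

/-- Kernel acting on the second coordinate. -/
noncomputable def L2 (T : X → X → ℝ≥0∞) : Module.End ℝ≥0∞ (X → X → ℝ≥0∞) where
  toFun f A B := ∑' B', T B B' * f A B'
  map_add' f g := by
    funext A B
    simp only [Pi.add_apply, mul_add]
    exact ENNReal.tsum_add
  map_smul' c f := by
    funext A B
    simp only [Pi.smul_apply, smul_eq_mul, RingHom.id_apply]
    rw [← ENNReal.tsum_mul_left]
    congr 1; ext A'; ring

lemma L1_apply (T : X → X → ℝ≥0∞) (f : X → X → ℝ≥0∞) (A B : X) : L1 T f A B = ∑' A', T A A' * f A' B := rfl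
lemma L2_apply (T : X → X → ℝ≥0∞) (f : X → X → ℝ≥0∞) (A B : X) : L2 T f A B = ∑' B', T B B' * f A B' := rfl

lemma L12_comm (T : X → X → ℝ≥0∞) : Commute (L1 T) (L2 T) := by
  refine LinearMap.ext fun f => ?_
  funext A B
  rw [Module.End.mul_apply, Module.End.mul_apply, L1_apply, L2_apply]
  simp_rw [L1_apply, L2_apply, ← ENNReal.tsum_mul_left]
  rw [ENNReal.tsum_comm]
  congr 1; ext a; congr 1; ext b; ring

lemma L1_pow (T : X → X → ℝ≥0∞) (f : X → X → ℝ≥0∞) (α : ℕ) (A B : X) :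
    (L1 T ^ α) f A B = kit T (fun A' => f A' B) α A := by
  induction α generalizing A with
  | zero => rfl
  | succ n ih =>
    rw [pow_succ', Module.End.mul_apply, L1_apply, kit_succ]
    simp_rw [ih]; rfl

lemma L2_pow (T : X → X → ℝ≥0∞) (f : X → X → ℝ≥0∞) (α : ℕ) (A B : X) :
    (L2 T ^ α) f A B = kit T (f A) α B := by
  induction α generalizing B with
  | zero => rfl
  | succ n ih =>
    rw [pow_succ', Module.End.mul_apply, L2_apply, kit_succ]
    simp_rw [ih]; rfl

/-- Two-body step. -/
noncomputable def qq (T : X → X → ℝ≥0∞) (a r : ℝ≥0∞) : Module.End ℝ≥0∞ (X → X → ℝ≥0∞) :=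
  a • L1 T + a • L2 T + r • 1

lemma qq_apply (T : X → X → ℝ≥0∞) (a r : ℝ≥0∞) (f : X → X → ℝ≥0∞) :
    qq T a r f = a • L1 T f + a • L2 T f + r • f := rfl

lemma qq_apply2 (T : X → X → ℝ≥0∞) (a r : ℝ≥0∞) (f : X → X → ℝ≥0∞) (A B : X) :
    qq T a r f A B = a * (∑' A', T A A' * f A' B) + a * (∑' B', T B B' * f A B') + r * f A B := rfl

/-- Majorising sequence. -/
noncomputable def om (a r : ℝ≥0∞) (ψ : ℕ → ℝ≥0∞) : ℕ → ℕ → ℝ≥0∞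
  | 0, s => ψ s
  | t + 1, s => a * om a r ψ t (s + 1) + (a + r) * om a r ψ t s

lemma om_sum (a r : ℝ≥0∞) (har : a + (a + r) = 1) (ψ : ℕ → ℝ≥0∞) (N s : ℕ) :
    a * ∑ t ∈ Finset.range N, om a r ψ t s ≤ ∑' α, ψ (s + α) := by
  induction N generalizing s with
  | zero => simp
  | succ N ih =>
    rw [Finset.sum_range_succ']
    simp only [om]
    rw [Finset.sum_add_distrib, ← Finset.mul_sum, ← Finset.mul_sum]
    have hΨ : ∑' α, ψ (s + α) = ψ s + ∑' α, ψ (s + 1 + α) := by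
      rw [tsum_eq_zero_add' ENNReal.summable, add_zero]
      congr 2; ext α; congr 1; ring
    calc a * (a * ∑ t ∈ Finset.range N, om a r ψ t (s + 1) + (a + r) * ∑ t ∈ Finset.range N, om a r ψ t s + ψ s)
        = a * (ψ s + a * ∑ t ∈ Finset.range N, om a r ψ t (s + 1)) + (a + r) * (a * ∑ t ∈ Finset.range N, om a r ψ t s) := by ring
      _ ≤ a * (ψ s + ∑' α, ψ (s + 1 + α)) + (a + r) * ∑' α, ψ (s + α) := by gcongr <;> exact ih _
      _ = (a + (a + r)) * ∑' α, ψ (s + α) := by rw [← hΨ]; ring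
      _ = _ := by rw [har, one_mul]

lemma om_tsum (a r : ℝ≥0∞) (har : a + (a + r) = 1) (ha : a ≠ 0) (ψ : ℕ → ℝ≥0∞) (hψ : ∑' n, ψ n ≠ ⊤) :
    ∑' t, om a r ψ t 0 ≠ ⊤ := by
  have hat : a ≠ ⊤ := ne_top_of_le_ne_top ENNReal.one_ne_top (har ▸ le_self_add)
  have : ∑' t, om a r ψ t 0 ≤ a⁻¹ * ∑' n, ψ n := by
    rw [ENNReal.tsum_eq_iSup_nat]
    refine iSup_le fun N => ?_
    have h := om_sum a r har ψ N 0
    simp only [zero_add] at h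
    calc _ = a⁻¹ * (a * ∑ t ∈ Finset.range N, om a r ψ t 0) := by
          rw [← mul_assoc, ENNReal.inv_mul_cancel ha hat, one_mul]
      _ ≤ _ := by gcongr
  exact ne_top_of_le_ne_top (ENNReal.mul_ne_top (ENNReal.inv_ne_top.2 ha) hψ) this

lemma qq_decay (T : X → X → ℝ≥0∞) (a r : ℝ≥0∞) (ψ : ℕ → ℝ≥0∞) (A B : X) (W : ℝ≥0∞) (t : ℕ) :
    ∀ (f : X → X → ℝ≥0∞) (s : ℕ), (∀ α β, (L1 T ^ α * L2 T ^ β) f A B ≤ ψ (s + α) * W) →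
      (qq T a r ^ t) f A B ≤ om a r ψ t s * W := by
  induction t with
  | zero =>
    intro f s h
    simpa [om] using h 0 0
  | succ t ih =>
    intro f s h
    rw [pow_succ, Module.End.mul_apply, qq_apply, map_add, map_add, map_smul, map_smul, map_smul]
    have h1 := ih (L1 T f) (s + 1) (fun α β => by
      have e : (L1 T ^ α * L2 T ^ β) (L1 T f) = (L1 T ^ (α + 1) * L2 T ^ β) f := by
        rw [← Module.End.mul_apply, mul_assoc, ((L12_comm T).pow_right β).symm.eq, pow_succ, mul_assoc]
      rw [e]
      refine (h (α + 1) β).trans (le_of_eq ?_)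
      congr 2; ring)
    have h2 := ih (L2 T f) s (fun α β => by
      have e : (L1 T ^ α * L2 T ^ β) (L2 T f) = (L1 T ^ α * L2 T ^ (β + 1)) f := by
        rw [← Module.End.mul_apply, mul_assoc, pow_succ]
      rw [e]
      exact h α (β + 1))
    have h3 := ih f s h
    simp only [Pi.add_apply, Pi.smul_apply, smul_eq_mul]
    calc _ ≤ a * (om a r ψ t (s + 1) * W) + a * (om a r ψ t s * W) + r * (om a r ψ t s * W) := by gcongr
      _ = _ := by rw [om]; ring

lemma qq_symm (T : X → X → ℝ≥0∞) (a r : ℝ≥0∞) (f : X → X → ℝ≥0∞) (hf : ∀ A B, f A B = f B A) (t : ℕ) (A B : X) :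
    (qq T a r ^ t) f A B = (qq T a r ^ t) f B A := by
  induction t generalizing A B with
  | zero => exact hf A B
  | succ t ih =>
    rw [pow_succ', Module.End.mul_apply, qq_apply2, qq_apply2, ih A B]
    have e1 : ∀ A', (qq T a r ^ t) f A' B = (qq T a r ^ t) f B A' := fun A' => ih A' B
    have e2 : ∀ B', (qq T a r ^ t) f A B' = (qq T a r ^ t) f B' A := fun B' => ih A B'
    simp_rw [e1, e2]
    congr 1
    rw [add_comm]

lemma qq_early (T : X → X → ℝ≥0∞) (hT : ∀ A, ∑' B, T A B = 1) (a r : ℝ≥0∞) (har : a + (a + r) = 1)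
    (I : ℕ → X → X → Prop) (hI1 : ∀ j A B A', I j A B → T A A' ≠ 0 → I (j + 1) A' B)
    (hI2 : ∀ j A B B', I j A B → T B B' ≠ 0 → I (j + 1) A B')
    (hI3 : ∀ j A B, I j A B → I (j + 1) A B) (f : X → X → ℝ≥0∞) (ε : ℝ≥0∞) (t0 : ℕ)
    (hf : ∀ A B, I t0 A B → f A B ≤ ε) (t : ℕ) :
    ∀ j, j + t ≤ t0 → ∀ A B, I j A B → (qq T a r ^ t) f A B ≤ ε := by
  have hup : ∀ m j A B, I j A B → I (j + m) A B := by
    intro m j A B h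
    induction m with
    | zero => exact h
    | succ m ih => exact hI3 _ _ _ ih
  induction t with
  | zero =>
    intro j hj A B h
    refine hf A B ?_
    have := hup (t0 - j) j A B h
    rwa [show j + (t0 - j) = t0 by omega] at this
  | succ t ih =>
    intro j hj A B h
    rw [pow_succ', Module.End.mul_apply, qq_apply2]
    have e1 : ∑' A', T A A' * (qq T a r ^ t) f A' B ≤ ε := by
      calc _ ≤ ∑' A', T A A' * ε := ENNReal.tsum_le_tsum fun A' => by
            by_cases h0 : T A A' = 0
            · simp [h0]
            · gcongr; exact ih (j + 1) (by omega) _ _ (hI1 j A B A' h h0)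
        _ = ε := by rw [ENNReal.tsum_mul_right, hT, one_mul]
    have e2 : ∑' B', T B B' * (qq T a r ^ t) f A B' ≤ ε := by
      calc _ ≤ ∑' B', T B B' * ε := ENNReal.tsum_le_tsum fun B' => by
            by_cases h0 : T B B' = 0
            · simp [h0]
            · gcongr; exact ih (j + 1) (by omega) _ _ (hI2 j A B B' h h0)
        _ = ε := by rw [ENNReal.tsum_mul_right, hT, one_mul]
    have e3 := ih j (by omega) A B h
    calc _ ≤ a * ε + a * ε + r * ε := by gcongr
      _ = (a + (a + r)) * ε := by ring
      _ = ε := by rw [har, one_mul]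

lemma qq_tsum (T : X → X → ℝ≥0∞) (a r : ℝ≥0∞) (f : ℕ → X → X → ℝ≥0∞) (A B : X) :
    qq T a r (fun A B => ∑' t, f t A B) A B = ∑' t, qq T a r (f t) A B := by
  simp_rw [qq_apply2]
  rw [ENNReal.tsum_add, ENNReal.tsum_add, ENNReal.tsum_mul_left, ENNReal.tsum_mul_left, ENNReal.tsum_mul_left]
  simp_rw [← ENNReal.tsum_mul_left]
  congr 1
  congr 1
  · simp_rw [ENNReal.tsum_mul_left]
    rw [ENNReal.tsum_comm]
    simp_rw [ENNReal.tsum_mul_left]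
  · simp_rw [ENNReal.tsum_mul_left]
    rw [ENNReal.tsum_comm]
    simp_rw [ENNReal.tsum_mul_left]

variable {d : ℕ}

/-- Sum of Green functions between two sets. -/
noncomputable def gg (A B : Finset (Pt d)) : ℝ≥0∞ := ∑ x ∈ A, ∑ z ∈ B, hh (x - z)

lemma gg_symm (A B : Finset (Pt d)) : gg A B = gg B A := by
  unfold gg
  rw [Finset.sum_comm]
  refine Finset.sum_congr rfl fun x _ => Finset.sum_congr rfl fun z _ => ?_
  rw [← hh_neg, neg_sub]

lemma kit_mono_dimer {f g : Kl d → ℝ≥0∞} (h : ∀ A : Kl d, A.1.card = 2 → f A ≤ g A) (n : ℕ) (A : Kl d)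
    (hA : A.1.card = 2) : kit Tk f n A ≤ kit Tk g n A := by
  induction n generalizing A with
  | zero => exact h A hA
  | succ n ih =>
    rw [kit_succ, kit_succ]
    refine ENNReal.tsum_le_tsum fun A' => ?_
    by_cases h0 : Tk A A' = 0
    · simp [h0]
    · gcongr; exact ih A' (by rw [Tk_card h0, hA])

lemma kit_smul (T : X → X → ℝ≥0∞) (f : X → ℝ≥0∞) (u : ℝ≥0∞) (n : ℕ) (a : X) :
    kit T (fun a => u * f a) n a = u * kit T f n a := by
  induction n generalizing a with
  | zero => rfl
  | succ n ih =>
    rw [kit_succ, kit_succ]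
    unfold kap
    simp_rw [ih, ← ENNReal.tsum_mul_left]
    congr 1; ext b; ring

lemma kit_sum {ι : Type*} (T : X → X → ℝ≥0∞) (S : Finset ι) (f : ι → X → ℝ≥0∞) (n : ℕ) (a : X) :
    kit T (fun a => ∑ i ∈ S, f i a) n a = ∑ i ∈ S, kit T (f i) n a := by
  induction n generalizing a with
  | zero => rfl
  | succ n ih =>
    rw [kit_succ]
    unfold kap
    simp_rw [ih, kit_succ, Finset.mul_sum]
    rw [Summable.tsum_finsetSum (fun _ _ => ENNReal.summable)]
    rfl

lemma sp_dimer (A : Kl d) (hA : A.1.card = 2) : sp A.1 ≤ 1 := by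
  obtain ⟨z, s, h⟩ := pair_of_card A.2 hA
  rw [h]; exact sp_pair z s

theorem two_body (hd : 5 ≤ d) (k : ℕ) (hk : 2 ≤ k) : ∃ (e γ : Kl d → Kl d → ℝ≥0∞),
    (∀ A B, γ A B = e A B + ((k : ℝ≥0∞)⁻¹ * (∑' A', Tk A A' * γ A' B) +
      (k : ℝ≥0∞)⁻¹ * (∑' B', Tk B B' * γ A B') + ((k - 2 : ℕ) * (k : ℝ≥0∞)⁻¹) * γ A B)) ∧
    (∀ A B : Kl d, gg A.1 B.1 ≤ e A B) ∧
    (∀ A B : Kl d, ∀ x ∈ A.1, (rho (↑(A.1.erase x)) x)⁻¹ * gg A.1 B.1 ≤ e A B) ∧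
    (∀ A B, e A B = e B A) ∧ (∀ A B, γ A B = γ B A) ∧
    ∀ δ : ℝ≥0∞, δ ≠ 0 → ∃ D : ℕ, ∀ A B : Kl d, (A.1.card = 2 ∨ B.1.card = 2) → sp A.1 ≤ 2 → sp B.1 ≤ 2 →
      (∀ x ∈ A.1, ∀ z ∈ B.1, D ≤ nm (x - z)) → γ A B ≤ δ := by
  have hd0 : 0 < d := by omega
  obtain ⟨V, L, M, hLt, hMt, hV1, hVrho, hVd, hVM⟩ := V_drift hd
  obtain ⟨C, hCt, hC⟩ := dimer_decay hd
  obtain ⟨H, hHt, hH0, hHm, hH⟩ := hh_decay hd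
  set a : ℝ≥0∞ := (k : ℝ≥0∞)⁻¹ with ha
  set r : ℝ≥0∞ := (k - 2 : ℕ) * (k : ℝ≥0∞)⁻¹ with hr
  have hk0 : (k : ℝ≥0∞) ≠ 0 := by exact_mod_cast (by omega : k ≠ 0)
  have ha0 : a ≠ 0 := by simp [ha]
  have har : a + (a + r) = 1 := by
    have h1 : a + (a + r) = ((2 + (k - 2) : ℕ) : ℝ≥0∞) * a := by
      rw [hr]; push_cast; ring
    rw [h1, show 2 + (k - 2) = k by omega, ha, ENNReal.mul_inv_cancel hk0 (by simp)]
  set e : Kl d → Kl d → ℝ≥0∞ := fun A B => V A * V B * gg A.1 B.1 with he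
  have hesymm : ∀ A B, e A B = e B A := by
    intro A B
    simp only [he]; rw [gg_symm]; ring
  have hqs := qq_symm (Tk (d := d)) a r e hesymm
  -- decay in terms of the first coordinate
  set C' : ℝ≥0∞ := M 1 * (3 * C) with hC'
  have hC't : C' ≠ ⊤ := ENNReal.mul_ne_top (hMt 1) (ENNReal.mul_ne_top (by simp) hCt)
  have hdec1 : ∀ A B : Kl d, A.1.card = 2 → ∀ α, (L1 Tk ^ α) e A B ≤ C' * psi α * V B := by
    intro A B hA α
    rw [L1_pow]
    calc kit Tk (fun A' => e A' B) α A
        ≤ kit Tk (fun A' => (M 1 * V B) * ∑ z ∈ B.1, ∑ x ∈ A'.1, hh (x - z)) α A := by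
          refine kit_mono_dimer (fun A' hA' => ?_) α A hA
          simp only [he, gg]
          rw [Finset.sum_comm]
          gcongr
          exact hVM A' 1 (sp_dimer A' hA')
      _ = (M 1 * V B) * ∑ z ∈ B.1, kit Tk (fun A' => ∑ x ∈ A'.1, hh (x - z)) α A := by
          rw [kit_smul, kit_sum]
      _ ≤ (M 1 * V B) * ∑ z ∈ B.1, (C * psi α) := by
          gcongr with z hz; exact hC A hA z α
      _ ≤ (M 1 * V B) * (3 * (C * psi α)) := by
          rw [Finset.sum_const, nsmul_eq_mul]
          gcongr
          exact_mod_cast B.2.2.1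
      _ = _ := by rw [hC']; ring
  have hdec2 : ∀ A B : Kl d, A.1.card = 2 → ∀ α β, ((L1 (Tk (d := d))) ^ α * (L2 (Tk (d := d))) ^ β) e A B ≤ psi (0 + α) * (C' * (V B + L)) := by
    intro A B hA α β
    rw [((L12_comm Tk).pow_pow α β).eq, Module.End.mul_apply, L2_pow]
    calc _ ≤ kit Tk (fun B' => C' * psi α * V B') β B := kit_mono Tk (fun B' => hdec1 A B' hA α) β B
      _ = C' * psi α * kit Tk V β B := kit_smul _ _ _ _ _
      _ ≤ C' * psi α * (V B + L) := by gcongr; exact hVd β B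
      _ = _ := by rw [zero_add]; ring
  have hdec : ∀ A B : Kl d, A.1.card = 2 → ∀ t, (qq Tk a r ^ t) e A B ≤ om a r psi t 0 * (C' * (V B + L)) :=
    fun A B hA t => qq_decay Tk a r psi A B _ t e 0 (hdec2 A B hA)
  have homt := om_tsum a r har ha0 psi psi_sum
  refine ⟨e, fun A B => ∑' t, (qq Tk a r ^ t) e A B, ?_, ?_, ?_, hesymm, ?_, ?_⟩
  · intro A B
    beta_reduce
    conv_lhs => rw [tsum_eq_zero_add' ENNReal.summable]
    congr 1
    have := qq_tsum Tk a r (fun t => (qq Tk a r ^ t) e) A B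
    rw [qq_apply2] at this
    rw [this]
    congr 1; ext t
    rw [pow_succ', Module.End.mul_apply]
  · intro A B
    simp only [he]
    calc gg A.1 B.1 = 1 * 1 * gg A.1 B.1 := by simp
      _ ≤ _ := by gcongr <;> exact hV1 _
  · intro A B x hx
    simp only [he]
    calc _ = (rho (↑(A.1.erase x)) x)⁻¹ * 1 * gg A.1 B.1 := by simp
      _ ≤ _ := by
        gcongr
        · exact hVrho A x hx
        · exact hV1 B
  · intro A B
    exact tsum_congr fun t => hqs t A B
  · intro δ hδ
    -- tail
    set Q : ℝ≥0∞ := C' * (M 2 + L) with hQ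
    have hQt : Q ≠ ⊤ := ENNReal.mul_ne_top hC't (ENNReal.add_ne_top.2 ⟨hMt 2, hLt⟩)
    have htail : ∃ t0, (∑' t, om a r psi (t + t0) 0) * Q ≤ δ / 2 := by
      have h1 := ENNReal.Tendsto.mul_const (ENNReal.tendsto_sum_nat_add (fun t => om a r psi t 0) homt) (Or.inr hQt)
      rw [zero_mul] at h1
      have hδ2 : (0 : ℝ≥0∞) < δ / 2 := ENNReal.half_pos hδ
      obtain ⟨t0, ht0⟩ := (h1.eventually (gt_mem_nhds hδ2)).exists
      exact ⟨t0, ht0.le⟩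
    obtain ⟨t0, ht0⟩ := htail
    have hearly : ∃ D0 : ℕ, (t0 : ℝ≥0∞) * (M (2 + t0) * M (2 + t0) * (9 * H D0)) ≤ δ / 2 := by
      have hm : M (2 + t0) * M (2 + t0) ≠ ⊤ := ENNReal.mul_ne_top (hMt _) (hMt _)
      have h1 : Filter.Tendsto (fun D0 => (t0 : ℝ≥0∞) * (M (2 + t0) * M (2 + t0) * (9 * H D0))) Filter.atTop
          (nhds ((t0 : ℝ≥0∞) * (M (2 + t0) * M (2 + t0) * (9 * 0)))) :=
        ENNReal.Tendsto.const_mul (ENNReal.Tendsto.const_mul (ENNReal.Tendsto.const_mul hH0 (Or.inr (by simp))) (Or.inr hm)) (Or.inr (by simp))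
      rw [mul_zero, mul_zero, mul_zero] at h1
      have hδ2 : (0 : ℝ≥0∞) < δ / 2 := ENNReal.half_pos hδ
      obtain ⟨D0, hD0⟩ := (h1.eventually (gt_mem_nhds hδ2)).exists
      exact ⟨D0, hD0.le⟩
    obtain ⟨D0, hD0⟩ := hearly
    refine ⟨D0 + t0, fun A B hAB hA hB hsep => ?_⟩
    set I : ℕ → Kl d → Kl d → Prop := fun j A B => sp A.1 ≤ 2 + j ∧ sp B.1 ≤ 2 + j ∧
      ∀ x ∈ A.1, ∀ z ∈ B.1, D0 + t0 ≤ nm (x - z) + j with hI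
    have hI1 : ∀ j A B A', I j A B → Tk A A' ≠ 0 → I (j + 1) A' B := by
      rintro j A B A' ⟨h1, h2, h3⟩ hT
      obtain ⟨h4, h5⟩ := Tk_near hT
      refine ⟨by omega, by omega, fun y hy z hz => ?_⟩
      obtain ⟨x, hx, hxy⟩ := h5 y hy
      have e1 := h3 x hx z hz
      have e2 := nm_tri x y z
      rw [nm_sub_comm x y] at e2
      omega
    have hI2 : ∀ j A B B', I j A B → Tk B B' ≠ 0 → I (j + 1) A B' := by
      rintro j A B B' ⟨h1, h2, h3⟩ hT
      obtain ⟨h4, h5⟩ := Tk_near hT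
      refine ⟨by omega, by omega, fun x hx y hy => ?_⟩
      obtain ⟨z, hz, hzy⟩ := h5 y hy
      have e1 := h3 x hx z hz
      have e2 := nm_tri x y z
      omega
    have hI3 : ∀ j A B, I j A B → I (j + 1) A B := by
      rintro j A B ⟨h1, h2, h3⟩
      exact ⟨by omega, by omega, fun x hx z hz => by have := h3 x hx z hz; omega⟩
    have hf : ∀ A B, I t0 A B → e A B ≤ M (2 + t0) * M (2 + t0) * (9 * H D0) := by
      rintro A B ⟨h1, h2, h3⟩
      simp only [he]
      gcongr
      · exact hVM A _ h1
      · exact hVM B _ h2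
      · unfold gg
        calc _ ≤ ∑ x ∈ A.1, ∑ z ∈ B.1, H D0 := by
              gcongr with x hx z hz
              exact hH _ _ (by have := h3 x hx z hz; omega)
          _ = ((A.1.card * B.1.card : ℕ) : ℝ≥0∞) * H D0 := by
              simp only [Finset.sum_const, nsmul_eq_mul]; push_cast; ring
          _ ≤ ((3 * 3 : ℕ) : ℝ≥0∞) * H D0 := by
              gcongr
              · exact A.2.2.1
              · exact B.2.2.1
          _ = 9 * H D0 := by norm_num
    have hE := qq_early Tk (Tk_row hd0) a r har I hI1 hI2 hI3 e _ t0 hf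
    have hI0 : I 0 A B := ⟨hA, hB, fun x hx z hz => hsep x hx z hz⟩
    have hdecAB : ∀ t, (qq Tk a r ^ t) e A B ≤ om a r psi t 0 * Q := by
      intro t
      rcases hAB with h | h
      · refine (hdec A B h t).trans ?_
        rw [hQ]; gcongr; exact hVM B 2 hB
      · rw [hqs t A B]
        refine (hdec B A h t).trans ?_
        rw [hQ]; gcongr; exact hVM A 2 hA
    beta_reduce
    rw [← ENNReal.summable.sum_add_tsum_nat_add' (k := t0)]
    refine (add_le_add ?_ ?_).trans (ENNReal.add_halves δ).le
    · refine le_trans (Finset.sum_le_sum fun t ht => hE t 0 (by have := Finset.mem_range.1 ht; omega) A B hI0) ?_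
      rw [Finset.sum_const, Finset.card_range, nsmul_eq_mul]
      exact hD0
    · refine le_trans (ENNReal.tsum_le_tsum fun t => hdecAB (t + t0)) ?_
      rw [ENNReal.tsum_mul_right]
      exact ht0

end TwoBody

section Lyap
open Classical
open scoped ENNReal

variable {d : ℕ}

lemma pair_step {k : ℕ} (hd : 0 < d) (hk : 2 ≤ k) (e γ : Kl d → Kl d → ℝ≥0∞)
    (hγ : ∀ A B, γ A B = e A B + ((k : ℝ≥0∞)⁻¹ * (∑' A', Tk A A' * γ A' B) +
      (k : ℝ≥0∞)⁻¹ * (∑' B', Tk B B' * γ A B') + ((k - 2 : ℕ) * (k : ℝ≥0∞)⁻¹) * γ A B))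
    (C : Fin k → Kl d) (i j : Fin k) (hij : i ≠ j) :
    ∑ l, kap Tk (fun A' => γ (Function.update C l A' i) (Function.update C l A' j)) (C l) + k * e (C i) (C j)
      = k * γ (C i) (C j) := by
  have hk0 : (k : ℝ≥0∞) ≠ 0 := by exact_mod_cast (by omega : k ≠ 0)
  have hkk : (k : ℝ≥0∞) * (k : ℝ≥0∞)⁻¹ = 1 := ENNReal.mul_inv_cancel hk0 (by simp)
  have h1 : ∑ l, kap Tk (fun A' => γ (Function.update C l A' i) (Function.update C l A' j)) (C l) =
      (∑' A', Tk (C i) A' * γ A' (C j)) + ((∑' B', Tk (C j) B' * γ (C i) B') + (k - 2 : ℕ) * γ (C i) (C j)) := by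
    rw [← Finset.add_sum_erase _ _ (Finset.mem_univ i),
      ← Finset.add_sum_erase _ _ (Finset.mem_erase.2 ⟨hij.symm, Finset.mem_univ j⟩)]
    congr 1
    · unfold kap
      simp [Function.update_of_ne hij.symm]
    congr 1
    · unfold kap
      simp [Function.update_of_ne hij]
    · rw [Finset.sum_congr rfl (g := fun _ => γ (C i) (C j))]
      · rw [Finset.sum_const, nsmul_eq_mul]
        congr 2
        rw [Finset.card_erase_of_mem (Finset.mem_erase.2 ⟨hij.symm, Finset.mem_univ j⟩),
          Finset.card_erase_of_mem (Finset.mem_univ i), Finset.card_univ, Fintype.card_fin]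
        omega
      · intro l hl
        rw [Finset.mem_erase, Finset.mem_erase] at hl
        unfold kap
        simp only [Function.update_of_ne hl.1.symm, Function.update_of_ne hl.2.1.symm]
        rw [ENNReal.tsum_mul_right, Tk_row hd, one_mul]
  rw [h1]
  conv_rhs => rw [hγ]
  generalize (∑' A', Tk (C i) A' * γ A' (C j)) = a
  generalize (∑' B', Tk (C j) B' * γ (C i) B') = b
  generalize γ (C i) (C j) = c
  generalize e (C i) (C j) = f
  generalize ((k - 2 : ℕ) : ℝ≥0∞) = m
  calc a + (b + m * c) + k * f = 1 * a + 1 * b + m * 1 * c + k * f := by ring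
    _ = ((k : ℝ≥0∞) * (k : ℝ≥0∞)⁻¹) * a + ((k : ℝ≥0∞) * (k : ℝ≥0∞)⁻¹) * b + m * ((k : ℝ≥0∞) * (k : ℝ≥0∞)⁻¹) * c + k * f := by rw [hkk]
    _ = _ := by ring

/-- Sum over ordered pairs of distinct clusters. -/
noncomputable def ps {k : ℕ} (Λ : ℝ≥0∞) (γ : Kl d → Kl d → ℝ≥0∞) (C : Fin k → Kl d) : ℝ≥0∞ :=
  Λ * ∑ p ∈ (Finset.univ : Finset (Fin k)).offDiag, γ (C p.1) (C p.2)

lemma ps_step {k : ℕ} (hd : 0 < d) (hk : 2 ≤ k) (e γ : Kl d → Kl d → ℝ≥0∞)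
    (hγ : ∀ A B, γ A B = e A B + ((k : ℝ≥0∞)⁻¹ * (∑' A', Tk A A' * γ A' B) +
      (k : ℝ≥0∞)⁻¹ * (∑' B', Tk B B' * γ A B') + ((k - 2 : ℕ) * (k : ℝ≥0∞)⁻¹) * γ A B))
    (Λ : ℝ≥0∞) (C : Fin k → Kl d) :
    ∑ l, kap Tk (fun A' => ps Λ γ (Function.update C l A')) (C l) + k * ps Λ e C = k * ps Λ γ C := by
  have h1 : ∀ l, kap Tk (fun A' => ps Λ γ (Function.update C l A')) (C l) =
      Λ * ∑ p ∈ (Finset.univ : Finset (Fin k)).offDiag,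
        kap Tk (fun A' => γ (Function.update C l A' p.1) (Function.update C l A' p.2)) (C l) := by
    intro l
    have := kit_smul Tk (fun A' => ∑ p ∈ (Finset.univ : Finset (Fin k)).offDiag,
      γ (Function.update C l A' p.1) (Function.update C l A' p.2)) Λ 1 (C l)
    rw [kit_sum] at this
    exact this
  simp_rw [h1]
  rw [← Finset.mul_sum, Finset.sum_comm]
  unfold ps
  rw [mul_left_comm, ← mul_add, mul_left_comm (k : ℝ≥0∞) Λ, Finset.mul_sum, Finset.mul_sum, ← Finset.sum_add_distrib]
  congr 1
  refine Finset.sum_congr rfl fun p hp => ?_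
  exact pair_step hd hk e γ hγ C p.1 p.2 (Finset.mem_offDiag.1 hp).2.2

lemma sum_biUnion' {k : ℕ} (C : Fin k → Kl d) (hdis : ∀ i j, i ≠ j → Disjoint (C i).1 (C j).1) (f : Pt d → ℝ≥0∞) :
    ∑ x ∈ Finset.univ.biUnion (fun i => (C i).1), f x = ∑ i, ∑ x ∈ (C i).1, f x :=
  Finset.sum_biUnion fun i _ j _ h => hdis i j h

/-- One HAT step applied to a function of the configuration. -/
noncomputable def PG (G : Finset (Pt d) → ℝ≥0∞) (U : Finset (Pt d)) : ℝ≥0∞ :=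
  ∑ x ∈ U, es (↑U) x / capE U * (HV (↑(U.erase x)) (fun y => G (insert y (U.erase x))) x / rho (↑(U.erase x)) x)

lemma PG_le_one {G : Finset (Pt d) → ℝ≥0∞} (hG : ∀ U, G U ≤ 1) (U : Finset (Pt d)) : PG G U ≤ 1 := by
  unfold PG
  calc _ ≤ ∑ x ∈ U, es (↑U) x / capE U * 1 := by
        gcongr with x hx
        refine ENNReal.div_le_of_le_mul ?_
        rw [one_mul]
        exact HV_mono (fun y => hG _) x
    _ = capE U / capE U := by
        simp only [mul_one, div_eq_mul_inv]
        rw [← Finset.sum_mul]; rfl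
    _ ≤ 1 := ENNReal.div_self_le_one

lemma main_ineq {k : ℕ} (hd : 5 ≤ d) (hk : 2 ≤ k) (e γ : Kl d → Kl d → ℝ≥0∞)
    (hγ : ∀ A B, γ A B = e A B + ((k : ℝ≥0∞)⁻¹ * (∑' A', Tk A A' * γ A' B) +
      (k : ℝ≥0∞)⁻¹ * (∑' B', Tk B B' * γ A B') + ((k - 2 : ℕ) * (k : ℝ≥0∞)⁻¹) * γ A B))
    (he : ∀ A B : Kl d, ∀ x ∈ A.1, (rho (↑(A.1.erase x)) x)⁻¹ * gg A.1 B.1 ≤ e A B)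
    (Λ : ℝ≥0∞) (hΛ : 1 ≤ Λ) (G : Finset (Pt d) → ℝ≥0∞) (hG1 : ∀ U, G U ≤ 1)
    (hGg : ∀ C : Fin k → Kl d, G (Finset.univ.biUnion fun i => (C i).1) ≤ ps Λ γ C)
    (C : Fin k → Kl d) (hdis : ∀ i j, i ≠ j → Disjoint (C i).1 (C j).1) (hlt : ps Λ γ C < 1) :
    PG G (Finset.univ.biUnion fun i => (C i).1) ≤ ps Λ γ C := by
  have hd0 : 0 < d := by omega
  set U : Finset (Pt d) := Finset.univ.biUnion fun i => (C i).1 with hU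
  set g := ps Λ γ C with hg
  have hsub : ∀ i, (C i).1 ⊆ U := fun i => Finset.subset_biUnion_of_mem (fun i => (C i).1) (Finset.mem_univ i)
  -- error terms
  set ε : Fin k → Pt d → ℝ≥0∞ := fun i x => rho (↑(U \ (C i).1)) x with hε
  set E : ℝ≥0∞ := ∑ i, ∑ x ∈ (C i).1, ε i x / rho (↑((C i).1.erase x)) x with hE
  have hεle : ∀ i x, ε i x ≤ ∑ j ∈ Finset.univ.erase i, ∑ z ∈ (C j).1, hh (x - z) := by
    intro i x
    refine (rho_le_hh hd _ x).trans ?_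
    have hs : U \ (C i).1 ⊆ (Finset.univ.erase i).biUnion (fun j => (C j).1) := by
      intro z hz
      rw [Finset.mem_sdiff, hU, Finset.mem_biUnion] at hz
      obtain ⟨⟨j, _, hj⟩, hz2⟩ := hz
      exact Finset.mem_biUnion.2 ⟨j, Finset.mem_erase.2 ⟨fun e => hz2 (e ▸ hj), Finset.mem_univ j⟩, hj⟩
    refine (Finset.sum_le_sum_of_subset hs).trans (le_of_eq ?_)
    exact Finset.sum_biUnion fun i _ j _ h => hdis i j h
  have hEle : 2 * E ≤ 3 * (k * ps Λ e C) := by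
    have h1 : E ≤ 3 * ∑ p ∈ (Finset.univ : Finset (Fin k)).offDiag, e (C p.1) (C p.2) := by
      calc E ≤ ∑ i, ∑ x ∈ (C i).1, ∑ j ∈ Finset.univ.erase i, e (C i) (C j) := by
            rw [hE]
            gcongr with i _ x hx
            rw [div_eq_mul_inv, mul_comm]
            refine (mul_le_mul_right (hεle i x) _).trans ?_
            rw [Finset.mul_sum]
            gcongr with j hj
            refine le_trans ?_ (he (C i) (C j) x hx)
            gcongr
            unfold gg
            exact Finset.single_le_sum (f := fun x => ∑ z ∈ (C j).1, hh (x - z)) (fun _ _ => bot_le) hx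
        _ ≤ ∑ i, 3 * ∑ j ∈ Finset.univ.erase i, e (C i) (C j) := by
            gcongr with i _
            rw [Finset.sum_const, nsmul_eq_mul]
            gcongr
            exact_mod_cast (C i).2.2.1
        _ = _ := by
            rw [← Finset.mul_sum]
            congr 1
            have : ∀ i : Fin k, Finset.univ.erase i = Finset.univ.filter (fun j => i ≠ j) := by
              intro i; ext j; simp [eq_comm]
            simp_rw [this]
            have hod : (Finset.univ : Finset (Fin k)).offDiag = (Finset.univ ×ˢ Finset.univ).filter (fun p => p.1 ≠ p.2) := by
              ext p; simp
            rw [hod, Finset.sum_filter, Finset.sum_product]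
            simp_rw [Finset.sum_filter]
    calc 2 * E ≤ 2 * (3 * ∑ p ∈ (Finset.univ : Finset (Fin k)).offDiag, e (C p.1) (C p.2)) := by gcongr
      _ = 3 * (2 * (1 * ∑ p ∈ (Finset.univ : Finset (Fin k)).offDiag, e (C p.1) (C p.2))) := by ring
      _ ≤ _ := by
        unfold ps
        gcongr
        exact_mod_cast hk
  have hstep := ps_step hd0 hk e γ hγ Λ C
  have hgt : g ≠ ⊤ := hlt.ne_top
  have herrt : (k : ℝ≥0∞) * ps Λ e C ≠ ⊤ := by
    refine ne_top_of_le_ne_top (ENNReal.mul_ne_top (ENNReal.natCast_ne_top k) hgt) (le_add_self.trans hstep.le)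
  have hEt : 2 * E ≠ ⊤ := ne_top_of_le_ne_top (ENNReal.mul_ne_top (by simp) herrt) hEle
  -- bound for individual terms
  set LH : ℝ≥0∞ := ∑ i, ∑ x ∈ (C i).1, es (↑U) x * (HV (↑(U.erase x)) (fun y => G (insert y (U.erase x))) x / rho (↑(U.erase x)) x) with hLH
  have hdecomp : ∀ i, ∀ x ∈ (C i).1, (↑(U.erase x) : Set (Pt d)) = ↑((C i).1.erase x) ∪ ↑(U \ (C i).1) := by
    intro i x hx
    rw [← Finset.coe_union]
    congr 1
    ext z
    simp only [Finset.mem_erase, Finset.mem_union, Finset.mem_sdiff]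
    constructor
    · rintro ⟨h1, h2⟩
      by_cases h3 : z ∈ (C i).1
      · exact Or.inl ⟨h1, h3⟩
      · exact Or.inr ⟨h2, h3⟩
    · rintro (⟨h1, h2⟩ | ⟨h1, h2⟩)
      · exact ⟨h1, hsub i h2⟩
      · exact ⟨fun e => h2 (e ▸ hx), h1⟩
  have hterm : ∀ i, ∀ x ∈ (C i).1,
      es (↑U) x * (HV (↑(U.erase x)) (fun y => G (insert y (U.erase x))) x / rho (↑(U.erase x)) x) ≤
      es (↑(C i).1) x / rho (↑((C i).1.erase x)) x *
        HV (↑((C i).1.erase x)) (fun y => ext0 (fun A' => ps Λ γ (Function.update C i A')) (insert y ((C i).1.erase x))) x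
      + ε i x / rho (↑((C i).1.erase x)) x := by
    intro i x hx
    have h1 : HV (↑(U.erase x)) (fun y => G (insert y (U.erase x))) x ≤
        HV (↑((C i).1.erase x)) (fun y => G (insert y (U.erase x))) x + ε i x := by
      rw [hdecomp i x hx]
      exact HV_union_le (fun y => hG1 _) x
    have h2 : rho (↑((C i).1.erase x)) x ≤ rho (↑(U.erase x)) x := by
      rw [hdecomp i x hx]
      exact HV_one_mono hd0 Set.subset_union_left x
    have h3 : es (↑U) x ≤ es (↑(C i).1) x :=
      tsub_le_tsub_left (HV_one_mono hd0 (Finset.coe_subset.2 (hsub i)) x) 1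
    have h4 : HV (↑((C i).1.erase x)) (fun y => G (insert y (U.erase x))) x ≤
        HV (↑((C i).1.erase x)) (fun y => ext0 (fun A' => ps Λ γ (Function.update C i A')) (insert y ((C i).1.erase x))) x := by
      refine HV_mono_supp fun y hy => ?_
      unfold ext0
      have hgood := good_move (C i).2 hx hy
      rw [dif_pos hgood]
      refine le_trans (le_of_eq ?_) (hGg _)
      congr 1
      ext z
      have hz : z ∈ U.erase x ↔ z ∈ (C i).1.erase x ∨ ∃ j, j ≠ i ∧ z ∈ (C j).1 := by
        rw [Finset.mem_erase, Finset.mem_erase, hU, Finset.mem_biUnion]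
        constructor
        · rintro ⟨hzx, j, _, hj⟩
          by_cases hji : j = i
          · subst hji; exact Or.inl ⟨hzx, hj⟩
          · exact Or.inr ⟨j, hji, hj⟩
        · rintro (⟨hzx, hj⟩ | ⟨j, hji, hj⟩)
          · exact ⟨hzx, i, Finset.mem_univ _, hj⟩
          · exact ⟨fun e => Finset.disjoint_left.1 (hdis j i hji) hj (e ▸ hx), j, Finset.mem_univ _, hj⟩
      rw [Finset.mem_insert, hz, Finset.mem_biUnion]
      constructor
      · rintro (h | h | ⟨j, hji, hj⟩)
        · exact ⟨i, Finset.mem_univ _, by rw [Function.update_self]; exact Finset.mem_insert.2 (Or.inl h)⟩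
        · exact ⟨i, Finset.mem_univ _, by rw [Function.update_self]; exact Finset.mem_insert.2 (Or.inr h)⟩
        · exact ⟨j, Finset.mem_univ _, by rw [Function.update_of_ne hji]; exact hj⟩
      · rintro ⟨j, _, hj⟩
        by_cases hji : j = i
        · subst hji
          rw [Function.update_self] at hj
          rcases Finset.mem_insert.1 hj with h | h
          · exact Or.inl h
          · exact Or.inr (Or.inl h)
        · rw [Function.update_of_ne hji] at hj
          exact Or.inr (Or.inr ⟨j, hji, hj⟩)
    calc _ ≤ es (↑U) x * ((HV (↑((C i).1.erase x)) (fun y => ext0 (fun A' => ps Λ γ (Function.update C i A')) (insert y ((C i).1.erase x))) x + ε i x) / rho (↑((C i).1.erase x)) x) := by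
          gcongr
          exact h1.trans (add_le_add h4 le_rfl)
      _ = es (↑U) x * (HV (↑((C i).1.erase x)) (fun y => ext0 (fun A' => ps Λ γ (Function.update C i A')) (insert y ((C i).1.erase x))) x / rho (↑((C i).1.erase x)) x)
          + es (↑U) x * (ε i x / rho (↑((C i).1.erase x)) x) := by rw [ENNReal.add_div, mul_add]
      _ ≤ es (↑(C i).1) x * (HV (↑((C i).1.erase x)) (fun y => ext0 (fun A' => ps Λ γ (Function.update C i A')) (insert y ((C i).1.erase x))) x / rho (↑((C i).1.erase x)) x)
          + 1 * (ε i x / rho (↑((C i).1.erase x)) x) := by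
          gcongr
          exact es_le_one _ _
      _ = _ := by
        rw [one_mul]
        congr 1
        simp only [div_eq_mul_inv]; ring
  have h3inv : (3 : ℝ≥0∞) * 3⁻¹ = 1 := ENNReal.mul_inv_cancel (by simp) (by simp)
  have hcap3 : ∀ i, capE (C i).1 ≤ 3 := fun i => (capE_le (C i).1).trans (by exact_mod_cast (C i).2.2.1)
  have hsum1 : LH + ∑ i, (3 - capE (C i).1) * g ≤
      3 * ∑ i, kap Tk (fun A' => ps Λ γ (Function.update C i A')) (C i) + E := by
    calc LH + ∑ i, (3 - capE (C i).1) * g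
        ≤ ∑ i, (∑ x ∈ (C i).1, (es (↑(C i).1) x / rho (↑((C i).1.erase x)) x *
        HV (↑((C i).1.erase x)) (fun y => ext0 (fun A' => ps Λ γ (Function.update C i A')) (insert y ((C i).1.erase x))) x
      + ε i x / rho (↑((C i).1.erase x)) x)) + ∑ i, (3 - capE (C i).1) * g := by
          rw [hLH]
          gcongr with i _ x hx
          exact hterm i x hx
      _ = _ := by
        simp_rw [Finset.sum_add_distrib]
        rw [add_right_comm, ← Finset.sum_add_distrib, Finset.mul_sum]
        congr 1
        refine Finset.sum_congr rfl fun i _ => ?_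
        rw [Tk_apply, ← mul_assoc, h3inv, one_mul, Function.update_eq_self]
  have hsum2 : LH + 3 * (k * ps Λ e C) ≤ (∑ i, capE (C i).1) * g + E := by
    have hfin : ∑ i, (3 - capE (C i).1) * g ≠ ⊤ := by
      refine ENNReal.sum_ne_top.2 fun i _ => ENNReal.mul_ne_top (ne_top_of_le_ne_top (by simp) (tsub_le_self (a := (3 : ℝ≥0∞)))) hgt
    rw [← ENNReal.add_le_add_iff_left hfin]
    calc _ = (LH + ∑ i, (3 - capE (C i).1) * g) + 3 * (k * ps Λ e C) := by ring
      _ ≤ (3 * ∑ i, kap Tk (fun A' => ps Λ γ (Function.update C i A')) (C i) + E) + 3 * (k * ps Λ e C) := by gcongr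
      _ = 3 * (∑ i, kap Tk (fun A' => ps Λ γ (Function.update C i A')) (C i) + k * ps Λ e C) + E := by ring
      _ = 3 * (k * g) + E := by rw [hstep]
      _ = ∑ i : Fin k, ((3 - capE (C i).1) + capE (C i).1) * g + E := by
        congr 1
        have : ∀ i, (3 - capE (C i).1) + capE (C i).1 = 3 := fun i => tsub_add_cancel_of_le (hcap3 i)
        simp_rw [this]
        rw [Finset.sum_const, Finset.card_univ, Fintype.card_fin, nsmul_eq_mul]; ring
      _ = _ := by
        simp_rw [add_mul]
        rw [Finset.sum_add_distrib, Finset.sum_mul]; ring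
  have hcapU : ∑ i, capE (C i).1 ≤ capE U + E := by
    have h1 : capE U = ∑ i, ∑ x ∈ (C i).1, es (↑U) x := sum_biUnion' C hdis _
    rw [h1, hE, ← Finset.sum_add_distrib]
    gcongr with i _
    unfold capE
    rw [← Finset.sum_add_distrib]
    gcongr with x hx
    have h2 : rho (↑U) x ≤ rho (↑(C i).1) x + ε i x := by
      have : (↑U : Set (Pt d)) = ↑(C i).1 ∪ ↑(U \ (C i).1) := by
        rw [← Finset.coe_union, Finset.union_sdiff_of_subset (hsub i)]
      conv_lhs => rw [this]
      exact HV_union_le (fun _ => le_rfl) x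
    have h3 : es (↑(C i).1) x ≤ es (↑U) x + ε i x := by
      rw [← ENNReal.add_le_add_iff_right (rho_ne_top hd0 (↑(C i).1) x), rho_add_es hd0]
      calc 1 = es (↑U) x + rho (↑U) x := (rho_add_es hd0 _ _).symm
        _ ≤ es (↑U) x + (rho (↑(C i).1) x + ε i x) := by gcongr
        _ = _ := by ring
    refine h3.trans ?_
    gcongr
    rw [div_eq_mul_inv]
    conv_lhs => rw [← mul_one (ε i x)]
    gcongr
    exact ENNReal.one_le_inv.2 (rho_le_one hd0 _ _)
  have hfinal : LH ≤ capE U * g := by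
    rw [← ENNReal.add_le_add_iff_right hEt]
    calc LH + 2 * E ≤ LH + 3 * (k * ps Λ e C) := by gcongr
      _ ≤ (∑ i, capE (C i).1) * g + E := hsum2
      _ ≤ (capE U + E) * g + E := by gcongr
      _ = capE U * g + E * g + E := by ring
      _ ≤ capE U * g + E * 1 + E := by gcongr
      _ = _ := by ring
  have hPG : PG G U = LH / capE U := by
    unfold PG
    rw [div_eq_mul_inv, hLH, ← sum_biUnion' C hdis, Finset.sum_mul]
    refine Finset.sum_congr rfl fun x _ => ?_
    rw [div_eq_mul_inv]; ring
  rw [hPG]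
  refine ENNReal.div_le_of_le_mul ?_
  rw [mul_comm]; exact hfinal

theorem exists_G (hd : 5 ≤ d) (k : ℕ) (hk : 2 ≤ k) (R : ℕ) : ∃ G : Finset (Pt d) → ℝ≥0∞,
    (∀ U, G U ≤ 1) ∧ (∀ V, sp V ≤ R → G V = 1) ∧ (∀ U, PG G U ≤ G U) ∧
    ∃ D : ℕ, ∀ C : Fin k → Kl d, (∀ i j, i ≠ j → (C i).1.card = 2 ∨ (C j).1.card = 2) → (∀ i, sp (C i).1 ≤ 2) →
      (∀ i j, i ≠ j → ∀ x ∈ (C i).1, ∀ z ∈ (C j).1, D ≤ nm (x - z)) →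
      G (Finset.univ.biUnion fun i => (C i).1) < 1 := by
  have hd0 : 0 < d := by omega
  obtain ⟨e, γ, hγ, he1, he2, _, _, hsep⟩ := two_body hd k hk
  obtain ⟨K, hKt, hK1, hK⟩ := rho_lower (d := d) hd
  set Λ : ℝ≥0∞ := K * ((R + 1 : ℕ) : ℝ≥0∞) ^ (2 * d) with hΛ
  have hΛ1 : 1 ≤ Λ := by
    calc (1 : ℝ≥0∞) = 1 * 1 := by simp
      _ ≤ _ := by
        rw [hΛ]
        gcongr
        apply one_le_pow₀
        exact_mod_cast (by omega : 1 ≤ R + 1)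
  have hΛt : Λ ≠ ⊤ := ENNReal.mul_ne_top hKt (ENNReal.pow_ne_top (ENNReal.natCast_ne_top _))
  have hγhh : ∀ A B : Kl d, ∀ x ∈ A.1, ∀ z ∈ B.1, hh (x - z) ≤ γ A B := by
    intro A B x hx z hz
    calc hh (x - z) ≤ ∑ z ∈ B.1, hh (x - z) := Finset.single_le_sum (f := fun z => hh (x - z)) (fun _ _ => bot_le) hz
      _ ≤ gg A.1 B.1 := Finset.single_le_sum (f := fun x => ∑ z ∈ B.1, hh (x - z)) (fun _ _ => bot_le) hx
      _ ≤ e A B := he1 A B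
      _ ≤ γ A B := by rw [hγ A B]; exact le_self_add
  have hps : ∀ (C : Fin k → Kl d) i j, i ≠ j → Λ * γ (C i) (C j) ≤ ps Λ γ C := by
    intro C i j hij
    unfold ps
    gcongr
    exact Finset.single_le_sum (f := fun p : Fin k × Fin k => γ (C p.1) (C p.2)) (fun _ _ => bot_le)
      (Finset.mem_offDiag.2 ⟨Finset.mem_univ i, Finset.mem_univ j, hij⟩ : (i, j) ∈ (Finset.univ : Finset (Fin k)).offDiag)
  set G : Finset (Pt d) → ℝ≥0∞ := fun U => min 1 (⨅ C : Fin k → Kl d, ⨅ _ : Finset.univ.biUnion (fun i => (C i).1) = U, ps Λ γ C) with hG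
  have hG1 : ∀ U, G U ≤ 1 := fun U => min_le_left _ _
  have hGg : ∀ C : Fin k → Kl d, G (Finset.univ.biUnion fun i => (C i).1) ≤ ps Λ γ C := fun C =>
    (min_le_right _ _).trans (iInf_le_of_le C (iInf_le_of_le rfl le_rfl))
  refine ⟨G, hG1, ?_, ?_, ?_⟩
  · intro V hV
    refine le_antisymm (hG1 V) (le_min le_rfl (le_iInf₂ fun C hC => ?_))
    set i : Fin k := ⟨0, by omega⟩
    set j : Fin k := ⟨1, by omega⟩
    have hij : i ≠ j := by simp [i, j]
    have hne : ∀ i, (C i).1.Nonempty := fun i => by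
      rw [← Finset.card_pos]; have := (C i).2.1; omega
    obtain ⟨x, hx⟩ := hne i
    obtain ⟨z, hz⟩ := hne j
    have hsub : ∀ i, (C i).1 ⊆ V := fun i => hC ▸ Finset.subset_biUnion_of_mem (fun i => (C i).1) (Finset.mem_univ i)
    refine le_trans ?_ (hps C i j hij)
    have h1 : rho {0} (x - z) ≤ γ (C i) (C j) := by
      refine le_trans ?_ (hγhh _ _ x hx z hz)
      have := rho_le_hh hd {0} (x - z)
      simpa using this
    have h2 : (rho {0} (x - z))⁻¹ ≤ Λ := by
      refine (hK _).trans ?_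
      rw [hΛ]
      gcongr
      exact (le_sp (hsub i hx) (hsub j hz)).trans hV
    calc 1 = (rho {0} (x - z))⁻¹ * rho {0} (x - z) :=
          (ENNReal.inv_mul_cancel (rho_zero_ne hd0 _) (rho_ne_top hd0 _ _)).symm
      _ ≤ _ := by gcongr
  · intro U
    refine le_min (PG_le_one hG1 U) (le_iInf₂ fun C hC => ?_)
    by_cases hlt : ps Λ γ C < 1
    · rw [← hC]
      refine main_ineq hd hk e γ hγ he2 Λ hΛ1 G hG1 hGg C ?_ hlt
      intro i j hij
      rw [Finset.disjoint_left]
      intro x hx hx'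
      refine absurd hlt (not_lt.2 (le_trans ?_ (hps C i j hij)))
      calc (1 : ℝ≥0∞) = 1 * 1 := by simp
        _ ≤ Λ * hh (x - x) := by
          gcongr
          rw [sub_self]; exact one_le_hh
        _ ≤ _ := by gcongr; exact hγhh _ _ x hx x hx'
    · exact (PG_le_one hG1 U).trans (not_lt.1 hlt)
  · set δ : ℝ≥0∞ := (2 * (Λ * ((k * k : ℕ) : ℝ≥0∞)))⁻¹ with hδ
    have hden : Λ * ((k * k : ℕ) : ℝ≥0∞) ≠ ⊤ := ENNReal.mul_ne_top hΛt (ENNReal.natCast_ne_top _)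
    have hden0 : Λ * ((k * k : ℕ) : ℝ≥0∞) ≠ 0 := by
      refine mul_ne_zero (fun h => by rw [h] at hΛ1; simp at hΛ1) ?_
      exact_mod_cast (by positivity : 0 < k * k).ne'
    have hδ0 : δ ≠ 0 := ENNReal.inv_ne_zero.2 (ENNReal.mul_ne_top (by simp) hden)
    obtain ⟨D, hD⟩ := hsep δ hδ0
    refine ⟨D, fun C h1 h2 h3 => ?_⟩
    have h4 : ps Λ γ C ≤ 2⁻¹ := by
      unfold ps
      calc _ ≤ Λ * ∑ p ∈ (Finset.univ : Finset (Fin k)).offDiag, δ := by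
            gcongr with p hp
            have hp' := (Finset.mem_offDiag.1 hp).2.2
            exact hD _ _ (h1 _ _ hp') (h2 _) (h2 _) (h3 _ _ hp')
        _ ≤ Λ * (((k * k : ℕ) : ℝ≥0∞) * δ) := by
            rw [Finset.sum_const, nsmul_eq_mul]
            gcongr
            rw [Finset.offDiag_card, Finset.card_univ, Fintype.card_fin]
            exact Nat.sub_le _ _
        _ = 2⁻¹ := by
            rw [hδ, ENNReal.mul_inv (Or.inl (by simp)) (Or.inl (by simp)), ← mul_assoc, mul_left_comm,
              ENNReal.mul_inv_cancel hden0 hden, mul_one]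
    refine (hGg C).trans_lt (h4.trans_lt ?_)
    exact ENNReal.inv_lt_one.2 (by norm_num)

end Lyap

section Hat
open Classical
open scoped ENNReal
variable {d : ℕ}

noncomputable def pE (U : Finset (Pt d)) (x y : Pt d) : ℝ≥0∞ :=
  if x ∈ U then es (↑U) x / capE U * (kW (↑(U.erase x)) x y / rho (↑(U.erase x)) x) else 0

noncomputable def PE (U V : Finset (Pt d)) : ℝ≥0∞ :=
  ∑' x, ∑' y, if V = insert y (U.erase x) then pE U x y else 0

lemma PE_sum (G : Finset (Pt d) → ℝ≥0∞) (U : Finset (Pt d)) : ∑' V, PE U V * G V = PG G U := by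
  unfold PE
  simp_rw [← ENNReal.tsum_mul_right]
  rw [ENNReal.tsum_comm]
  have h1 : ∀ x, ∑' V, ∑' y, (if V = insert y (U.erase x) then pE U x y else 0) * G V
      = if x ∈ U then es (↑U) x / capE U * (HV (↑(U.erase x)) (fun y => G (insert y (U.erase x))) x / rho (↑(U.erase x)) x) else 0 := by
    intro x
    rw [ENNReal.tsum_comm]
    have h2 : ∀ y, ∑' V, (if V = insert y (U.erase x) then pE U x y else 0) * G V = pE U x y * G (insert y (U.erase x)) := by
      intro y
      rw [tsum_eq_single (insert y (U.erase x))]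
      · simp
      · intro V hV; simp [hV]
    simp_rw [h2, pE]
    split_ifs with hx
    · rw [HV_eq_tsum]
      simp_rw [div_eq_mul_inv, mul_assoc]
      rw [ENNReal.tsum_mul_left, ENNReal.tsum_mul_left]
      congr 2
      rw [← ENNReal.tsum_mul_right]
      refine tsum_congr fun y => ?_
      ring
    · simp
  simp_rw [h1]
  rw [tsum_eq_sum (s := U)]
  · unfold PG
    refine Finset.sum_congr rfl fun x hx => by rw [if_pos hx]
  · intro x hx; rw [if_neg hx]

lemma PE_row (U : Finset (Pt d)) : ∑' V, PE U V ≤ 1 := by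
  have := PE_sum (fun _ => 1) U
  simp only [mul_one] at this
  rw [this]
  exact PG_le_one (fun _ => le_rfl) U

lemma pE_row (U : Finset (Pt d)) (x : Pt d) : ∑' y, pE U x y ≤ 1 := by
  refine le_trans ?_ (PE_row U)
  unfold PE
  rw [ENNReal.tsum_comm]
  refine le_trans ?_ (ENNReal.le_tsum x)
  rw [ENNReal.tsum_comm]
  refine ENNReal.tsum_le_tsum fun y => ?_
  refine le_trans ?_ (ENNReal.le_tsum (insert y (U.erase x)))
  simp

lemma pE_ne_top (U : Finset (Pt d)) (x y : Pt d) : pE U x y ≠ ⊤ :=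
  (((ENNReal.le_tsum y).trans (pE_row U x)).trans_lt ENNReal.one_lt_top).ne

lemma capa_eq (hd : 0 < d) (U : Finset (Pt d)) : capa d (↑U) = (capE U).toReal := by
  unfold capa capE
  rw [ENNReal.toReal_sum (fun x _ => ((es_le_one _ x).trans_lt ENNReal.one_lt_top).ne)]
  rw [Finset.tsum_subtype' U (fun x => esc d (↑U) x)]
  exact Finset.sum_congr rfl fun x hx => esc_eq hd _ x (Finset.mem_coe.2 hx)

lemma pHAT_eq (hd : 0 < d) (U : Finset (Pt d)) (x y : Pt d) : pHAT d U x y = (pE U x y).toReal := by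
  unfold pHAT harm transP pE
  split_ifs with hx
  · rw [hitFrom_eq, retProb_eq, esc_eq hd _ x (Finset.mem_coe.2 hx), capa_eq hd, ← Finset.coe_erase,
      ENNReal.toReal_mul, ENNReal.toReal_div, ENNReal.toReal_div]
  · have : esc d (↑U) x = 0 := by unfold esc; rw [if_neg]; simpa using hx
    simp [this]

lemma PE_ne_top (U V : Finset (Pt d)) : PE U V ≠ ⊤ :=
  (((ENNReal.le_tsum V).trans (PE_row U)).trans_lt ENNReal.one_lt_top).ne

lemma hatProb_eq (hd : 0 < d) (U V : Finset (Pt d)) : hatProb d U V = (PE U V).toReal := by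
  unfold hatProb PE
  have hfin : ∀ x, ∑' y, (if V = insert y (U.erase x) then pE U x y else 0) ≠ ⊤ := by
    intro x
    refine ((le_trans ?_ (pE_row U x)).trans_lt ENNReal.one_lt_top).ne
    refine ENNReal.tsum_le_tsum fun y => ?_
    split_ifs
    · exact le_rfl
    · exact bot_le
  have hfin' : ∀ x y, (if V = insert y (U.erase x) then pE U x y else 0) ≠ ⊤ := by
    intro x y
    split_ifs
    · exact pE_ne_top U x y
    · simp
  rw [ENNReal.tsum_toReal_eq hfin]
  split_ifs with hV
  · subst hV
    refine tsum_congr fun x => ?_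
    rw [ENNReal.tsum_toReal_eq (hfin' x), tsum_eq_single x]
    · by_cases hx : x ∈ V
      · rw [Finset.insert_erase hx, if_pos rfl, pHAT_eq hd]
      · rw [pHAT_eq hd]; simp [pE, hx]
    · intro y hy
      by_cases hx : x ∈ V
      · rw [if_neg]; · simp
        intro h
        have : x ∈ insert y (V.erase x) := h ▸ hx
        simp [hy.symm] at this
      · simp [pE, hx]
  · refine tsum_congr fun x => ?_
    rw [ENNReal.tsum_toReal_eq (hfin' x)]
    refine tsum_congr fun y => ?_
    by_cases hx : x ∈ U
    · by_cases hVV : V = insert y (U.erase x)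
      · have hxy : x ≠ y := by
          rintro rfl
          rw [Finset.insert_erase hx] at hVV
          exact hV hVV
        rw [if_pos ⟨hx, hxy, hVV⟩, if_pos hVV, pHAT_eq hd]
      · rw [if_neg (fun h => hVV h.2.2), if_neg hVV]; simp
    · simp [hx, pE]

lemma ofReal_hatProb (hd : 0 < d) (U V : Finset (Pt d)) : ENNReal.ofReal (hatProb d U V) = PE U V := by
  rw [hatProb_eq hd, ENNReal.ofReal_toReal (PE_ne_top U V)]

lemma PE_pos (hd : 0 < d) (U : Finset (Pt d)) (x y : Pt d) (hx : x ∈ U) (h1 : es (↑U) x ≠ 0)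
    (h2 : kW (↑(U.erase x)) x y ≠ 0) : PE U (insert y (U.erase x)) ≠ 0 := by
  unfold PE
  refine ne_of_gt (lt_of_lt_of_le ?_ (ENNReal.le_tsum x))
  refine lt_of_lt_of_le ?_ (ENNReal.le_tsum y)
  rw [if_pos rfl, pE, if_pos hx]
  refine pos_iff_ne_zero.2 (mul_ne_zero ?_ ?_)
  · refine (ENNReal.div_pos h1 ?_).ne'
    exact ((capE_le U).trans_lt (ENNReal.natCast_lt_top _)).ne
  · exact (ENNReal.div_pos h2 (rho_ne_top hd _ _)).ne'

lemma PE_sy {g : Pt d → Pt d} (hg : IsSy g) (hs : Function.Surjective g) (U V : Finset (Pt d)) :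
    PE (U.image g) (V.image g) = PE U V := by
  have hi := hg.1
  have herase : ∀ x, (U.image g).erase (g x) = (U.erase x).image g := by
    intro x; rw [Finset.image_erase hi]
  have hcap : capE (U.image g) = capE U := by
    unfold capE
    rw [Finset.sum_image (fun a _ b _ h => hi h), Finset.coe_image]
    exact Finset.sum_congr rfl fun x _ => es_sy hg _ x
  have hpE : ∀ x y, pE (U.image g) (g x) (g y) = pE U x y := by
    intro x y
    unfold pE
    rw [herase, Finset.coe_image, Finset.coe_image, es_sy hg, kW_sy hg, rho_sy hg, hcap]
    congr 1
    rw [Finset.mem_image]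
    exact propext ⟨fun ⟨a, ha, h⟩ => hi h ▸ ha, fun h => ⟨x, h, rfl⟩⟩
  unfold PE
  set e := Equiv.ofBijective g ⟨hi, hs⟩ with he
  rw [← e.tsum_eq]
  refine tsum_congr fun x => ?_
  rw [← e.tsum_eq]
  refine tsum_congr fun y => ?_
  change (if V.image g = insert (g y) ((U.image g).erase (g x)) then pE (U.image g) (g x) (g y) else 0) = _
  rw [hpE, herase, ← Finset.image_insert]
  congr 1
  exact propext (Finset.image_injective hi).eq_iff

lemma sym_comp (σ σ' : Equiv.Perm (Fin d)) (ε ε' : Fin d → ℤ) (v v' : Pt d) (x : Pt d) :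
    SymImage d σ ε v (SymImage d σ' ε' v' x) =
      SymImage d (σ.trans σ') (fun i => ε i * ε' (σ i)) (fun i => v i + ε i * v' (σ i)) x := by
  ext i; simp only [SymImage, Equiv.trans_apply]; ring

lemma sym_inv (σ : Equiv.Perm (Fin d)) (ε : Fin d → ℤ) (v : Pt d) (hε : ∀ i, ε i = 1 ∨ ε i = -1) (x : Pt d) :
    SymImage d σ ε v (SymImage d σ.symm (fun i => ε (σ.symm i)) (fun i => - (ε (σ.symm i) * v (σ.symm i))) x) = x := by
  ext i; simp only [SymImage, Equiv.symm_apply_apply]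
  rcases hε i with h | h <;> rw [h] <;> ring

lemma sym_inv' (σ : Equiv.Perm (Fin d)) (ε : Fin d → ℤ) (v : Pt d) (hε : ∀ i, ε i = 1 ∨ ε i = -1) (x : Pt d) :
    SymImage d σ.symm (fun i => ε (σ.symm i)) (fun i => - (ε (σ.symm i) * v (σ.symm i))) (SymImage d σ ε v x) = x := by
  apply (isSy_sym σ ε v hε).1
  rw [sym_inv σ ε v hε]

lemma symEq_image (U Y : Finset (Pt d)) (σ : Equiv.Perm (Fin d)) (ε : Fin d → ℤ) (v : Pt d) (hε : ∀ i, ε i = 1 ∨ ε i = -1) :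
    SymEq d U (Y.image (SymImage d σ ε v)) ↔ SymEq d U Y := by
  have key : ∀ (σ : Equiv.Perm (Fin d)) (ε : Fin d → ℤ) (v : Pt d), (∀ i, ε i = 1 ∨ ε i = -1) → ∀ Y, SymEq d U Y →
      SymEq d U (Y.image (SymImage d σ ε v)) := by
    rintro σ ε v hε Y ⟨σ', ε', v', hε', rfl⟩
    refine ⟨σ.trans σ', fun i => ε i * ε' (σ i), fun i => v i + ε i * v' (σ i), ?_, ?_⟩
    rotate_left
    · rw [Finset.image_image]
      exact Finset.image_congr (fun x _ => sym_comp σ σ' ε ε' v v' x)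
    · intro i
      rcases hε i with h | h <;> rcases hε' (σ i) with h' | h' <;> simp [h, h']
  refine ⟨fun h => ?_, key σ ε v hε Y⟩
  have := key σ.symm _ (fun i => - (ε (σ.symm i) * v (σ.symm i))) (fun i => hε (σ.symm i)) _ h
  rw [Finset.image_image] at this
  convert this
  conv_lhs => rw [← Finset.image_id (s := Y)]
  exact Finset.image_congr (fun x _ => (sym_inv' σ ε v hε x).symm)

lemma symEq_refl (U : Finset (Pt d)) : SymEq d U U := by
  refine ⟨Equiv.refl _, fun _ => 1, 0, fun _ => Or.inl rfl, ?_⟩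
  conv_lhs => rw [← Finset.image_id (s := U)]
  exact Finset.image_congr (fun x _ => by ext i; simp [SymImage])

lemma symEq_sp {U V : Finset (Pt d)} (h : SymEq d U V) : sp V ≤ sp U := by
  obtain ⟨σ, ε, v, hε, rfl⟩ := h
  rw [sp_le]
  intro x hx y hy
  rw [Finset.mem_image] at hx hy
  obtain ⟨a, ha, rfl⟩ := hx
  obtain ⟨b, hb, rfl⟩ := hy
  refine le_trans ?_ (le_sp ha hb)
  rw [nm_le]
  intro i
  refine le_trans (le_of_eq ?_) (le_nm (a - b) (σ i))
  have : (SymImage d σ ε v a - SymImage d σ ε v b) i = ε i * (a - b) (σ i) := by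
    simp only [SymImage, Pi.sub_apply]; ring
  rw [this, Int.natAbs_mul]
  rcases hε i with h | h <;> simp [h]

end Hat

section Markov
open Classical
open scoped ENNReal
variable {α : Type*}

/-- Probability of at least `N` visits to `S` within `T` steps. -/
noncomputable def vv (P : α → α → ℝ≥0∞) (S : Set α) : ℕ → ℕ → α → ℝ≥0∞
  | _, 0, _ => 1
  | 0, _ + 1, _ => 0
  | T + 1, N + 1, X => ∑' Y, P X Y * (if Y ∈ S then vv P S T N Y else vv P S T (N + 1) Y)

lemma vv_zero (P : α → α → ℝ≥0∞) (S : Set α) (T : ℕ) (X : α) : vv P S T 0 X = 1 := by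
  cases T <;> rfl

lemma vv_pow {P : α → α → ℝ≥0∞} {S : Set α} {r : ℝ≥0∞} (hr : ∀ T, ∀ Y ∈ S, vv P S T 1 Y ≤ r) (T N : ℕ) (X : α) :
    vv P S T (N + 1) X ≤ vv P S T 1 X * r ^ N := by
  induction T generalizing N X with
  | zero => simp [vv]
  | succ T ih =>
    rw [vv, vv, ← ENNReal.tsum_mul_right]
    refine ENNReal.tsum_le_tsum fun Y => ?_
    rw [mul_assoc]
    refine mul_le_mul_right ?_ _
    split_ifs with hY
    · rw [vv_zero, one_mul]
      cases N with
      | zero => rw [vv_zero]; simp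
      | succ M =>
        refine (ih M Y).trans ?_
        rw [pow_succ, mul_comm]
        exact mul_le_mul_right (hr T Y hY) _
    · exact ih N Y

lemma vv_le {P : α → α → ℝ≥0∞} {S : Set α} {G : α → ℝ≥0∞} (hS : ∀ Y ∈ S, G Y = 1)
    (hG : ∀ X, ∑' Y, P X Y * G Y ≤ G X) (T : ℕ) (X : α) : vv P S T 1 X ≤ G X := by
  induction T generalizing X with
  | zero => simp [vv]
  | succ T ih =>
    rw [vv]
    refine le_trans (ENNReal.tsum_le_tsum fun Y => ?_) (hG X)
    refine mul_le_mul_right ?_ _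
    split_ifs with hY
    · rw [vv_zero, hS Y hY]
    · exact ih Y

lemma vv_le_one {P : α → α → ℝ≥0∞} {S : Set α} (hP : ∀ X, ∑' Y, P X Y ≤ 1) (T : ℕ) (X : α) : vv P S T 1 X ≤ 1 :=
  vv_le (G := fun _ => 1) (fun _ _ => rfl) (fun X => by simpa using hP X) T X

lemma vv_inv {P : α → α → ℝ≥0∞} {S : Set α} (e : α ≃ α) (he : ∀ A B, P (e A) (e B) = P A B)
    (heS : ∀ A, e A ∈ S ↔ A ∈ S) (T N : ℕ) (X : α) : vv P S T N (e X) = vv P S T N X := by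
  induction T generalizing N X with
  | zero => cases N <;> rfl
  | succ T ih =>
    cases N with
    | zero => rw [vv_zero, vv_zero]
    | succ N =>
      rw [vv, vv, ← e.tsum_eq]
      refine tsum_congr fun Y => ?_
      rw [he]
      simp only [heS, ih]

lemma vv_reach {P : α → α → ℝ≥0∞} {S : Set α} {G : α → ℝ≥0∞} (hP : ∀ X, ∑' Y, P X Y ≤ 1) (hS : ∀ Y ∈ S, G Y = 1)
    (hG : ∀ X, ∑' Y, P X Y * G Y ≤ G X) {X V : α} (hXV : Relation.ReflTransGen (fun A B => P A B ≠ 0) X V) (hV : G V < 1) :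
    (∃ ρ < 1, ∀ T, vv P S T 1 X ≤ ρ) ∨ ∃ Y ∈ S, ∃ ρ < 1, ∀ T, vv P S T 1 Y ≤ ρ := by
  induction hXV using Relation.ReflTransGen.head_induction_on with
  | refl => exact Or.inl ⟨G V, hV, fun T => vv_le hS hG T V⟩
  | @head X X' hstep _ ih =>
    rcases ih with ⟨ρ, hρ, h⟩ | h
    · by_cases hX' : X' ∈ S
      · exact Or.inr ⟨X', hX', ρ, hρ, h⟩
      left
      have hpt : P X X' ≠ ⊤ := (((ENNReal.le_tsum X').trans (hP X)).trans_lt ENNReal.one_lt_top).ne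
      set q := P X X' * (1 - ρ) with hq
      have hq0 : q ≠ 0 := mul_ne_zero hstep (tsub_pos_of_lt hρ).ne'
      refine ⟨1 - q, ENNReal.sub_lt_self ENNReal.one_ne_top one_ne_zero hq0, fun T => ?_⟩
      cases T with
      | zero => simp [vv]
      | succ T =>
        rw [vv]
        have hqt : q ≠ ⊤ := ENNReal.mul_ne_top hpt (ENNReal.sub_ne_top ENNReal.one_ne_top)
        refine ENNReal.le_sub_of_add_le_right hqt ?_
        refine le_trans ?_ (hP X)
        have e1 : q = ∑' Y, if Y = X' then q else 0 := by rw [tsum_ite_eq]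
        rw [e1, ← ENNReal.tsum_add]
        refine ENNReal.tsum_le_tsum fun Y => ?_
        by_cases hY : Y = X'
        · subst hY
          rw [if_pos rfl, if_neg hX', hq, ← mul_add]
          calc _ ≤ P X Y * (ρ + (1 - ρ)) := mul_le_mul_right (add_le_add (h T) le_rfl) _
            _ = P X Y := by rw [add_tsub_cancel_of_le hρ.le, mul_one]
        · rw [if_neg hY, add_zero]
          conv_rhs => rw [← mul_one (P X Y)]
          refine mul_le_mul_right ?_ _
          split_ifs
          · rw [vv_zero]
          · exact vv_le_one hP T Y
    · exact Or.inr h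

noncomputable def cnt (S : Set α) (t T : ℕ) (ω : ℕ → α) : ℕ :=
  ∑ s ∈ Finset.range T, if ω (t + 1 + s) ∈ S then 1 else 0

lemma cnt_succ (S : Set α) (t T : ℕ) (ω : ℕ → α) :
    cnt S t (T + 1) ω = cnt S (t + 1) T ω + if ω (t + 1) ∈ S then 1 else 0 := by
  unfold cnt
  rw [Finset.sum_range_succ']
  simp only [add_zero, Nat.add_left_inj]
  exact Finset.sum_congr rfl fun s _ => by rw [show t + 1 + (s + 1) = t + 1 + 1 + s by ring]

open MeasureTheory in
lemma mu_cnt [Countable α] [MeasurableSpace α] {P : α → α → ℝ≥0∞} {S : Set α} {μ : Measure (ℕ → α)} {U : α}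
    (hμ : ∀ (t : ℕ) (u : ℕ → α), μ {ω | ∀ s ≤ t, ω s = u s} =
      (if u 0 = U then 1 else 0) * ∏ s ∈ Finset.range t, P (u s) (u (s + 1))) (T N t : ℕ) (u : ℕ → α) :
    μ {ω | (∀ s ≤ t, ω s = u s) ∧ N ≤ cnt S t T ω} ≤ μ {ω | ∀ s ≤ t, ω s = u s} * vv P S T N (u t) := by
  induction T generalizing N t u with
  | zero =>
    cases N with
    | zero => simp [vv]
    | succ N => simp [vv, cnt]
  | succ T ih =>
    cases N with
    | zero => simp [vv]
    | succ N =>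
      rw [vv]
      set w : α → ℕ → α := fun Y => Function.update u (t + 1) Y with hw
      have hwt : ∀ Y, ∀ s ≤ t, w Y s = u s := fun Y s hs => Function.update_of_ne (by omega) _ _
      have hw1 : ∀ Y, w Y (t + 1) = Y := fun Y => Function.update_self _ _ _
      have hcyl : ∀ Y, μ {ω | ∀ s ≤ t + 1, ω s = w Y s} = μ {ω | ∀ s ≤ t, ω s = u s} * P (u t) Y := by
        intro Y
        rw [hμ, hμ, Finset.prod_range_succ, hw1, hwt Y t le_rfl, hwt Y 0 (by omega), mul_assoc]
        congr 2
        refine Finset.prod_congr rfl fun s hs => ?_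
        rw [Finset.mem_range] at hs
        rw [hwt Y s (by omega), hwt Y (s + 1) (by omega)]
      have hsub : {ω : ℕ → α | (∀ s ≤ t, ω s = u s) ∧ N + 1 ≤ cnt S t (T + 1) ω} ⊆
          ⋃ Y, {ω | (∀ s ≤ t + 1, ω s = w Y s) ∧ (if Y ∈ S then N else N + 1) ≤ cnt S (t + 1) T ω} := by
        rintro ω ⟨h1, h2⟩
        rw [Set.mem_iUnion]
        refine ⟨ω (t + 1), fun s hs => ?_, ?_⟩
        · rcases Nat.lt_or_ge s (t + 1) with h | h
          · rw [hwt _ s (by omega)]; exact h1 s (by omega)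
          · obtain rfl : s = t + 1 := by omega
            rw [hw1]
        · rw [cnt_succ] at h2
          split_ifs at h2 ⊢ <;> omega
      refine (measure_mono hsub).trans ((measure_iUnion_le _).trans ?_)
      rw [← ENNReal.tsum_mul_left]
      refine ENNReal.tsum_le_tsum fun Y => ?_
      refine (ih _ (t + 1) (w Y)).trans ?_
      rw [hcyl, hw1, mul_assoc]
      split_ifs <;> exact le_rfl

open MeasureTheory in
theorem markov_transient [Countable α] [MeasurableSpace α] {P : α → α → ℝ≥0∞} {S : Set α} {μ : Measure (ℕ → α)} {U V : α}
    (hμ : ∀ (t : ℕ) (u : ℕ → α), μ {ω | ∀ s ≤ t, ω s = u s} =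
      (if u 0 = U then 1 else 0) * ∏ s ∈ Finset.range t, P (u s) (u (s + 1)))
    (G : α → ℝ≥0∞) (hP : ∀ X, ∑' Y, P X Y ≤ 1) (hS : ∀ Y ∈ S, G Y = 1)
    (hG : ∀ X, ∑' Y, P X Y * G Y ≤ G X) (hUV : Relation.ReflTransGen (fun A B => P A B ≠ 0) U V) (hV : G V < 1)
    (hinv : ∀ Y ∈ S, ∃ e : α ≃ α, e U = Y ∧ (∀ A B, P (e A) (e B) = P A B) ∧ ∀ A, e A ∈ S ↔ A ∈ S) :
    μ {ω | {t : ℕ | ω t ∈ S}.Infinite} = 0 := by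
  have hvv : ∀ Y ∈ S, ∀ T, vv P S T 1 Y = vv P S T 1 U := by
    intro Y hY T
    obtain ⟨e, rfl, h1, h2⟩ := hinv Y hY
    exact vv_inv e h1 h2 T 1 U
  have hr : ∃ ρ < 1, ∀ T, vv P S T 1 U ≤ ρ := by
    rcases vv_reach hP hS hG hUV hV with h | ⟨Y, hY, ρ, hρ, h⟩
    · exact h
    · exact ⟨ρ, hρ, fun T => hvv Y hY T ▸ h T⟩
  obtain ⟨r, hr1, hr⟩ := hr
  have hN : ∀ N T, μ {ω | N + 1 ≤ cnt S 0 T ω} ≤ r ^ N := by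
    intro N T
    have hsub : {ω : ℕ → α | N + 1 ≤ cnt S 0 T ω} ⊆ ⋃ Y : α, {ω | (∀ s ≤ 0, ω s = (fun _ => Y) s) ∧ N + 1 ≤ cnt S 0 T ω} := by
      intro ω h
      rw [Set.mem_iUnion]
      exact ⟨ω 0, fun s hs => by obtain rfl : s = 0 := by omega
                                 rfl, h⟩
    refine (measure_mono hsub).trans ((measure_iUnion_le _).trans ?_)
    refine (ENNReal.tsum_le_tsum fun Y => mu_cnt hμ T (N + 1) 0 (fun _ => Y)).trans ?_
    simp_rw [hμ]
    rw [tsum_eq_single U]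
    · simp only [if_true, Finset.range_zero, Finset.prod_empty, one_mul]
      refine (vv_pow (fun T Y hY => (hvv Y hY T).le.trans (hr T)) T N U).trans ?_
      calc _ ≤ 1 * r ^ N := mul_le_mul' (vv_le_one hP T U) le_rfl
        _ = _ := one_mul _
    · intro Y hY; simp [hY]
  have hall : ∀ N, μ {ω | {t : ℕ | ω t ∈ S}.Infinite} ≤ r ^ N := by
    intro N
    have hsub : {ω : ℕ → α | {t : ℕ | ω t ∈ S}.Infinite} ⊆ ⋃ T, {ω | N + 1 ≤ cnt S 0 T ω} := by
      intro ω h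
      rw [Set.mem_iUnion]
      by_contra hc
      push Not at hc
      apply h
      have h2 : ∀ T, ((Finset.range T).filter (fun s => ω (s + 1) ∈ S)).card ≤ N := by
        intro T
        have := hc T
        simp only [Set.mem_setOf_eq, not_le, cnt] at this
        rw [Finset.card_filter]
        simp only [zero_add] at this
        simp_rw [add_comm 1] at this
        omega
      have h3 : {s : ℕ | ω (s + 1) ∈ S}.Finite := by
        by_contra hinf
        obtain ⟨F, hF, hFc⟩ := Set.Infinite.exists_subset_card_eq hinf (N + 1)
        have := h2 (F.sup id + 1)
        have hle := Finset.card_le_card (s := F) (t := (Finset.range (F.sup id + 1)).filter (fun s => ω (s + 1) ∈ S)) (by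
          intro s hs
          rw [Finset.mem_filter, Finset.mem_range]
          exact ⟨Nat.lt_succ_of_le (Finset.le_sup (f := id) hs), hF hs⟩)
        omega
      refine ((h3.image (fun s => s + 1)).union (Set.finite_singleton 0)).subset ?_
      intro t ht
      cases t with
      | zero => right; rfl
      | succ t => left; exact ⟨t, ht, rfl⟩
    refine (measure_mono hsub).trans ?_
    rw [Monotone.measure_iUnion]
    · exact iSup_le fun T => hN N T
    · intro T T' hT ω h
      refine le_trans (show N + 1 ≤ cnt S 0 T ω from h) ?_
      exact Finset.sum_le_sum_of_subset (Finset.range_mono hT)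
  have hlim := ENNReal.tendsto_pow_atTop_nhds_zero_of_lt_one hr1
  exact le_antisymm (ge_of_tendsto' hlim hall) bot_le

end Markov

section Hat2
open Classical
open scoped ENNReal
open MeasureTheory
variable {d : ℕ}

theorem hat_transient_of (hd : 5 ≤ d) (U V : Conf d) (G : Finset (Pt d) → ℝ≥0∞)
    (hGS : ∀ V, sp V ≤ sp U → G V = 1) (hG : ∀ U, PG G U ≤ G U) (hV : G V < 1)
    (hUV : Relation.ReflTransGen (fun A B : Conf d => PE A B ≠ 0) U V)
    (μ : Measure (ℕ → Conf d)) (hμ : IsHATLaw d U μ) :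
    μ {ω | {t : ℕ | SymEq d U (ω t)}.Infinite} = 0 := by
  have hd0 : 0 < d := by omega
  refine markov_transient (P := PE) (S := {Y | SymEq d U Y}) (U := U) (V := V) ?_ G PE_row (fun Y hY => hGS Y (symEq_sp hY))
    (fun X => by rw [PE_sum]; exact hG X) hUV hV ?_
  · intro t u
    rw [hμ.2 t u]
    simp_rw [ofReal_hatProb hd0]
    congr
  · rintro Y ⟨σ, ε, v, hε, rfl⟩
    have hsy := isSy_sym σ ε v hε
    have hsur : Function.Surjective (SymImage d σ ε v) := fun x => ⟨_, sym_inv σ ε v hε x⟩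
    refine ⟨Equiv.ofBijective (Finset.image (SymImage d σ ε v)) ⟨Finset.image_injective hsy.1, ?_⟩, rfl, ?_, ?_⟩
    · intro A
      refine ⟨A.image (SymImage d σ.symm (fun i => ε (σ.symm i)) (fun i => - (ε (σ.symm i) * v (σ.symm i)))), ?_⟩
      rw [Finset.image_image]
      conv_rhs => rw [← Finset.image_id (s := A)]
      exact Finset.image_congr (fun x _ => sym_inv σ ε v hε x)
    · exact fun A B => PE_sy hsy hsur A B
    · exact fun A => symEq_image U A σ ε v hε

end Hat2

section Reach
open Classical
open scoped ENNReal
variable {d : ℕ}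

lemma kW_box (W : Set (Pt d)) (a b y : Pt d)
    (h : ∀ z : Pt d, (∀ i, (a i ≤ z i ∧ z i ≤ b i) ∨ (b i ≤ z i ∧ z i ≤ a i)) → z ∉ W) (hb : kW W b y ≠ 0) :
    kW W a y ≠ 0 := by
  generalize hn : ∑ i, (b i - a i).natAbs = n
  induction n using Nat.strong_induction_on generalizing a with
  | _ n ih =>
    by_cases hab : a = b
    · rw [hab]; exact hb
    obtain ⟨i, hi⟩ : ∃ i, a i ≠ b i := by
      by_contra hc; push Not at hc; exact hab (funext hc)
    have hstep : ∃ s : Fin d × Bool, (∀ j, j ≠ i → (a + stp s) j = a j) ∧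
        ((a i < b i ∧ (a + stp s) i = a i + 1) ∨ (b i < a i ∧ (a + stp s) i = a i - 1)) := by
      rcases lt_or_gt_of_ne hi with h1 | h1
      · refine ⟨(i, true), fun j hj => by simp [stp, hj], Or.inl ⟨h1, by simp [stp]⟩⟩
      · refine ⟨(i, false), fun j hj => by simp [stp, hj], Or.inr ⟨h1, by simp [stp]; ring⟩⟩
    obtain ⟨s, h1, h2⟩ := hstep
    have hbox : ∀ z : Pt d, (∀ j, ((a + stp s) j ≤ z j ∧ z j ≤ b j) ∨ (b j ≤ z j ∧ z j ≤ (a + stp s) j)) → z ∉ W := by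
      intro z hz
      apply h
      intro j
      have := hz j
      by_cases hj : j = i
      · subst hj; omega
      · rw [h1 j hj] at this; exact this
    have hlt : ∑ j, (b j - (a + stp s) j).natAbs < n := by
      rw [← hn]
      refine Finset.sum_lt_sum (fun j _ => ?_) ⟨i, Finset.mem_univ i, by omega⟩
      by_cases hj : j = i
      · subst hj; omega
      · rw [h1 j hj]
    have h3 := ih _ hlt (a + stp s) hbox rfl
    have h4 : a + stp s ∉ W := by
      refine hbox _ fun j => ?_
      by_cases hj : j = i
      · subst hj; omega
      · rw [h1 j hj]; omega
    intro h0
    have h5 := kW_step W a y s h4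
    rw [h0] at h5
    exact mul_ne_zero inv2d_ne_zero h3 (le_antisymm h5 bot_le)

lemma kW_self_ne (W : Set (Pt d)) (y : Pt d) (s : Fin d × Bool) (h : y + stp s ∈ W) : kW W y y ≠ 0 := by
  intro h0
  have := kW_self W y s h
  rw [h0] at this
  exact inv2d_ne_zero (le_antisymm this bot_le)

lemma exists_above (W : Finset (Pt d)) (i : Fin d) (a : ℤ) : ∃ N : ℤ, a ≤ N ∧ ∀ w ∈ W, w i < N := by
  induction W using Finset.induction_on with
  | empty => exact ⟨a, le_rfl, by simp⟩
  | insert w W _ ih =>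
    obtain ⟨N, h1, h2⟩ := ih
    refine ⟨max N (w i + 1), le_max_of_le_left h1, fun v hv => ?_⟩
    rcases Finset.mem_insert.1 hv with rfl | hv
    · exact lt_of_lt_of_le (by omega) (le_max_right _ _)
    · exact lt_of_lt_of_le (h2 v hv) (le_max_left _ _)

lemma move_over (hd : 5 ≤ d) (i0 i1 : Fin d) (h01 : i0 ≠ i1) (U : Finset (Pt d)) (x z : Pt d) (hx : x ∈ U) (hz : z ∈ U) (hxz : x ≠ z)
    (hmin : ∀ w ∈ U, x i0 ≤ w i0) (hmax : ∀ w ∈ U, w i0 ≤ z i0) :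
    PE U (insert (Function.update z i0 (z i0 + 1)) (U.erase x)) ≠ 0 := by
  have h10 := h01.symm
  refine PE_pos (by omega) U x _ hx ?_ ?_
  · refine es_pos_ray hd U x (i0, false) fun t ht hc => ?_
    have := hmin _ hc
    simp [stp] at this
    omega
  · obtain ⟨N, hN1, hN⟩ := exists_above (U.erase x) i1 (x i1)
    have hW : ∀ w : Pt d, w ∈ (↑(U.erase x) : Set (Pt d)) → w ≠ x ∧ w i1 < N ∧ x i0 ≤ w i0 ∧ w i0 ≤ z i0 := by
      intro w hw
      have hw' := Finset.mem_coe.1 hw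
      have hw2 := Finset.mem_erase.1 hw'
      exact ⟨hw2.1, hN w hw', hmin w hw2.2, hmax w hw2.2⟩
    have hxz0 := hmin z hz
    refine kW_box _ x (Function.update x i0 (x i0 - 1)) _ ?_ ?_
    · intro w hw hc
      obtain ⟨h1, h2, h3, h4⟩ := hW w hc
      apply h1
      ext i
      have := hw i
      by_cases hi : i = i0
      · subst hi; simp at this; omega
      · simp [hi] at this; omega
    refine kW_box _ _ (Function.update (Function.update x i0 (x i0 - 1)) i1 N) _ ?_ ?_
    · intro w hw hc
      obtain ⟨h1, h2, h3, h4⟩ := hW w hc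
      have := hw i0
      simp [h01] at this
      omega
    refine kW_box _ _ (Function.update (Function.update x i0 (z i0 + 1)) i1 N) _ ?_ ?_
    · intro w hw hc
      obtain ⟨h1, h2, h3, h4⟩ := hW w hc
      have := hw i1
      simp at this
      omega
    refine kW_box _ _ (Function.update z i0 (z i0 + 1)) _ ?_ ?_
    · intro w hw hc
      obtain ⟨h1, h2, h3, h4⟩ := hW w hc
      have := hw i0
      simp [h01] at this
      omega
    · refine kW_self_ne _ _ (i0, false) ?_
      have : Function.update z i0 (z i0 + 1) + stp (i0, false) = z := by
        ext i
        by_cases hi : i = i0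
        · subst hi; simp [stp]
        · simp [stp, hi]
      rw [this]
      exact Finset.mem_coe.2 (Finset.mem_erase.2 ⟨hxz.symm, hz⟩)

/-- The line configuration. -/
def ln (z : Pt d) (i0 : Fin d) (S : Finset ℤ) : Finset (Pt d) := S.image (fun a => Function.update z i0 a)

lemma upd_inj (z : Pt d) (i0 : Fin d) : Function.Injective (fun a : ℤ => Function.update z i0 a) :=
  Function.update_injective z i0

lemma mem_ln {z : Pt d} {i0 : Fin d} {S : Finset ℤ} {w : Pt d} : w ∈ ln z i0 S ↔ ∃ a ∈ S, Function.update z i0 a = w := by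
  simp [ln]

abbrev Rch (A B : Finset (Pt d)) : Prop := Relation.ReflTransGen (fun A B : Finset (Pt d) => PE A B ≠ 0) A B

lemma reach_line (hd : 5 ≤ d) (i0 i1 : Fin d) (h01 : i0 ≠ i1) (z : Pt d) (m k : ℕ) (A : Finset (Pt d)) (hz : z ∈ A) (hA : ∀ a ∈ A, a i0 ≤ z i0)
    (hk : A.card = k + 1) :
    Rch (A ∪ ln z i0 (Finset.Ioc (z i0) (z i0 + m))) (ln z i0 (Finset.Icc (z i0) (z i0 + m + k))) := by
  induction k generalizing A m with
  | zero =>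
    obtain ⟨w, rfl⟩ := Finset.card_eq_one.1 hk
    obtain rfl := Finset.mem_singleton.1 hz
    have : ({z} : Finset (Pt d)) ∪ ln z i0 (Finset.Ioc (z i0) (z i0 + m)) = ln z i0 (Finset.Icc (z i0) (z i0 + m + (0 : ℕ))) := by
      have e : Finset.Icc (z i0) (z i0 + m + (0 : ℕ)) = insert (z i0) (Finset.Ioc (z i0) (z i0 + m)) := by
        ext a; simp only [Finset.mem_Icc, Finset.mem_insert, Finset.mem_Ioc]; omega
      rw [e, ln, ln, Finset.image_insert, Function.update_eq_self]; rfl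
    rw [this]
  | succ k ih =>
    have hne : (A.erase z).Nonempty := by
      rw [← Finset.card_pos, Finset.card_erase_of_mem hz]; omega
    obtain ⟨x, hx, hxmin⟩ := Finset.exists_min_image (A.erase z) (fun w => w i0) hne
    have hx' := Finset.mem_erase.1 hx
    have hxz0 : x i0 ≤ z i0 := hA x hx'.2
    set L := ln z i0 (Finset.Ioc (z i0) (z i0 + m)) with hL
    have hLc : ∀ w ∈ L, z i0 < w i0 ∧ w i0 ≤ z i0 + m := by
      intro w hw
      obtain ⟨a, ha, rfl⟩ := mem_ln.1 hw
      simpa using ha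
    set t := Function.update z i0 (z i0 + m) with ht
    have htmem : t ∈ A ∪ L := by
      rcases Nat.eq_zero_or_pos m with rfl | hm
      · simp [ht, hz]
      · refine Finset.mem_union_right _ (mem_ln.2 ⟨z i0 + m, ?_, rfl⟩)
        rw [Finset.mem_Ioc]; omega
    have hxt : x ≠ t := by
      rintro rfl
      by_cases hm : m = 0
      · subst hm; simp [ht] at hx'
      · simp [ht] at hxz0; omega
    have hstep := move_over hd i0 i1 h01 (A ∪ L) x t (Finset.mem_union_left _ hx'.2) htmem hxt ?_ ?_
    · refine Relation.ReflTransGen.head hstep ?_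
      have h1 := ih (m + 1) (A.erase x) (Finset.mem_erase.2 ⟨hx'.1.symm, hz⟩) (fun a ha => hA a (Finset.mem_of_mem_erase ha))
        (by rw [Finset.card_erase_of_mem hx'.2, hk]; omega)
      have e1 : insert (Function.update t i0 (t i0 + 1)) ((A ∪ L).erase x) =
          A.erase x ∪ ln z i0 (Finset.Ioc (z i0) (z i0 + (m + 1 : ℕ))) := by
        have e2 : Finset.Ioc (z i0) (z i0 + (m + 1 : ℕ)) = insert (z i0 + m + 1) (Finset.Ioc (z i0) (z i0 + m)) := by
          ext a; simp only [Finset.mem_insert, Finset.mem_Ioc]; push_cast; omega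
        have e3 : Function.update t i0 (t i0 + 1) = Function.update z i0 (z i0 + m + 1) := by
          simp [ht]
        have e4 : ln z i0 (Finset.Ioc (z i0) (z i0 + (m + 1 : ℕ))) = insert (Function.update z i0 (z i0 + m + 1)) L := by
          rw [e2, ln, Finset.image_insert]; rfl
        have hxL : x ∉ L := fun h => by have := hLc x h; omega
        rw [e3, e4, Finset.erase_union_distrib, Finset.erase_eq_of_notMem hxL, Finset.union_insert]
      rw [e1]
      have e5 : z i0 + m + ((k + 1 : ℕ) : ℤ) = z i0 + ((m + 1 : ℕ) : ℤ) + k := by push_cast; ring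
      rw [e5]
      exact h1
    · intro w hw
      rcases Finset.mem_union.1 hw with h | h
      · by_cases hwz : w = z
        · rw [hwz]; exact hxz0
        · exact hxmin w (Finset.mem_erase.2 ⟨hwz, h⟩)
      · have := hLc w h; omega
    · intro w hw
      have : t i0 = z i0 + m := by simp [ht]
      rw [this]
      rcases Finset.mem_union.1 hw with h | h
      · have := hA w h; omega
      · exact (hLc w h).2

/-- One-dimensional moves. -/
def LR (S S' : Finset ℤ) : Prop :=
  ∃ a ∈ S, ∃ b, b ∉ S.erase a ∧ (b + 1 ∈ S.erase a ∨ b - 1 ∈ S.erase a) ∧ S' = insert b (S.erase a)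

lemma LR_PE (hd : 5 ≤ d) (i0 i1 : Fin d) (h01 : i0 ≠ i1) (z : Pt d) {S S' : Finset ℤ} (h : LR S S') :
    PE (ln z i0 S) (ln z i0 S') ≠ 0 := by
  obtain ⟨a, ha, b, hb, hadj, rfl⟩ := h
  have h10 := h01.symm
  have hinj := upd_inj z i0
  have e1 : (ln z i0 S).erase (Function.update z i0 a) = ln z i0 (S.erase a) := by
    unfold ln
    exact (Finset.image_erase hinj S a).symm
  have e2 : ln z i0 (insert b (S.erase a)) = insert (Function.update z i0 b) ((ln z i0 S).erase (Function.update z i0 a)) := by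
    rw [e1, ln, Finset.image_insert]; rfl
  rw [e2]
  refine PE_pos (by omega) _ _ _ (mem_ln.2 ⟨a, ha, rfl⟩) ?_ ?_
  · refine es_pos_ray hd _ _ (i1, true) fun t ht hc => ?_
    obtain ⟨c, hc, he⟩ := mem_ln.1 hc
    have := congrFun he i1
    simp [stp, h10] at this
    omega
  · rw [e1]
    have hW : ∀ w : Pt d, w ∈ (↑(ln z i0 (S.erase a)) : Set (Pt d)) → ∃ c, c ∈ S.erase a ∧ w i0 = c ∧ w i1 = z i1 := by
      intro w hw
      obtain ⟨c, hc, rfl⟩ := mem_ln.1 (Finset.mem_coe.1 hw)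
      exact ⟨c, hc, by simp, by simp [h10]⟩
    refine kW_box _ _ (Function.update (Function.update z i0 a) i1 (z i1 + 1)) _ ?_ ?_
    · intro w hw hc
      obtain ⟨c, h1, h2, h3⟩ := hW w hc
      have := hw i0
      simp [h01] at this
      obtain rfl : c = a := by omega
      simp at h1
    refine kW_box _ _ (Function.update (Function.update z i0 b) i1 (z i1 + 1)) _ ?_ ?_
    · intro w hw hc
      obtain ⟨c, h1, h2, h3⟩ := hW w hc
      have := hw i1
      simp at this
      omega
    refine kW_box _ _ (Function.update z i0 b) _ ?_ ?_
    · intro w hw hc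
      obtain ⟨c, h1, h2, h3⟩ := hW w hc
      have := hw i0
      simp [h01] at this
      obtain rfl : c = b := by omega
      exact hb h1
    · rcases hadj with h | h
      · refine kW_self_ne _ _ (i0, true) (Finset.mem_coe.2 (mem_ln.2 ⟨b + 1, h, ?_⟩))
        ext i
        by_cases hi : i = i0
        · subst hi; simp [stp]
        · simp [stp, hi]
      · refine kW_self_ne _ _ (i0, false) (Finset.mem_coe.2 (mem_ln.2 ⟨b - 1, h, ?_⟩))
        ext i
        by_cases hi : i = i0
        · subst hi; simp [stp]; ring
        · simp [stp, hi]

lemma LR_walk (m : ℕ) (hm : 2 ≤ m) (c : ℤ) (Z : Finset ℤ) (hZ : ∀ b ∈ Z, c + m ≤ b) (R : ℕ) :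
    Relation.ReflTransGen LR (Finset.Ico c (c + m) ∪ Z) (Finset.Ico (c - R) (c - R + m) ∪ Z) := by
  induction R with
  | zero => simp; exact Relation.ReflTransGen.refl
  | succ R ih =>
    refine ih.tail ⟨c - R + m - 1, ?_, c - R - 1, ?_, Or.inl ?_, ?_⟩
    · simp only [Finset.mem_union, Finset.mem_Ico]; left; omega
    · simp only [Finset.mem_erase, Finset.mem_union, Finset.mem_Ico]
      rintro ⟨_, h | h⟩
      · omega
      · have := hZ _ h; omega
    · simp only [Finset.mem_erase, Finset.mem_union, Finset.mem_Ico]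
      exact ⟨by omega, Or.inl (by omega)⟩
    · ext b
      simp only [Finset.mem_insert, Finset.mem_erase, Finset.mem_union, Finset.mem_Ico]
      push_cast
      by_cases hb : b ∈ Z
      · have := hZ b hb
        simp only [hb, or_true, and_true, true_iff]
        omega
      · simp only [hb, or_false]
        omega

lemma LR_split (D : ℕ) (k : ℕ) : ∀ (m : ℕ), 2 ≤ m → m / 2 = k → ∀ (c : ℤ) (Z : Finset ℤ), (∀ b ∈ Z, c + m ≤ b) →
    ∃ C : Fin k → Finset ℤ, Relation.ReflTransGen LR (Finset.Ico c (c + m) ∪ Z) (Finset.univ.biUnion C ∪ Z) ∧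
      (∀ i j, i ≠ j → (C i).card = 2 ∨ (C j).card = 2) ∧
      (∀ i, ∃ a, (C i = Finset.Ico a (a + 2) ∨ C i = Finset.Ico a (a + 3))) ∧
      (∀ i j, i ≠ j → ∀ a ∈ C i, ∀ b ∈ C j, D ≤ (a - b).natAbs) ∧
      (∀ i, ∀ a ∈ C i, ∀ b ∈ Z, D ≤ (a - b).natAbs) := by
  induction k with
  | zero => intro m h1 h2; omega
  | succ k ih =>
    intro m hm hk c Z hZ
    have hw := LR_walk m hm c Z hZ D
    set c' := c - D with hc'
    by_cases h4 : m < 4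
    · obtain rfl : k = 0 := by omega
      refine ⟨fun _ => Finset.Ico c' (c' + m), ?_, ?_, ?_, ?_, ?_⟩
      · simpa using hw
      · intro i j hij; exact absurd (Fin.ext (by omega)) hij
      · intro i
        refine ⟨c', ?_⟩
        interval_cases m
        · left; rfl
        · right; rfl
      · intro i j hij; exact absurd (Fin.ext (by omega)) hij
      · intro i a ha b hb
        rw [Finset.mem_Ico] at ha
        have := hZ b hb
        omega
    · push Not at h4
      set Dm : Finset ℤ := Finset.Ico (c' + m - 2) (c' + m - 2 + 2) with hDm
      obtain ⟨C, h1, h2, h3, h5, h6⟩ := ih (m - 2) (by omega) (by omega) (c' - 1) (Dm ∪ Z) (by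
        intro b hb
        rcases Finset.mem_union.1 hb with h | h
        · rw [hDm, Finset.mem_Ico] at h; omega
        · have := hZ b h; omega)
      have hstep : LR (Finset.Ico c' (c' + m) ∪ Z) (Finset.Ico (c' - 1) (c' - 1 + ((m - 2 : ℕ) : ℤ)) ∪ (Dm ∪ Z)) := by
        refine ⟨c' + m - 3, ?_, c' - 1, ?_, Or.inl ?_, ?_⟩
        · simp only [Finset.mem_union, Finset.mem_Ico]; left; omega
        · simp only [Finset.mem_erase, Finset.mem_union, Finset.mem_Ico]
          rintro ⟨_, h | h⟩
          · omega
          · have := hZ _ h; omega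
        · simp only [Finset.mem_erase, Finset.mem_union, Finset.mem_Ico]
          exact ⟨by omega, Or.inl (by omega)⟩
        · ext b
          simp only [hDm, Finset.mem_insert, Finset.mem_erase, Finset.mem_union, Finset.mem_Ico]
          by_cases hb : b ∈ Z
          · have := hZ b hb
            simp only [hb, or_true, and_true, true_iff]
            omega
          · simp only [hb, or_false]
            omega
      refine ⟨Fin.cons Dm C, ?_, ?_, ?_, ?_, ?_⟩
      · have e : Finset.univ.biUnion (Fin.cons Dm C : Fin (k + 1) → Finset ℤ) ∪ Z = Finset.univ.biUnion C ∪ (Dm ∪ Z) := by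
          ext b
          simp only [Finset.mem_union, Finset.mem_biUnion, Finset.mem_univ, true_and, Fin.exists_fin_succ, Fin.cons_zero, Fin.cons_succ]
          tauto
        rw [e]
        exact (hw.tail hstep).trans h1
      · have hcard : Dm.card = 2 := by rw [hDm, Int.card_Ico]; omega
        intro i j hij
        rcases Fin.eq_zero_or_eq_succ i with rfl | ⟨i', rfl⟩
        · left; rw [Fin.cons_zero]; exact hcard
        rcases Fin.eq_zero_or_eq_succ j with rfl | ⟨j', rfl⟩
        · right; rw [Fin.cons_zero]; exact hcard
        rw [Fin.cons_succ, Fin.cons_succ]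
        exact h2 i' j' (fun h => hij (by rw [h]))
      · intro i
        refine Fin.cases ?_ (fun i' => ?_) i
        · exact ⟨_, Or.inl rfl⟩
        · rw [Fin.cons_succ]; exact h3 i'
      · intro i j hij
        rcases Fin.eq_zero_or_eq_succ i with rfl | ⟨i', rfl⟩
        · rcases Fin.eq_zero_or_eq_succ j with rfl | ⟨j', rfl⟩
          · exact absurd rfl hij
          · rw [Fin.cons_zero, Fin.cons_succ]
            intro a ha b hb
            have := h6 j' b hb a (Finset.mem_union_left _ ha)
            omega
        · rcases Fin.eq_zero_or_eq_succ j with rfl | ⟨j', rfl⟩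
          · rw [Fin.cons_zero, Fin.cons_succ]
            exact fun a ha b hb => h6 i' a ha b (Finset.mem_union_left _ hb)
          · rw [Fin.cons_succ, Fin.cons_succ]
            exact h5 i' j' (fun h => hij (by rw [h]))
      · intro i
        refine Fin.cases ?_ (fun i' => ?_) i
        · intro a ha b hb
          rw [Fin.cons_zero, hDm, Finset.mem_Ico] at ha
          have := hZ b hb
          omega
        · rw [Fin.cons_succ]
          exact fun a ha b hb => h6 i' a ha b (Finset.mem_union_right _ hb)

lemma nm_line (z : Pt d) (i0 : Fin d) (a b : ℤ) : nm (Function.update z i0 a - Function.update z i0 b) = (a - b).natAbs := by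
  apply le_antisymm
  · rw [nm_le]
    intro i
    by_cases hi : i = i0
    · subst hi; simp
    · simp [hi]
  · have := le_nm (Function.update z i0 a - Function.update z i0 b) i0
    simpa using this

lemma good_ln (z : Pt d) (i0 : Fin d) (a : ℤ) (S : Finset ℤ) (h : S = Finset.Ico a (a + 2) ∨ S = Finset.Ico a (a + 3)) :
    Good (ln z i0 S) := by
  have hc : (ln z i0 S).card = S.card := Finset.card_image_of_injective _ (upd_inj z i0)
  have ha : a ∈ S ∧ a + 1 ∈ S := by
    rcases h with rfl | rfl <;> simp only [Finset.mem_Ico] <;> omega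
  refine ⟨?_, ?_, Function.update z i0 a, (i0, true), mem_ln.2 ⟨a, ha.1, rfl⟩, mem_ln.2 ⟨a + 1, ha.2, ?_⟩⟩
  · rw [hc]; rcases h with rfl | rfl <;> rw [Int.card_Ico] <;> omega
  · rw [hc]; rcases h with rfl | rfl <;> rw [Int.card_Ico] <;> omega
  · ext i
    by_cases hi : i = i0
    · subst hi; simp [stp]
    · simp [stp, hi]

theorem reach_far (hd : 5 ≤ d) (U : Finset (Pt d)) (n : ℕ) (hn : 4 ≤ n) (hU : U.card = n) (D : ℕ) :
    ∃ C : Fin (n / 2) → Kl d, (∀ i j, i ≠ j → (C i).1.card = 2 ∨ (C j).1.card = 2) ∧ (∀ i, sp (C i).1 ≤ 2) ∧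
      (∀ i j, i ≠ j → ∀ x ∈ (C i).1, ∀ z ∈ (C j).1, D ≤ nm (x - z)) ∧
      Rch U (Finset.univ.biUnion fun i => (C i).1) := by
  set i0 : Fin d := ⟨0, by omega⟩ with hi0
  set i1 : Fin d := ⟨1, by omega⟩ with hi1
  have h01 : i0 ≠ i1 := by simp [hi0, hi1]
  have hne : U.Nonempty := by rw [← Finset.card_pos]; omega
  obtain ⟨z, hz, hzmax⟩ := Finset.exists_max_image U (fun w => w i0) hne
  have h1 := reach_line hd i0 i1 h01 z 0 (n - 1) U hz hzmax (by omega)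
  have e1 : U ∪ ln z i0 (Finset.Ioc (z i0) (z i0 + (0 : ℕ))) = U := by simp [ln]
  have e2 : Finset.Icc (z i0) (z i0 + (0 : ℕ) + (n - 1 : ℕ)) = Finset.Ico (z i0) (z i0 + n) ∪ ∅ := by
    ext a; simp only [Finset.mem_Icc, Finset.mem_Ico, Finset.union_empty]; omega
  rw [e1, e2] at h1
  obtain ⟨C, h2, h3, h4, h5, _⟩ := LR_split D (n / 2) n (by omega) rfl (z i0) ∅ (by simp)
  have h6 : Rch (ln z i0 (Finset.Ico (z i0) (z i0 + n) ∪ ∅)) (ln z i0 (Finset.univ.biUnion C ∪ ∅)) :=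
    Relation.ReflTransGen.lift (p := fun A B : Finset (Pt d) => PE A B ≠ 0) (ln z i0)
      (fun S S' h => LR_PE hd i0 i1 h01 z h) _ _ h2
  have hgood : ∀ i, Good (ln z i0 (C i)) := fun i => by
    obtain ⟨a, ha⟩ := h4 i
    exact good_ln z i0 a _ ha
  have hcard : ∀ i, (ln z i0 (C i)).card = (C i).card := fun i => Finset.card_image_of_injective _ (upd_inj z i0)
  refine ⟨fun i => ⟨ln z i0 (C i), hgood i⟩, ?_, ?_, ?_, ?_⟩
  · intro i j hij
    simp only [hcard]
    exact h3 i j hij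
  · intro i
    rw [sp_le]
    intro x hx y hy
    obtain ⟨a, ha, rfl⟩ := mem_ln.1 hx
    obtain ⟨b, hb, rfl⟩ := mem_ln.1 hy
    rw [nm_line]
    obtain ⟨c, hc | hc⟩ := h4 i <;> rw [hc, Finset.mem_Ico] at ha hb <;> omega
  · intro i j hij x hx y hy
    obtain ⟨a, ha, rfl⟩ := mem_ln.1 hx
    obtain ⟨b, hb, rfl⟩ := mem_ln.1 hy
    rw [nm_line]
    exact h5 i j hij a ha b hb
  · have e3 : ln z i0 (Finset.univ.biUnion C ∪ ∅) = Finset.univ.biUnion fun i => ln z i0 (C i) := by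
      rw [Finset.union_empty, ln, Finset.biUnion_image]; rfl
    rw [e3] at h6
    exact h1.trans h6

end Reach

/-- **Transience in high dimensions.** HAT is transient for every `d ≥ 5` and `n ≥ 4`:
from any `n`-element configuration `U` in `ℤ^d`, almost surely the set of times `t` at
which `U_t` is a lattice-symmetry image of `U` is finite. -/
theorem hat_transient (d n : ℕ) (hd : 5 ≤ d) (hn : 4 ≤ n)
    (U : Conf d) (hU : U.card = n)
    (μ : Measure (ℕ → Conf d)) (hμ : IsHATLaw d U μ) :
    μ {ω | {t : ℕ | SymEq d U (ω t)}.Infinite} = 0 := by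
  obtain ⟨G, _, hGS, hG, D, hD⟩ := exists_G hd (n / 2) (by omega) (sp U)
  obtain ⟨C, h1, h2, h3, h4⟩ := reach_far hd U n hn hU D
  exact hat_transient_of hd U _ G hGS hG (hD C h1 h2 h3) h4 μ hμ

end HATFormal
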